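/- arXiv:2601.12121 — 2 statements merged into one kernel-verified Lean document; each statement's English description precedes it below -/
import Mathlib

section
/- For any dimension d ≥ 1, any weight vector w ∈ (0,1)^d, and any τ > 1, dim_H E_w(τ) = min_{1≤k≤d} (d + 1 + Σ_{i=1}^k (τ w_k − τ w_i)) / (1 + τ w_k). -/
open Real MeasureTheory Set

/-- The weighted norm `‖x‖_u = max_i |x_i|^(1/u_i)`. -/
noncomputable def wNorm {d : ℕ} (u : Fin d → ℝ) (x : Fin d → ℝ) : ℝ :=
  ⨆ i, |x i| ^ (1 / u i)

/-- The set `W_w(c,τ)` of `w`-weighted `(c,τ)`-approximable vectors in `[0,1)^d`. -/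
noncomputable def wApprox {d : ℕ} (w : Fin d → ℝ) (c τ : ℝ) : Set (Fin d → ℝ) :=
  {x | (∀ i, x i ∈ Set.Ico (0 : ℝ) 1) ∧
    {pq : (Fin d → ℤ) × ℕ | 0 < pq.2 ∧
      wNorm w (fun i => (pq.2 : ℝ) * x i - (pq.1 i : ℝ)) < c * (pq.2 : ℝ) ^ (-τ)}.Infinite}

/-- The set `E_w(τ)` of `w`-weighted `τ`-exactly-approximable vectors. -/
noncomputable def wExact {d : ℕ} (w : Fin d → ℝ) (τ : ℝ) : Set (Fin d → ℝ) :=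
  wApprox w 1 τ \ ⋃ c ∈ Set.Ioo (0 : ℝ) 1, wApprox w c τ

section
open Filter Topology


lemma wNorm_lt_iff {d : ℕ} (hd : 1 ≤ d) (w y : Fin d → ℝ) (hw : ∀ i, 0 < w i) {A : ℝ}
    (hA : 0 < A) : wNorm w y < A ↔ ∀ i, |y i| < A ^ (w i) := by
  have : Nonempty (Fin d) := ⟨⟨0, hd⟩⟩
  have key : ∀ i, (|y i| ^ (1 / w i) < A ↔ |y i| < A ^ (w i)) := by
    intro i
    rw [one_div]
    exact Real.rpow_inv_lt_iff_of_pos (abs_nonneg _) hA.le (hw i)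
  unfold wNorm
  constructor
  · intro h i
    rw [← key]
    exact lt_of_le_of_lt (le_ciSup (f := fun i => |y i| ^ (1 / w i)) (Set.finite_range _).bddAbove i) h
  · intro h
    obtain ⟨i, hi⟩ := exists_eq_ciSup_of_finite (f := fun i => |y i| ^ (1 / w i))
    rw [← hi]
    exact (key i).2 (h i)

/-- Packing lemma. -/
lemma packing {d : ℕ} {α : Type*} (S : Finset α) (f : α → Fin d → ℝ) (y h ρ : Fin d → ℝ)
    (hρ : ∀ i, 0 < ρ i) (hh : ∀ i, 0 ≤ h i)
    (mem : ∀ a ∈ S, ∀ i, |f a i - y i| ≤ h i)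
    (sep : ∀ a ∈ S, ∀ b ∈ S, a ≠ b → ∃ i, ρ i ≤ |f a i - f b i|) :
    (S.card : ℝ) ≤ ∏ i, (2 * h i / ρ i + 1) := by
  classical
  set g : α → Fin d → ℕ := fun a i => ⌊(f a i - y i + h i) / ρ i⌋₊ with hg
  have hnn : ∀ a ∈ S, ∀ i, 0 ≤ (f a i - y i + h i) / ρ i := by
    intro a ha i
    have := (abs_le.1 (mem a ha i)).1
    exact div_nonneg (by linarith) (hρ i).le
  have hcard : S.card ≤ (Fintype.piFinset (fun i => Finset.range (⌊2 * h i / ρ i⌋₊ + 1))).card := by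
    apply Finset.card_le_card_of_injOn g
    · intro a ha
      rw [Finset.mem_coe, Fintype.mem_piFinset]
      intro i
      rw [Finset.mem_range, Nat.lt_succ_iff]
      apply Nat.floor_le_floor
      have := (abs_le.1 (mem a ha i)).2
      have h2 := hρ i
      gcongr
      linarith
    · intro a ha b hb hab
      by_contra hne
      obtain ⟨i, hi⟩ := sep a ha b hb hne
      have h1 : ⌊(f a i - y i + h i) / ρ i⌋₊ = ⌊(f b i - y i + h i) / ρ i⌋₊ := congrFun hab i
      have a1 := Nat.floor_le (hnn a ha i)
      have a2 := Nat.lt_floor_add_one ((f a i - y i + h i) / ρ i)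
      have b1 := Nat.floor_le (hnn b hb i)
      have b2 := Nat.lt_floor_add_one ((f b i - y i + h i) / ρ i)
      rw [h1] at a1 a2
      have : |(f a i - y i + h i) / ρ i - (f b i - y i + h i) / ρ i| < 1 := by
        rw [abs_lt]; constructor <;> linarith
      rw [← sub_div, abs_div, abs_of_pos (hρ i), div_lt_one (hρ i)] at this
      have e : f a i - y i + h i - (f b i - y i + h i) = f a i - f b i := by ring
      rw [e] at this
      linarith
  calc (S.card : ℝ) ≤ ((Fintype.piFinset (fun i => Finset.range (⌊2 * h i / ρ i⌋₊ + 1))).card : ℝ) := by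
        exact_mod_cast hcard
    _ = ∏ i, ((⌊2 * h i / ρ i⌋₊ : ℝ) + 1) := by
        rw [Fintype.card_piFinset]; push_cast; simp
    _ ≤ _ := by
        apply Finset.prod_le_prod
        · intro i _; positivity
        · intro i _
          have : 0 ≤ 2 * h i / ρ i := div_nonneg (by linarith [hh i]) (hρ i).le
          linarith [Nat.floor_le this]

/-- Counting integer points in a box. -/
lemma int_box {d : ℕ} (S : Finset (Fin d → ℤ)) (y h : Fin d → ℝ) (hh : ∀ i, 0 ≤ h i)
    (mem : ∀ a ∈ S, ∀ i, |(a i : ℝ) - y i| ≤ h i) :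
    (S.card : ℝ) ≤ ∏ i, (2 * h i + 1) := by
  have := packing S (fun a i => (a i : ℝ)) y h (fun _ => 1) (by simp) hh mem (by
    intro a _ b _ hab
    obtain ⟨i, hi⟩ := Function.ne_iff.1 hab
    refine ⟨i, ?_⟩
    have : (1 : ℤ) ≤ |a i - b i| := Int.one_le_abs (sub_ne_zero.2 hi)
    exact_mod_cast this)
  simpa using this

/-- Counting residues. -/
lemma residue_count {d : ℕ} (q n : ℕ) (hq : q.Prime) (hn : 1 ≤ n) (hnq : n < q)
    (X : Fin d → ℝ) (hX : ∀ i, 0 ≤ X i) (S : Finset (Fin d → ℤ))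
    (hS : ∀ p ∈ S, ∀ i, 0 ≤ p i ∧ p i < q)
    (hP : ∀ p ∈ S, ∃ P : Fin d → ℤ, ∀ i, |(n : ℝ) * p i - P i * q| ≤ X i) :
    (S.card : ℝ) ≤ ∏ i, (2 * X i + 1) := by
  classical
  choose! P hP using hP
  have := packing S (fun p i => (((n : ℤ) * p i - P p i * q : ℤ) : ℝ)) (fun _ => 0) X (fun _ => 1)
    (by simp) hX (by
      intro p hp i
      have := hP p hp i
      push_cast
      simpa using this) (by
    intro a ha b hb hab
    obtain ⟨i, hi⟩ := Function.ne_iff.1 hab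
    refine ⟨i, ?_⟩
    have h1 : ((n : ℤ) * a i - P a i * q) - ((n : ℤ) * b i - P b i * q) ≠ 0 := by
      intro h0
      have hdvd : (q : ℤ) ∣ (n : ℤ) * (a i - b i) := ⟨P a i - P b i, by linarith⟩
      have hcop : IsCoprime (q : ℤ) (n : ℤ) := by
        rw [Nat.isCoprime_iff_coprime]
        exact Nat.coprime_of_lt_prime (by omega) hnq hq
      have h2 := hcop.dvd_of_dvd_mul_left hdvd
      have h3 := Int.eq_zero_of_abs_lt_dvd h2 (by
        have := hS a ha i; have := hS b hb i
        rw [abs_lt]; constructor <;> linarith)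
      exact hi (by linarith)
    have : (1 : ℤ) ≤ |((n : ℤ) * a i - P a i * q) - ((n : ℤ) * b i - P b i * q)| := Int.one_le_abs h1
    exact_mod_cast this)
  simpa using this

lemma exists_many_primes (η : ℝ) (hη : 0 < η) (N : ℕ) :
    ∃ Q : ℕ, N ≤ Q ∧ 1 ≤ Q ∧
      (Q : ℝ) ^ (1 - η) ≤ (((Finset.Ico Q (2 * Q)).filter Nat.Prime).card : ℝ) := by
  classical
  by_contra hcon
  push Not at hcon
  apply not_summable_one_div_on_primes
  set f : ℕ → ℝ := indicator {p : ℕ | p.Prime} (fun n : ℕ => (1 : ℝ) / n) with hf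
  have hf0 : ∀ n, 0 ≤ f n := by
    intro n; apply indicator_nonneg; intro x _; positivity
  set S : ℕ → ℝ := fun k => ∑ n ∈ Finset.range (2 ^ k), f n with hS
  have step : ∀ k, N ≤ k → S (k + 1) ≤ S k + ((2 : ℝ) ^ (-η)) ^ k := by
    intro k hk
    have h2k : N ≤ 2 ^ k := hk.trans k.lt_two_pow_self.le
    have hb := hcon (2 ^ k) h2k Nat.one_le_two_pow
    have e : S (k + 1) = S k + ∑ n ∈ Finset.Ico (2 ^ k) (2 * 2 ^ k), f n := by
      simp only [hS]
      rw [pow_succ', Finset.sum_range_add_sum_Ico _ (by omega)]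
    rw [e]
    gcongr
    have e2 : ∑ n ∈ Finset.Ico (2 ^ k) (2 * 2 ^ k), f n =
        ∑ n ∈ (Finset.Ico (2 ^ k) (2 * 2 ^ k)).filter Nat.Prime, (1 : ℝ) / n := by
      rw [Finset.sum_filter]
      apply Finset.sum_congr rfl
      intro n _
      simp [hf, indicator]
    rw [e2]
    calc _ ≤ ∑ n ∈ (Finset.Ico (2 ^ k) (2 * 2 ^ k)).filter Nat.Prime, ((2 : ℝ) ^ k)⁻¹ := by
          apply Finset.sum_le_sum
          intro n hn
          simp only [Finset.mem_filter, Finset.mem_Ico] at hn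
          rw [one_div]
          have : (2 : ℝ) ^ k ≤ n := by exact_mod_cast hn.1.1
          gcongr
      _ ≤ (((2 ^ k : ℕ) : ℝ) ^ (1 - η)) * ((2 : ℝ) ^ k)⁻¹ := by
          rw [Finset.sum_const, nsmul_eq_mul]
          gcongr
      _ = ((2 : ℝ) ^ (-η)) ^ k := by
          push_cast
          rw [← Real.rpow_natCast, ← Real.rpow_natCast, ← Real.rpow_mul (by norm_num),
            ← Real.rpow_mul (by norm_num), ← Real.rpow_neg (by norm_num),
            ← Real.rpow_add (by norm_num)]
          congr 1; ring
  have hlt : (2 : ℝ) ^ (-η) < 1 := Real.rpow_lt_one_of_one_lt_of_neg (by norm_num) (by linarith)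
  have hpos : 0 < (2 : ℝ) ^ (-η) := by positivity
  have bound : ∀ k, S (N + k) ≤ S N + ∑ j ∈ Finset.range (N + k), ((2 : ℝ) ^ (-η)) ^ j := by
    intro k
    induction k with
    | zero =>
      simp only [add_zero]
      have : 0 ≤ ∑ j ∈ Finset.range N, ((2 : ℝ) ^ (-η)) ^ j := Finset.sum_nonneg (fun _ _ => by positivity)
      linarith
    | succ k ih =>
      have := step (N + k) (by omega)
      rw [← add_assoc, Finset.sum_range_succ]
      linarith
  apply summable_of_sum_range_le (c := S N + (1 - (2 : ℝ) ^ (-η))⁻¹) hf0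
  intro n
  have h1 : ∑ i ∈ Finset.range n, f i ≤ S (N + n) := by
    apply Finset.sum_le_sum_of_subset_of_nonneg
    · apply Finset.range_subset_range.2
      exact (n.lt_two_pow_self.le).trans (Nat.pow_le_pow_right (by norm_num) (by omega))
    · intro i _ _; exact hf0 i
  have h2 := bound n
  have h3 : ∑ j ∈ Finset.range (N + n), ((2 : ℝ) ^ (-η)) ^ j ≤ (1 - (2 : ℝ) ^ (-η))⁻¹ := by
    rw [← tsum_geometric_of_lt_one hpos.le hlt]
    exact (summable_geometric_of_lt_one hpos.le hlt).sum_le_tsum _ (fun _ _ => by positivity)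
  linarith


lemma expA {d : ℕ} (w : Fin d → ℝ) (τ s0 : ℝ) (hs0 : 0 < s0) (hs0d : s0 ≤ d)
    (H : ∀ k, s0 * (1 + τ * w k) ≤ d + 1 + ∑ i, max 0 (τ * w k - τ * w i)) (t : ℝ) :
    s0 * (1 + t) ≤ d + 1 + ∑ i, max 0 (t - τ * w i) := by
  classical
  set A : Finset (Fin d) := Finset.univ.filter (fun i => τ * w i ≤ t) with hA
  have e1 : ∑ i, max 0 (t - τ * w i) = ∑ i ∈ A, (t - τ * w i) := by
    rw [hA, Finset.sum_filter]
    apply Finset.sum_congr rfl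
    intro i _
    split_ifs with h
    · exact max_eq_right (by linarith)
    · exact max_eq_left (by linarith)
  have main : ∀ T : ℝ, (∀ i ∈ A, τ * w i ≤ T) → (∀ i ∉ A, T ≤ τ * w i) →
      ∑ i, max 0 (T - τ * w i) = ∑ i ∈ A, (t - τ * w i) + (A.card : ℝ) * (T - t) := by
    intro T h1 h2
    have : ∑ i, max 0 (T - τ * w i) = ∑ i ∈ A, (T - τ * w i) := by
      have e3 : ∑ i ∈ A, (T - τ * w i) = ∑ i ∈ A, max 0 (T - τ * w i) := by
        apply Finset.sum_congr rfl
        intro i hi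
        exact (max_eq_right (by linarith [h1 i hi])).symm
      rw [e3]
      symm
      apply Finset.sum_subset (Finset.subset_univ _)
      intro i _ hi
      exact max_eq_left (by linarith [h2 i hi])
    rw [this, ← nsmul_eq_mul, ← Finset.sum_const, ← Finset.sum_add_distrib]
    apply Finset.sum_congr rfl
    intro i _; ring
  rw [e1]
  by_cases hc : s0 ≤ A.card
  · have hne : A.Nonempty := by
      rw [← Finset.card_pos]
      have : (0 : ℝ) < A.card := by linarith
      exact_mod_cast this
    obtain ⟨k, hk, hmax⟩ := Finset.exists_max_image A (fun i => τ * w i) hne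
    have hkt : τ * w k ≤ t := by simpa [hA] using hk
    have h3 := main (τ * w k) hmax (by
      intro i hi
      have : t < τ * w i := by simpa [hA] using hi
      linarith)
    have := H k
    rw [h3] at this
    nlinarith
  · push Not at hc
    have hne : (Aᶜ).Nonempty := by
      rw [← Finset.card_pos, Finset.card_compl, Fintype.card_fin]
      have : (A.card : ℝ) < d := by linarith
      have : A.card < d := by exact_mod_cast this
      omega
    obtain ⟨k, hk, hmin⟩ := Finset.exists_min_image (Aᶜ) (fun i => τ * w i) hne
    have hkt : t < τ * w k := by simpa [hA] using hk
    have h3 := main (τ * w k) (by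
      intro i hi
      have : τ * w i ≤ t := by simpa [hA] using hi
      linarith) (by
      intro i hi
      exact hmin i (by simpa using hi))
    have := H k
    rw [h3] at this
    nlinarith

lemma waterfill {d : ℕ} (w : Fin d → ℝ) (hw0 : ∀ i, 0 < w i) (hw1 : ∀ i, w i < 1)
    (hwsum : ∑ i, w i = 1) (τ : ℝ) (hτ : 1 < τ) :
    ∃ lam : ℝ, 0 < lam ∧ ∑ i, min (τ * w i) lam = 1 := by
  have hcont : Continuous (fun l : ℝ => ∑ i, min (τ * w i) l) := by fun_prop
  have hτ0 : (0 : ℝ) ≤ τ := by linarith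
  have := intermediate_value_Icc hτ0 hcont.continuousOn
  have h0 : ∑ i, min (τ * w i) (0 : ℝ) = 0 := by
    apply Finset.sum_eq_zero
    intro i _
    apply min_eq_right
    have := hw0 i; positivity
  have h1 : ∑ i, min (τ * w i) τ = τ := by
    have : ∀ i, min (τ * w i) τ = τ * w i := fun i => min_eq_left (by nlinarith [hw1 i])
    simp only [this]
    rw [← Finset.mul_sum, hwsum, mul_one]
  rw [h0, h1] at this
  obtain ⟨l, hl, hl1⟩ := this ⟨zero_le_one, hτ.le⟩
  refine ⟨l, ?_, hl1⟩
  rcases hl.1.lt_or_eq with h | h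
  · exact h
  · subst h
    simp only [] at hl1
    rw [h0] at hl1
    norm_num at hl1

lemma expB {d : ℕ} (w : Fin d → ℝ) (hw0 : ∀ i, 0 < w i) (hw1 : ∀ i, w i < 1)
    (hwsum : ∑ i, w i = 1) (τ s0 s : ℝ) (hτ : 1 < τ) (hs : 0 < s) (hss : s < s0) (hs0d : s0 ≤ d)
    (H : ∀ k, s0 * (1 + τ * w k) ≤ d + 1 + ∑ i, max 0 (τ * w k - τ * w i)) :
    ∃ (u : Fin d → ℝ) (η : ℝ), 0 < η ∧ (∀ i, 0 < u i) ∧ (∀ i, u i < τ * w i) ∧ ∑ i, u i = 1 ∧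
      ∀ t, 0 ≤ t → ∑ i, (max 0 (u i - t) + min 0 (τ * w i - t)) ≤ d + 1 - (1 + t) * s - 2 * η := by
  obtain ⟨τ', h1, h2, h3⟩ : ∃ τ', 1 < τ' ∧ τ' < τ ∧ τ - τ' ≤ (s0 - s) / 2 := by
    refine ⟨max ((1 + τ) / 2) (τ - (s0 - s) / 2), ?_, ?_, ?_⟩
    · exact lt_max_of_lt_left (by linarith)
    · exact max_lt (by linarith) (by linarith)
    · have := le_max_right ((1 + τ) / 2) (τ - (s0 - s) / 2)
      linarith
  obtain ⟨l, hl0, hl⟩ := waterfill w hw0 hw1 hwsum τ' h1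
  refine ⟨fun i => min (τ' * w i) l, (s0 - s) / 4, by linarith, ?_, ?_, hl, ?_⟩
  · intro i
    have := hw0 i
    exact lt_min (by positivity) hl0
  · intro i
    have := hw0 i
    exact lt_of_le_of_lt (min_le_left _ _) (by nlinarith)
  · intro t ht
    have hA := expA w τ s0 (by linarith) hs0d H t
    by_cases htl : l ≤ t
    · have : ∑ i, (max 0 (min (τ' * w i) l - t) + min 0 (τ * w i - t)) =
          - ∑ i, max 0 (t - τ * w i) := by
        rw [← Finset.sum_neg_distrib]
        apply Finset.sum_congr rfl
        intro i _
        rw [max_eq_left (by have := min_le_right (τ' * w i) l; linarith), zero_add]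
        rcases le_total t (τ * w i) with h | h
        · rw [min_eq_left (by linarith), max_eq_left (by linarith)]; simp
        · rw [min_eq_right (by linarith), max_eq_right (by linarith)]; ring
      rw [this]
      nlinarith
    · push Not at htl
      have : ∑ i, (max 0 (min (τ' * w i) l - t) + min 0 (τ * w i - t)) ≤
          ∑ i, (min (τ' * w i) l - t + (τ - τ') * w i) := by
        apply Finset.sum_le_sum
        intro i _
        have hwi := hw0 i
        have hx : 0 ≤ (τ - τ') * w i := by nlinarith
        have m0 := min_le_left 0 (τ * w i - t)
        have m1 := min_le_right 0 (τ * w i - t)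
        rcases le_total l (τ' * w i) with h | h
        · rw [min_eq_right h, max_eq_right (by linarith)]
          linarith
        · rw [min_eq_left h]
          rcases le_total t (τ' * w i) with h' | h'
          · rw [max_eq_right (by linarith)]; linarith
          · rw [max_eq_left (by linarith)]; linarith
      have e : ∑ i, (min (τ' * w i) l - t + (τ - τ') * w i) = 1 - d * t + (τ - τ') := by
        rw [Finset.sum_add_distrib, Finset.sum_sub_distrib, hl, ← Finset.mul_sum, hwsum]
        simp
      rw [e] at this
      nlinarith

lemma expC {d : ℕ} (w u : Fin d → ℝ) (τ s η : ℝ)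
    (hB : ∀ t, 0 ≤ t → ∑ i, (max 0 (u i - t) + min 0 (τ * w i - t)) ≤ d + 1 - (1 + t) * s - 2 * η)
    (Q r : ℝ) (hQ : 1 < Q) (hr : 0 < r) (hrQ : r ≤ 1 / Q) :
    (∏ i, max 1 (r * Q ^ (1 + u i))) * ∏ i, min 1 (r * Q ^ (1 + τ * w i)) ≤
      r ^ s * Q ^ ((d : ℝ) + 1 - 2 * η) := by
  have hQ0 : 0 < Q := by linarith
  have hlQ : 0 < Real.log Q := Real.log_pos hQ
  set t : ℝ := - Real.log r / Real.log Q - 1 with ht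
  have hrt : r = Q ^ (-(1 + t)) := by
    rw [Real.rpow_def_of_pos hQ0, ht]
    have : Real.log Q * -(1 + (-Real.log r / Real.log Q - 1)) = Real.log r := by
      field_simp; ring
    rw [this, Real.exp_log hr]
  have ht0 : 0 ≤ t := by
    have h1 : Real.log r ≤ - Real.log Q := by
      rw [← Real.log_inv, ← one_div]
      exact Real.log_le_log hr hrQ
    rw [ht, sub_nonneg, le_div_iff₀ hlQ]
    linarith
  have e1 : ∀ a : ℝ, r * Q ^ (1 + a) = Q ^ (a - t) := by
    intro a
    rw [hrt, ← Real.rpow_add hQ0]; congr 1; ring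
  have emax : ∀ a : ℝ, max 1 (Q ^ a) = Q ^ (max 0 a) := by
    intro a
    rcases le_total 0 a with h | h
    · rw [max_eq_right h, max_eq_right (Real.one_le_rpow hQ.le h)]
    · rw [max_eq_left h, max_eq_left (Real.rpow_le_one_of_one_le_of_nonpos hQ.le h), Real.rpow_zero]
  have emin : ∀ a : ℝ, min 1 (Q ^ a) = Q ^ (min 0 a) := by
    intro a
    rcases le_total 0 a with h | h
    · rw [min_eq_left h, min_eq_left (Real.one_le_rpow hQ.le h), Real.rpow_zero]
    · rw [min_eq_right h, min_eq_right (Real.rpow_le_one_of_one_le_of_nonpos hQ.le h)]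
  simp only [e1, emax, emin]
  rw [← Finset.prod_mul_distrib]
  simp only [← Real.rpow_add hQ0]
  rw [← Real.rpow_sum_of_pos hQ0, hrt, ← Real.rpow_mul hQ0.le, ← Real.rpow_add hQ0]
  apply Real.rpow_le_rpow_of_exponent_le hQ.le
  have := hB t ht0
  linarith


lemma upper_aux {d : ℕ} (hd : 1 ≤ d) (w : Fin d → ℝ) (hw0 : ∀ i, 0 < w i) (τ : ℝ) (hτ : 1 < τ)
    (k : Fin d) (s : ℝ) (hs : 0 < s)
    (H : d + 1 + ∑ i, max 0 (τ * w k - τ * w i) < (1 + τ * w k) * s) :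
    μH[s] (wApprox w 1 τ) = 0 := by
  classical
  set e : Fin d → ℝ := fun i => max 0 (τ * w k - τ * w i) with he
  set M : ℕ → Fin d → ℕ := fun q i => ⌊2 * (q : ℝ) ^ (τ * w k - τ * w i)⌋₊ + 1 with hM
  set ρ : ℕ → ℝ := fun q => (q : ℝ) ^ (-1 - τ * w k) with hρ
  set a : (q : ℕ) → (Fin d → Fin (q + 1)) × ((i : Fin d) → Fin (M q i)) → Fin d → ℝ :=
    fun q pm i => ((pm.1 i : ℕ) : ℝ) / q - (q : ℝ) ^ (-1 - τ * w i) + (pm.2 i : ℕ) * ρ q with ha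
  set t : (N : ℕ) → (Σ j : ℕ, (Fin d → Fin (j + N + 1 + 1)) × ((i : Fin d) → Fin (M (j + N + 1) i))) →
      Set (Fin d → ℝ) :=
    fun N x => Set.Icc (a (x.1 + N + 1) x.2) (fun i => a (x.1 + N + 1) x.2 i + ρ (x.1 + N + 1)) with ht
  have hτw : ∀ i, 0 < τ * w i := fun i => mul_pos (by linarith) (hw0 i)
  have hdiam : ∀ N x, Metric.ediam (t N x) ≤ ENNReal.ofReal (ρ (x.1 + N + 1)) := by
    intro N x
    have hρ0 : 0 ≤ ρ (x.1 + N + 1) := by simp only [hρ]; positivity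
    apply Metric.ediam_le
    intro y hy z hz
    rw [edist_dist]
    apply ENNReal.ofReal_le_ofReal
    rw [dist_pi_le_iff hρ0]
    intro i
    rw [Real.dist_eq, abs_le]
    have h1 := hy.1 i; have h2 := hy.2 i; have h3 := hz.1 i; have h4 := hz.2 i
    simp only at h2 h4
    constructor <;> linarith
  set f : ℕ → ℝ := fun q => 6 ^ d * (q : ℝ) ^ (d + ∑ i, e i - (1 + τ * w k) * s) with hf
  have hsumm : Summable f := by
    apply Summable.mul_left
    rw [Real.summable_nat_rpow]
    linarith
  have hf0 : ∀ n, 0 ≤ f n := fun n => by simp only [hf]; positivity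
  have htail : Tendsto (fun N => ∑' j, ENNReal.ofReal (f (j + (N + 1)))) atTop (𝓝 0) := by
    have h1 : ∑' j, ENNReal.ofReal (f j) ≠ ⊤ := by
      rw [← ENNReal.ofReal_tsum_of_nonneg hf0 hsumm]
      exact ENNReal.ofReal_ne_top
    exact (tendsto_add_atTop_iff_nat 1).2 (ENNReal.tendsto_sum_nat_add (fun j => ENNReal.ofReal (f j)) h1)
  have hle := Measure.hausdorffMeasure_le_liminf_tsum s (wApprox w 1 τ) (l := atTop)
    (fun N : ℕ => ENNReal.ofReal ((N : ℝ) + 1)⁻¹) (by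
      rw [← ENNReal.ofReal_zero]
      apply ENNReal.tendsto_ofReal
      simpa [one_div] using tendsto_one_div_add_atTop_nhds_zero_nat (𝕜 := ℝ)) t
    (by
      apply Eventually.of_forall
      intro N x
      refine (hdiam N x).trans (ENNReal.ofReal_le_ofReal ?_)
      simp only [hρ]
      have h1 : (1 : ℝ) ≤ ((x.1 + N + 1 : ℕ) : ℝ) := by push_cast; linarith [(Nat.cast_nonneg x.1 : (0:ℝ) ≤ x.1), (Nat.cast_nonneg N : (0:ℝ) ≤ N)]
      calc ((x.1 + N + 1 : ℕ) : ℝ) ^ (-1 - τ * w k) ≤ ((x.1 + N + 1 : ℕ) : ℝ) ^ (-1 : ℝ) := by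
            apply Real.rpow_le_rpow_of_exponent_le h1
            linarith [hτw k]
        _ ≤ _ := by
            rw [Real.rpow_neg_one]
            have : (N : ℝ) + 1 ≤ ((x.1 + N + 1 : ℕ) : ℝ) := by push_cast; linarith [(Nat.cast_nonneg x.1 : (0:ℝ) ≤ x.1)]
            gcongr)
    (by
      apply Eventually.of_forall
      intro N x hx
      obtain ⟨hx01, hinf⟩ := hx
      -- find a pair with large denominator
      obtain ⟨pq, hpq, hqN⟩ : ∃ pq : (Fin d → ℤ) × ℕ, (0 < pq.2 ∧
          wNorm w (fun i => (pq.2 : ℝ) * x i - (pq.1 i : ℝ)) < 1 * (pq.2 : ℝ) ^ (-τ)) ∧ N < pq.2 := by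
        by_contra hcon
        push Not at hcon
        apply hinf
        apply Set.Finite.subset (s := (Set.Icc (fun _ => -1) (fun _ => (N : ℤ) + 1)) ×ˢ (Set.Iic N))
        · exact (Set.finite_Icc _ _).prod (Set.finite_Iic _)
        · rintro pq hpq
          have hN := hcon pq hpq
          have hq : 0 < pq.2 := hpq.1
          have hq1 : (1 : ℝ) ≤ pq.2 := by exact_mod_cast hq
          have h2 := (wNorm_lt_iff hd w _ hw0 (by positivity)).1 hpq.2
          refine ⟨⟨fun i => ?_, fun i => ?_⟩, hN⟩
          all_goals
            have h3 := h2 i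
            rw [one_mul, ← Real.rpow_mul (by positivity)] at h3
            have h4 : (pq.2 : ℝ) ^ (-τ * w i) ≤ 1 := Real.rpow_le_one_of_one_le_of_nonpos hq1 (by nlinarith [hτw i])
            have h5 := abs_lt.1 (lt_of_lt_of_le h3 h4)
            have h6 := hx01 i
            have hNr : (pq.2 : ℝ) ≤ N := by exact_mod_cast hN
          · have : (-1 : ℝ) ≤ pq.1 i := by nlinarith [h5.2, h6.1, h6.2, mul_nonneg (by linarith : (0:ℝ) ≤ pq.2) h6.1]
            exact_mod_cast this
          · have : (pq.1 i : ℝ) ≤ N + 1 := by nlinarith [h5.1, h6.1, h6.2]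
            exact_mod_cast this
      obtain ⟨P, q⟩ := pq
      simp only at hpq hqN
      obtain ⟨j, rfl⟩ : ∃ j, q = j + N + 1 := ⟨q - N - 1, by omega⟩
      set q := j + N + 1 with hq
      have hq0 : (0 : ℝ) < q := by exact_mod_cast hpq.1
      have hq1 : (1 : ℝ) ≤ q := by exact_mod_cast hpq.1
      have h2 := (wNorm_lt_iff hd w _ hw0 (by positivity)).1 hpq.2
      have h3 : ∀ i, |(q : ℝ) * x i - P i| < (q : ℝ) ^ (-(τ * w i)) := by
        intro i
        have := h2 i
        rwa [one_mul, ← Real.rpow_mul (by positivity), neg_mul] at this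
      have h4 : ∀ i, |(q : ℝ) * x i - P i| < 1 := fun i =>
        lt_of_lt_of_le (h3 i) (Real.rpow_le_one_of_one_le_of_nonpos hq1 (by linarith [hτw i]))
      have hP : ∀ i, 0 ≤ P i ∧ P i < q + 1 := by
        intro i
        have h5 := abs_lt.1 (h4 i)
        have h6 := hx01 i
        constructor
        · have : (-1 : ℝ) < P i := by nlinarith [h5.2, h6.1]
          have : (-1 : ℤ) < P i := by exact_mod_cast this
          omega
        · have : (P i : ℝ) < q + 1 := by nlinarith [h5.1, h6.2]
          exact_mod_cast this
      have hρ0 : 0 < ρ q := by simp only [hρ]; positivity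
      have h7 : ∀ i, |x i - P i / q| < (q : ℝ) ^ (-1 - τ * w i) := by
        intro i
        have e1 : x i - P i / q = ((q : ℝ) * x i - P i) / q := by field_simp
        rw [e1, abs_div, abs_of_pos hq0, div_lt_iff₀ hq0]
        have : (q : ℝ) ^ (-1 - τ * w i) * q = (q : ℝ) ^ (-(τ * w i)) := by
          rw [← Real.rpow_add_one hq0.ne']; congr 1; ring
        rw [this]; exact h3 i
      have h8 : ∀ i, 0 ≤ (x i - P i / q + (q : ℝ) ^ (-1 - τ * w i)) / ρ q := by
        intro i
        have := (abs_lt.1 (h7 i)).1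
        exact div_nonneg (by linarith) hρ0.le
      have h9 : ∀ i, ⌊(x i - P i / q + (q : ℝ) ^ (-1 - τ * w i)) / ρ q⌋₊ < M q i := by
        intro i
        simp only [hM]
        rw [Nat.lt_succ_iff]
        apply Nat.floor_le_floor
        rw [div_le_iff₀ hρ0]
        have := (abs_lt.1 (h7 i)).2
        have e2 : (q : ℝ) ^ (τ * w k - τ * w i) * ρ q = (q : ℝ) ^ (-1 - τ * w i) := by
          simp only [hρ]
          rw [← Real.rpow_add hq0]; congr 1; ring
        rw [mul_assoc, e2]; linarith
      have hPc : ∀ i, (((P i).toNat : ℕ) : ℝ) = P i := by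
        intro i
        have := Int.toNat_of_nonneg (hP i).1
        exact_mod_cast this
      rw [Set.mem_iUnion]
      refine ⟨⟨j, ⟨fun i => ⟨(P i).toNat, ?_⟩, fun i => ⟨_, h9 i⟩⟩⟩, ?_⟩
      · have := (hP i).2; have := (hP i).1; omega
      · simp only [ht, ha]
        constructor
        · intro i
          have := Nat.floor_le (h8 i)
          rw [le_div_iff₀ hρ0] at this
          simp only [hPc, ← hq]
          linarith
        · intro i
          have := Nat.lt_floor_add_one ((x i - P i / q + (q : ℝ) ^ (-1 - τ * w i)) / ρ q)
          rw [div_lt_iff₀ hρ0] at this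
          simp only [hPc, ← hq]
          linarith)
  have hle2 : liminf (fun N => ∑' x, Metric.ediam (t N x) ^ s) atTop ≤ 0 := by
    have : liminf (fun N => ∑' x, Metric.ediam (t N x) ^ s) atTop ≤
        liminf (fun N => ∑' j, ENNReal.ofReal (f (j + (N + 1)))) atTop := by
      refine liminf_le_liminf ?_
      · apply Eventually.of_forall
        intro N
        rw [ENNReal.tsum_sigma']
        apply ENNReal.tsum_le_tsum
        intro j
        rw [tsum_fintype]
        have hq0 : (0 : ℝ) < ((j + N + 1 : ℕ) : ℝ) := by positivity
        have hq1 : (1 : ℝ) ≤ ((j + N + 1 : ℕ) : ℝ) := by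
          have : 1 ≤ j + N + 1 := by omega
          exact_mod_cast this
        rw [← add_assoc]
        set q := j + N + 1 with hq
        have hρ0 : 0 ≤ ρ q := by simp only [hρ]; positivity
        calc _ ≤ ∑ x : (Fin d → Fin (q + 1)) × ((i : Fin d) → Fin (M q i)), ENNReal.ofReal (ρ q ^ s) := by
              apply Finset.sum_le_sum
              intro x _
              rw [← ENNReal.ofReal_rpow_of_nonneg hρ0 hs.le]
              exact ENNReal.rpow_le_rpow (hdiam N ⟨j, x⟩) hs.le
          _ = ENNReal.ofReal (((q + 1 : ℝ)) ^ d * (∏ i, (M q i : ℝ)) * ρ q ^ s) := by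
              rw [Finset.sum_const, Finset.card_univ, Fintype.card_prod, Fintype.card_pi, Fintype.card_pi,
                nsmul_eq_mul, ENNReal.ofReal_mul (by positivity)]
              congr 1
              rw [← ENNReal.ofReal_natCast]
              congr 1
              push_cast
              simp
          _ ≤ ENNReal.ofReal (f q) := by
              apply ENNReal.ofReal_le_ofReal
              have b1 : ((q : ℝ) + 1) ^ d ≤ (2 * (q : ℝ)) ^ d := by
                gcongr; linarith
              have b2 : ∏ i, (M q i : ℝ) ≤ ∏ i, (3 * (q : ℝ) ^ (e i)) := by
                apply Finset.prod_le_prod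
                · intro i _; positivity
                · intro i _
                  simp only [hM, he]
                  push_cast
                  have c1 : (q : ℝ) ^ (τ * w k - τ * w i) ≤ (q : ℝ) ^ (max 0 (τ * w k - τ * w i)) :=
                    Real.rpow_le_rpow_of_exponent_le hq1 (le_max_right _ _)
                  have c2 : 1 ≤ (q : ℝ) ^ (max 0 (τ * w k - τ * w i)) :=
                    Real.one_le_rpow hq1 (le_max_left _ _)
                  have c3 := Nat.floor_le (show 0 ≤ 2 * (q : ℝ) ^ (τ * w k - τ * w i) by positivity)
                  linarith
              calc _ ≤ (2 * (q : ℝ)) ^ d * (∏ i, (3 * (q : ℝ) ^ (e i))) * ρ q ^ s := by gcongr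
                _ = f q := by
                  simp only [hf, hρ]
                  rw [Finset.prod_mul_distrib, ← Real.rpow_sum_of_pos hq0, Finset.prod_const,
                    Finset.card_univ, Fintype.card_fin, ← Real.rpow_mul hq0.le, mul_pow,
                    show (d : ℝ) + ∑ i, e i - (1 + τ * w k) * s = d + ∑ i, e i + (-1 - τ * w k) * s by ring,
                    Real.rpow_add hq0, Real.rpow_add hq0, Real.rpow_natCast,
                    show (6 : ℝ) ^ d = 2 ^ d * 3 ^ d by rw [← mul_pow]; norm_num]
                  ring
    rw [htail.liminf_eq] at this
    exact this
  exact le_antisymm (hle.trans hle2) zero_le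

lemma sum_ite_eq_max {d : ℕ} (w : Fin d → ℝ) (hwmono : Monotone w) (τ : ℝ) (hτ : 1 < τ) (k : Fin d) :
    (∑ i : Fin d, if i ≤ k then τ * w k - τ * w i else 0) = ∑ i, max 0 (τ * w k - τ * w i) := by
  apply Finset.sum_congr rfl
  intro i _
  split_ifs with h
  · have := hwmono h
    rw [max_eq_right]; nlinarith
  · have := hwmono (not_le.1 h).le
    rw [max_eq_left]; nlinarith

lemma upper {d : ℕ} (hd : 1 ≤ d) (w : Fin d → ℝ) (hw0 : ∀ i, 0 < w i) (hwmono : Monotone w)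
    (τ : ℝ) (hτ : 1 < τ) (k : Fin d) :
    dimH (wApprox w 1 τ) ≤ ENNReal.ofReal
        (((d : ℝ) + 1 + ∑ i : Fin d, if i ≤ k then τ * w k - τ * w i else 0) / (1 + τ * w k)) := by
  rw [sum_ite_eq_max w hwmono τ hτ k]
  apply le_of_forall_gt_imp_ge_of_dense
  intro b hb
  have hpos : 0 < 1 + τ * w k := by have := hw0 k; positivity
  have h0 : 0 ≤ ∑ i, max 0 (τ * w k - τ * w i) := Finset.sum_nonneg (fun i _ => le_max_left _ _)
  by_cases hbt : b = ⊤
  · rw [hbt]; exact le_top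
  lift b to NNReal using hbt
  have h1 : ((d : ℝ) + 1 + ∑ i, max 0 (τ * w k - τ * w i)) / (1 + τ * w k) < b := by
    by_contra hcon
    push Not at hcon
    have := ENNReal.ofReal_le_ofReal hcon
    rw [ENNReal.ofReal_coe_nnreal] at this
    exact absurd hb (not_lt.2 this)
  apply dimH_le_of_hausdorffMeasure_ne_top
  rw [upper_aux hd w hw0 τ hτ k b (lt_of_le_of_lt (by positivity) h1) (by
    rw [div_lt_iff₀ hpos] at h1; linarith)]
  simp


/-- closeness of `x` to the rational point `P/n` at the critical scale -/
def Near {d : ℕ} (w : Fin d → ℝ) (τ : ℝ) (n : ℕ) (x : Fin d → ℝ) (P : Fin d → ℤ) : Prop :=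
  ∀ i, |(n : ℝ) * x i - P i| < (n : ℝ) ^ (-(τ * w i))

/-- the corner box at `p/q` -/
def InB {d : ℕ} (w : Fin d → ℝ) (τ : ℝ) (q : ℕ) (p : Fin d → ℤ) (x : Fin d → ℝ) : Prop :=
  ∀ i, (p i : ℝ) / q ≤ x i ∧ x i ≤ (p i : ℝ) / q + (q : ℝ) ^ (-1 - τ * w i)

/-- candidate numerators -/
noncomputable def Cand {d : ℕ} (a l : Fin d → ℝ) (q : ℕ) : Finset (Fin d → ℤ) :=
  Fintype.piFinset (fun i => Finset.Icc ⌈(q : ℝ) * a i⌉ ⌊(q : ℝ) * a i + q * l i - 1⌋)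

lemma mem_Cand {d : ℕ} (a l : Fin d → ℝ) (q : ℕ) (p : Fin d → ℤ) :
    p ∈ Cand a l q ↔ ∀ i, (q : ℝ) * a i ≤ p i ∧ (p i : ℝ) + 1 ≤ q * (a i + l i) := by
  unfold Cand
  rw [Fintype.mem_piFinset]
  apply forall_congr'
  intro i
  rw [Finset.mem_Icc, Int.ceil_le, Int.le_floor]
  constructor
  · rintro ⟨h1, h2⟩; exact ⟨h1, by linarith⟩
  · rintro ⟨h1, h2⟩; exact ⟨h1, by linarith⟩

lemma card_Cand {d : ℕ} (a l : Fin d → ℝ) (hl : ∀ i, 0 < l i) :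
    ∀ᶠ q : ℕ in atTop, (9/10 : ℝ) * (∏ i, l i) * (q : ℝ) ^ d ≤ (Cand a l q).card := by
  have hV : 0 < ∏ i, l i := Finset.prod_pos fun i _ => hl i
  have h1 : Tendsto (fun q : ℕ => ∏ i, (l i - 2 / (q : ℝ))) atTop (𝓝 (∏ i, l i)) := by
    apply tendsto_finsetProd
    intro i _
    have : Tendsto (fun q : ℕ => (2 : ℝ) / q) atTop (𝓝 0) := tendsto_const_div_atTop_nhds_zero_nat 2
    simpa using tendsto_const_nhds.sub this
  have h2 := h1.eventually_const_le (show (9/10 : ℝ) * (∏ i, l i) < ∏ i, l i by linarith)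
  have h3 : ∀ i, ∀ᶠ q : ℕ in atTop, 2 ≤ (q : ℝ) * l i := by
    intro i
    have : Tendsto (fun q : ℕ => (q : ℝ) * l i) atTop atTop :=
      tendsto_natCast_atTop_atTop.atTop_mul_const (hl i)
    exact this.eventually_ge_atTop 2
  filter_upwards [h2, eventually_all.2 h3, eventually_gt_atTop 0] with q h2 h3 hq
  have hq' : (0 : ℝ) < q := by exact_mod_cast hq
  have h4 : ((Cand a l q).card : ℝ) ≥ ∏ i, ((q : ℝ) * l i - 2) := by
    unfold Cand
    rw [Fintype.card_piFinset]
    push_cast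
    apply Finset.prod_le_prod
    · intro i _; linarith [h3 i]
    · intro i _
      rw [Int.card_Icc]
      have e1 := Int.ceil_lt_add_one ((q : ℝ) * a i)
      have e2 := Int.lt_floor_add_one ((q : ℝ) * a i + q * l i - 1)
      have e3 : ((⌊(q : ℝ) * a i + q * l i - 1⌋ + 1 - ⌈(q : ℝ) * a i⌉ : ℤ) : ℝ) ≤
        (((⌊(q : ℝ) * a i + q * l i - 1⌋ + 1 - ⌈(q : ℝ) * a i⌉).toNat : ℤ) : ℝ) := by
        exact_mod_cast Int.self_le_toNat _
      push_cast at e3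
      linarith
  have h5 : ∏ i, ((q : ℝ) * l i - 2) = (∏ i, (l i - 2 / (q : ℝ))) * (q : ℝ) ^ d := by
    have : (q : ℝ) ^ d = ∏ i : Fin d, (q : ℝ) := by simp
    rw [this, ← Finset.prod_mul_distrib]
    apply Finset.prod_congr rfl
    intro i _
    field_simp
  rw [h5] at h4
  have : (0 : ℝ) ≤ (q : ℝ) ^ d := by positivity
  nlinarith

lemma InB_shift {d : ℕ} (w : Fin d → ℝ) (hw0 : ∀ i, 0 < w i) (τ : ℝ) (hτ : 1 < τ) (q : ℕ) (hq : 1 ≤ q)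
    (p : Fin d → ℤ) (x : Fin d → ℝ) (h : InB w τ q p x) (i : Fin d) :
    (p i : ℝ) ≤ q * x i ∧ (q : ℝ) * x i ≤ p i + (q : ℝ) ^ (- (τ * w i)) ∧ (q : ℝ) ^ (- (τ * w i)) ≤ 1 := by
  have hq' : (1 : ℝ) ≤ q := by exact_mod_cast hq
  have hq0 : (0 : ℝ) < q := by linarith
  obtain ⟨h1, h2⟩ := h i
  refine ⟨?_, ?_, ?_⟩
  · rw [div_le_iff₀ hq0] at h1; linarith
  · have : (q : ℝ) ^ (-1 - τ * w i) = (q : ℝ) ^ (- (τ * w i)) / q := by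
      rw [show -1 - τ * w i = - (τ * w i) - 1 by ring, Real.rpow_sub_one hq0.ne']
    rw [this, ← add_div, le_div_iff₀ hq0] at h2
    linarith
  · apply Real.rpow_le_one_of_one_le_of_nonpos hq'
    have := hw0 i
    have : 0 < τ * w i := by positivity
    linarith

/-- numerators meeting a given small rational neighbourhood -/
lemma bad1 {d : ℕ} (w : Fin d → ℝ) (hw0 : ∀ i, 0 < w i) (τ : ℝ) (hτ : 1 < τ) (V : ℝ) (hV : 0 < V)
    (S : Finset ((Fin d → ℤ) × ℕ)) (hS1 : ∀ pq ∈ S, 1 ≤ pq.2)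
    (hS : ∑ pq ∈ S, ∏ i, (2 * (pq.2 : ℝ) ^ (-1 - τ * w i)) ≤ (1/10) * V) :
    ∀ᶠ q : ℕ in atTop, ∀ B : Finset (Fin d → ℤ),
      (∀ p ∈ B, ∃ pq ∈ S, ∃ x, InB w τ q p x ∧ Near w τ pq.2 x pq.1) →
      (B.card : ℝ) ≤ (2/10) * V * (q : ℝ) ^ d := by
  classical
  have h1 : Tendsto (fun q : ℕ => ∑ pq ∈ S, ∏ i, (2 * (pq.2 : ℝ) ^ (-1 - τ * w i) + 3 / (q : ℝ))) atTop
      (𝓝 (∑ pq ∈ S, ∏ i, (2 * (pq.2 : ℝ) ^ (-1 - τ * w i)))) := by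
    apply tendsto_finsetSum
    intro pq _
    apply tendsto_finsetProd
    intro i _
    have : Tendsto (fun q : ℕ => (3 : ℝ) / q) atTop (𝓝 0) := tendsto_const_div_atTop_nhds_zero_nat 3
    simpa using tendsto_const_nhds.add this
  have h2 := h1.eventually_le_const (show _ < (2/10 : ℝ) * V by linarith)
  filter_upwards [h2, eventually_ge_atTop 1] with q h2 hq B hB
  have hq' : (1 : ℝ) ≤ q := by exact_mod_cast hq
  have hq0 : (0 : ℝ) < q := by linarith
  have hsub : B ⊆ S.biUnion (fun pq => B.filter (fun p => ∃ x, InB w τ q p x ∧ Near w τ pq.2 x pq.1)) := by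
    intro p hp
    obtain ⟨pq, h, h'⟩ := hB p hp
    exact Finset.mem_biUnion.2 ⟨pq, h, Finset.mem_filter.2 ⟨hp, h'⟩⟩
  have h3 : (B.card : ℝ) ≤ ∑ pq ∈ S, ((B.filter (fun p => ∃ x, InB w τ q p x ∧ Near w τ pq.2 x pq.1)).card : ℝ) := by
    exact_mod_cast (Finset.card_le_card hsub).trans Finset.card_biUnion_le
  have h4 : ∀ pq ∈ S, ((B.filter (fun p => ∃ x, InB w τ q p x ∧ Near w τ pq.2 x pq.1)).card : ℝ) ≤
      (∏ i, (2 * (pq.2 : ℝ) ^ (-1 - τ * w i) + 3 / (q : ℝ))) * (q : ℝ) ^ d := by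
    intro pq hpq
    have hn : (1 : ℝ) ≤ pq.2 := by exact_mod_cast hS1 pq hpq
    have hn0 : (0 : ℝ) < pq.2 := by linarith
    have := int_box (B.filter (fun p => ∃ x, InB w τ q p x ∧ Near w τ pq.2 x pq.1))
      (fun i => q * (pq.1 i / pq.2)) (fun i => q * (pq.2 : ℝ) ^ (-1 - τ * w i) + 1)
      (fun i => by positivity) (by
        intro p hp i
        obtain ⟨x, hx1, hx2⟩ := (Finset.mem_filter.1 hp).2
        obtain ⟨e1, e2, e3⟩ := InB_shift w hw0 τ hτ q hq p x hx1 i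
        have e4 := hx2 i
        have e5 : |x i - pq.1 i / pq.2| ≤ (pq.2 : ℝ) ^ (-1 - τ * w i) := by
          have : x i - pq.1 i / pq.2 = (pq.2 * x i - pq.1 i) / pq.2 := by field_simp
          rw [this, abs_div, abs_of_pos hn0, show -1 - τ * w i = - (τ * w i) - 1 by ring,
            Real.rpow_sub_one hn0.ne']
          gcongr
        have e6 : |q * x i - q * (pq.1 i / pq.2)| ≤ q * (pq.2 : ℝ) ^ (-1 - τ * w i) := by
          rw [← mul_sub, abs_mul, abs_of_pos hq0]; gcongr
        rw [abs_le] at e6 ⊢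
        constructor <;> linarith)
    refine this.trans (le_of_eq ?_)
    have : (q : ℝ) ^ d = ∏ i : Fin d, (q : ℝ) := by simp
    rw [this, ← Finset.prod_mul_distrib]
    apply Finset.prod_congr rfl
    intro i _
    field_simp
    ring
  refine h3.trans ((Finset.sum_le_sum h4).trans ?_)
  rw [← Finset.sum_mul]
  gcongr

/-- generic residue bound -/
lemma bad_res {d : ℕ} (v : Fin d → ℝ) (hvsum : ∑ i, v i = 1) (hv0 : ∀ i, 0 < v i)
    (q n : ℕ) (hq : q.Prime) (hn : 1 ≤ n) (hnq : n < q)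
    (c β : ℝ) (hc : 0 < c) (hβ : c / q ≤ β) (hqc : ∀ i, 1 ≤ (q : ℝ) * (c / q) ^ v i)
    (S : Finset (Fin d → ℤ)) (hS : ∀ p ∈ S, ∀ i, 0 ≤ p i ∧ p i < q)
    (hP : ∀ p ∈ S, ∃ P : Fin d → ℤ, ∀ i, |(n : ℝ) * p i - P i * q| ≤ q * β ^ v i) :
    (S.card : ℝ) ≤ 3 ^ d * (q : ℝ) ^ d * β := by
  have hq0 : (0 : ℝ) < q := by exact_mod_cast hq.pos
  have hcq : 0 < c / q := by positivity
  have hβ0 : 0 < β := by linarith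
  refine (residue_count q n hq hn hnq (fun i => q * β ^ v i) (fun i => by positivity) S hS hP).trans ?_
  calc ∏ i, (2 * ((q : ℝ) * β ^ v i) + 1) ≤ ∏ i, (3 * (q : ℝ) * β ^ v i) := by
        apply Finset.prod_le_prod
        · intro i _; positivity
        · intro i _
          have : (c / q) ^ v i ≤ β ^ v i := Real.rpow_le_rpow hcq.le hβ (hv0 i).le
          have := hqc i
          nlinarith
    _ = _ := by
        rw [Finset.prod_mul_distrib, ← Real.rpow_sum_of_pos hβ0, hvsum, Real.rpow_one]
        simp [mul_pow]

lemma qc_event {d : ℕ} (v : Fin d → ℝ) (hv1 : ∀ i, v i < 1) (c : ℝ) (hc : 0 < c) :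
    ∀ᶠ q : ℕ in atTop, ∀ i, 1 ≤ (q : ℝ) * (c / q) ^ v i := by
  rw [eventually_all]
  intro i
  have h : Tendsto (fun q : ℕ => c ^ v i * (q : ℝ) ^ (1 - v i)) atTop atTop := by
    apply Tendsto.const_mul_atTop (by positivity)
    exact (tendsto_rpow_atTop (by linarith [hv1 i])).comp tendsto_natCast_atTop_atTop
  filter_upwards [h.eventually_ge_atTop 1, eventually_gt_atTop 0] with q h hq
  have hq0 : (0 : ℝ) < q := by exact_mod_cast hq
  rw [Real.div_rpow hc.le hq0.le]
  rw [Real.rpow_sub hq0, Real.rpow_one] at h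
  calc (1 : ℝ) ≤ _ := h
    _ = _ := by ring


lemma exists_C {d : ℕ} (w : Fin d → ℝ) (hw0 : ∀ i, 0 < w i) : ∃ C : ℝ, 0 < C ∧ ∀ i, 2 ≤ C ^ w i := by
  refine ⟨∑ i, (2 : ℝ) ^ (1 / w i) + 1, ?_, ?_⟩
  · have : 0 ≤ ∑ i, (2 : ℝ) ^ (1 / w i) := Finset.sum_nonneg fun i _ => by positivity
    linarith
  · intro i
    have h : (2 : ℝ) ^ (1 / w i) ≤ ∑ i, (2 : ℝ) ^ (1 / w i) + 1 := by
      have := Finset.single_le_sum (f := fun i => (2 : ℝ) ^ (1 / w i)) (fun i _ => by positivity) (Finset.mem_univ i)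
      linarith
    calc (2 : ℝ) = ((2 : ℝ) ^ (1 / w i)) ^ w i := by
          rw [← Real.rpow_mul (by norm_num), one_div_mul_cancel (hw0 i).ne', Real.rpow_one]
      _ ≤ _ := Real.rpow_le_rpow (by positivity) h (hw0 i).le

lemma tail_small (τ : ℝ) (hτ : 1 < τ) (δ : ℝ) (hδ : 0 < δ) :
    ∃ N0 : ℕ, ∀ S : Finset ℕ, (∀ n ∈ S, N0 < n) → ∑ n ∈ S, (n : ℝ) ^ (-τ) ≤ δ := by
  have hs : Summable (fun n : ℕ => (n : ℝ) ^ (-τ)) := Real.summable_nat_rpow.2 (by linarith)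
  obtain ⟨T, hT⟩ := (summable_iff_vanishing_norm.1 hs) δ hδ
  refine ⟨T.sup id, fun S hS => ?_⟩
  have := hT S (by
    rw [Finset.disjoint_left]
    intro n hn hnT
    have h1 := hS n hn
    have h2 : id n ≤ T.sup id := Finset.le_sup hnT
    simp only [id] at h2
    omega)
  exact (le_abs_self _).trans this.le

lemma bad2 {d : ℕ} (w : Fin d → ℝ) (hw0 : ∀ i, 0 < w i) (hw1 : ∀ i, w i < 1) (hwsum : ∑ i, w i = 1)
    (τ : ℝ) (hτ : 1 < τ) (V : ℝ) (hV : 0 < V) :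
    ∃ N0 : ℕ, ∀ c : ℝ, 0 < c → 3 ^ d * c ≤ V / 20 → ∀ᶠ q : ℕ in atTop, q.Prime →
      ∀ B : Finset (Fin d → ℤ), (∀ p ∈ B, ∀ i, 0 ≤ p i ∧ p i < q) →
      (∀ p ∈ B, ∃ n P x, N0 < n ∧ n < q ∧ InB w τ q p x ∧ Near w τ n x P) →
      (B.card : ℝ) ≤ V / 10 * (q : ℝ) ^ d := by
  classical
  obtain ⟨C, hC0, hC⟩ := exists_C w hw0
  obtain ⟨N0, hN0⟩ := tail_small τ hτ (V / (20 * 3 ^ d * C)) (by positivity)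
  refine ⟨N0, fun c hc hcV => ?_⟩
  filter_upwards [qc_event w hw1 c hc] with q hqc hq B hB hB2
  have hq1 : 1 ≤ q := hq.one_lt.le
  have hq0 : (0 : ℝ) < q := by exact_mod_cast hq.pos
  set I := Finset.Ioo N0 q with hI
  let F : ℕ → Finset (Fin d → ℤ) := fun n => B.filter (fun p => ∃ P x, InB w τ q p x ∧ Near w τ n x P)
  have hsub : B ⊆ I.biUnion F := by
    intro p hp
    obtain ⟨n, P, x, h1, h2, h3, h4⟩ := hB2 p hp
    exact Finset.mem_biUnion.2 ⟨n, Finset.mem_Ioo.2 ⟨h1, h2⟩, Finset.mem_filter.2 ⟨hp, P, x, h3, h4⟩⟩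
  have h3 : (B.card : ℝ) ≤ ∑ n ∈ I, ((F n).card : ℝ) := by
    exact_mod_cast (Finset.card_le_card hsub).trans Finset.card_biUnion_le
  have h4 : ∀ n ∈ I, ((F n).card : ℝ) ≤ 3 ^ d * (q : ℝ) ^ d * (C * (n : ℝ) ^ (-τ) + c / q) := by
    intro n hn
    obtain ⟨hn1, hn2⟩ := Finset.mem_Ioo.1 hn
    have hn0 : (0 : ℝ) < n := by
      have : 0 < n := by omega
      exact_mod_cast this
    have hnq : (n : ℝ) ≤ q := by exact_mod_cast hn2.le
    apply bad_res w hwsum hw0 q n hq (by omega) hn2 c _ hc _ hqc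
    · intro p hp; exact hB p (Finset.mem_filter.1 hp).1
    · intro p hp
      obtain ⟨P, x, hx1, hx2⟩ := (Finset.mem_filter.1 hp).2
      refine ⟨P, fun i => ?_⟩
      obtain ⟨e1, e2, e3⟩ := InB_shift w hw0 τ hτ q hq1 p x hx1 i
      have e4 := hx2 i
      have e5 : (q : ℝ) ^ (-(τ * w i)) ≤ (n : ℝ) ^ (-(τ * w i)) := by
        apply Real.rpow_le_rpow_of_nonpos hn0 hnq
        have := hw0 i
        have : 0 < τ * w i := by positivity
        linarith
      have e6 : |(n : ℝ) * p i - P i * q| ≤ q * (2 * (n : ℝ) ^ (-(τ * w i))) := by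
        have t1 : (n : ℝ) * p i - P i * q = q * (n * x i - P i) - n * (q * x i - p i) := by ring
        have t2 : |(q : ℝ) * (n * x i - P i)| ≤ q * (n : ℝ) ^ (-(τ * w i)) := by
          rw [abs_mul, abs_of_pos hq0]; gcongr
        have t3 : |(n : ℝ) * (q * x i - p i)| ≤ q * (n : ℝ) ^ (-(τ * w i)) := by
          rw [abs_mul, abs_of_pos hn0]
          apply mul_le_mul hnq _ (abs_nonneg _) hq0.le
          rw [abs_le]; constructor
          · have : 0 < (n : ℝ) ^ (-(τ * w i)) := by positivity
            linarith
          · linarith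
        rw [t1]
        refine (abs_sub _ _).trans ?_
        linarith
      refine e6.trans ?_
      gcongr
      calc 2 * (n : ℝ) ^ (-(τ * w i)) ≤ C ^ w i * ((n : ℝ) ^ (-τ)) ^ w i := by
            rw [← Real.rpow_mul hn0.le, show -τ * w i = -(τ * w i) by ring]
            gcongr
            exact hC i
        _ = (C * (n : ℝ) ^ (-τ)) ^ w i := by rw [Real.mul_rpow hC0.le (by positivity)]
        _ ≤ _ := by
            apply Real.rpow_le_rpow (by positivity) _ (hw0 i).le
            have : 0 < c / q := by positivity
            linarith
    · have : 0 < C * (n : ℝ) ^ (-τ) := by positivity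
      linarith
  refine h3.trans ((Finset.sum_le_sum h4).trans ?_)
  rw [← Finset.mul_sum, Finset.sum_add_distrib, ← Finset.mul_sum, Finset.sum_const, nsmul_eq_mul]
  have e1 : ∑ n ∈ I, (n : ℝ) ^ (-τ) ≤ V / (20 * 3 ^ d * C) := hN0 I (fun n hn => (Finset.mem_Ioo.1 hn).1)
  have e2 : (I.card : ℝ) * (c / q) ≤ c := by
    have : (I.card : ℝ) ≤ q := by
      have : I.card ≤ q := by rw [hI, Nat.card_Ioo]; omega
      exact_mod_cast this
    calc (I.card : ℝ) * (c / q) ≤ q * (c / q) := by gcongr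
      _ = c := by field_simp
  calc 3 ^ d * (q : ℝ) ^ d * (C * ∑ n ∈ I, (n : ℝ) ^ (-τ) + I.card * (c / q))
      ≤ 3 ^ d * (q : ℝ) ^ d * (C * (V / (20 * 3 ^ d * C)) + c) := by gcongr
    _ = (q : ℝ) ^ d * (V / 20 + 3 ^ d * c) := by field_simp
    _ ≤ (q : ℝ) ^ d * (V / 20 + V / 20) := by gcongr
    _ = _ := by ring

lemma bad3 {d : ℕ} (u : Fin d → ℝ) (hu0 : ∀ i, 0 < u i) (hu1 : ∀ i, u i < 1) (husum : ∑ i, u i = 1)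
    (V : ℝ) (c : ℝ) (hc : 0 < c) (hcV : 3 ^ d * c ≤ V / 20) : ∀ᶠ q : ℕ in atTop, q.Prime →
      ∀ B : Finset (Fin d → ℤ), (∀ p ∈ B, ∀ i, 0 ≤ p i ∧ p i < q) →
      (∀ p ∈ B, ∃ (n : ℕ) (P : Fin d → ℤ), 1 ≤ n ∧ n < q ∧
        ∀ i, |(n : ℝ) * (p i / q) - P i| < (c / q) ^ u i) →
      (B.card : ℝ) ≤ V / 10 * (q : ℝ) ^ d := by
  classical
  filter_upwards [qc_event u hu1 c hc] with q hqc hq B hB hB2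
  have hq1 : 1 ≤ q := hq.one_lt.le
  have hq0 : (0 : ℝ) < q := by exact_mod_cast hq.pos
  set I := Finset.Ico 1 q with hI
  let F : ℕ → Finset (Fin d → ℤ) := fun n => B.filter (fun p => ∃ P : Fin d → ℤ,
        ∀ i, |(n : ℝ) * (p i / q) - P i| < (c / q) ^ u i)
  have hsub : B ⊆ I.biUnion F := by
    intro p hp
    obtain ⟨n, P, h1, h2, h3⟩ := hB2 p hp
    exact Finset.mem_biUnion.2 ⟨n, Finset.mem_Ico.2 ⟨h1, h2⟩, Finset.mem_filter.2 ⟨hp, P, h3⟩⟩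
  have h3 : (B.card : ℝ) ≤ ∑ n ∈ I, ((F n).card : ℝ) := by
    exact_mod_cast (Finset.card_le_card hsub).trans Finset.card_biUnion_le
  have h4 : ∀ n ∈ I, ((F n).card : ℝ) ≤ 3 ^ d * (q : ℝ) ^ d * (c / q) := by
    intro n hn
    obtain ⟨hn1, hn2⟩ := Finset.mem_Ico.1 hn
    apply bad_res u husum hu0 q n hq hn1 hn2 c _ hc le_rfl hqc
    · intro p hp; exact hB p (Finset.mem_filter.1 hp).1
    · intro p hp
      obtain ⟨P, hP⟩ := (Finset.mem_filter.1 hp).2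
      refine ⟨P, fun i => ?_⟩
      have : (n : ℝ) * p i - P i * q = q * (n * (p i / q) - P i) := by field_simp
      rw [this, abs_mul, abs_of_pos hq0]
      gcongr
      exact (hP i).le
  refine h3.trans ((Finset.sum_le_sum h4).trans ?_)
  rw [Finset.sum_const, nsmul_eq_mul]
  have : (I.card : ℝ) ≤ q := by
    have : I.card ≤ q := by rw [hI, Nat.card_Ico]; omega
    exact_mod_cast this
  have hV : 0 < V := by have : 0 < 3 ^ d * c := by positivity
                        linarith
  calc (I.card : ℝ) * (3 ^ d * (q : ℝ) ^ d * (c / q)) ≤ q * (3 ^ d * (q : ℝ) ^ d * (c / q)) := by gcongr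
    _ = (3 ^ d * c) * (q : ℝ) ^ d := by field_simp
    _ ≤ (V / 20) * (q : ℝ) ^ d := by gcongr
    _ ≤ _ := by gcongr; norm_num

lemma bad4 {d : ℕ} (w : Fin d → ℝ) (hw0 : ∀ i, 0 < w i) (τ : ℝ) (hτ : 1 < τ)
    (a l : Fin d → ℝ) (hl : ∀ i, 0 < l i) (y : ℕ → Fin d → ℝ) (r : ℕ → ℝ) :
    ∀ᶠ q : ℕ in atTop, ∀ (K : Finset ℕ), (∀ k ∈ K, 1 / (q : ℝ) ≤ r k) → ∀ B : Finset (Fin d → ℤ),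
      (∀ p ∈ B, p ∈ Cand a l q) → (∀ p ∈ B, ∃ k ∈ K, ∃ x, InB w τ q p x ∧ ∀ i, |x i - y k i| ≤ r k) →
      (B.card : ℝ) ≤ 5 ^ d * (∏ i, l i) * (q : ℝ) ^ d * ∑ k ∈ K, ∏ i, min 1 (r k / l i) := by
  classical
  have h3 : ∀ i, ∀ᶠ q : ℕ in atTop, 2 ≤ (q : ℝ) * l i := by
    intro i
    have : Tendsto (fun q : ℕ => (q : ℝ) * l i) atTop atTop :=
      tendsto_natCast_atTop_atTop.atTop_mul_const (hl i)
    exact this.eventually_ge_atTop 2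
  filter_upwards [eventually_all.2 h3, eventually_ge_atTop 1] with q hql hq K hK B hB1 hB2
  have hq0 : (0 : ℝ) < q := by exact_mod_cast hq
  let F : ℕ → Finset (Fin d → ℤ) := fun k => B.filter (fun p => ∃ x, InB w τ q p x ∧ ∀ i, |x i - y k i| ≤ r k)
  have hsub : B ⊆ K.biUnion F := by
    intro p hp
    obtain ⟨k, hk, x, h⟩ := hB2 p hp
    exact Finset.mem_biUnion.2 ⟨k, hk, Finset.mem_filter.2 ⟨hp, x, h⟩⟩
  have h3 : (B.card : ℝ) ≤ ∑ k ∈ K, ((F k).card : ℝ) := by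
    exact_mod_cast (Finset.card_le_card hsub).trans Finset.card_biUnion_le
  rw [Finset.mul_sum]
  refine h3.trans (Finset.sum_le_sum fun k hk => ?_)
  have hrq := hK k hk
  have hrk : 1 ≤ q * r k := by rw [div_le_iff₀ hq0] at hrq; linarith
  have hr0 : 0 < r k := lt_of_lt_of_le (by positivity) hrq
  have := int_box (F k)
      (fun i => if 2 * r k ≤ l i / 2 then q * y k i else q * (a i + l i / 2))
      (fun i => if 2 * r k ≤ l i / 2 then q * (2 * r k) else q * (l i / 2))
      (fun i => by have := hl i; split_ifs <;> positivity) (by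
        intro p hp i
        obtain ⟨hpB, x, hx1, hx2⟩ := Finset.mem_filter.1 hp
        obtain ⟨e1, e2, e3⟩ := InB_shift w hw0 τ hτ q hq p x hx1 i
        have e4 := (mem_Cand a l q p).1 (hB1 p hpB) i
        have e5 : |q * x i - q * y k i| ≤ q * r k := by
          rw [← mul_sub, abs_mul, abs_of_pos hq0]; have := hx2 i; gcongr
        split_ifs with h
        · rw [abs_le] at e5 ⊢
          constructor <;> linarith
        · rw [abs_le]
          constructor <;> linarith)
  refine this.trans ?_
  have e : (5 : ℝ) ^ d * (∏ i, l i) * (q : ℝ) ^ d * ∏ i, min 1 (r k / l i)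
      = ∏ i, (5 * l i * q * min 1 (r k / l i)) := by
    rw [Finset.prod_mul_distrib, Finset.prod_mul_distrib, Finset.prod_mul_distrib]
    simp
  rw [e]
  apply Finset.prod_le_prod
  · intro i _
    have := hl i
    split_ifs <;> positivity
  · intro i _
    have hli := hl i
    have hqi := hql i
    have : l i * min 1 (r k / l i) = min (l i) (r k) := by
      rw [mul_min_of_nonneg _ _ hli.le, mul_one, mul_div_cancel₀ _ hli.ne']
    rw [show 5 * l i * q * min 1 (r k / l i) = 5 * q * (l i * min 1 (r k / l i)) by ring, this]
    split_ifs with h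
    · rw [min_eq_right (by linarith)]
      nlinarith
    · rcases le_total (l i) (r k) with h' | h'
      · rw [min_eq_left h']; nlinarith
      · rw [min_eq_right h']
        have : q * (l i / 2) ≤ q * (2 * r k) := by
          have := not_le.1 h
          gcongr
        nlinarith


/-- The induction invariant. -/
structure GoodState {d : ℕ} (w : Fin d → ℝ) (τ : ℝ) (y : ℕ → Fin d → ℝ) (r : ℕ → ℝ)
    (q : ℕ) (z a l : Fin d → ℝ) : Prop where
  hq : 1 ≤ q
  hl : ∀ i, 0 < l i
  ha : ∀ i, 0 ≤ a i
  hal : ∀ i, a i + l i ≤ 1 / 2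
  hR : ∀ S : Finset ((Fin d → ℤ) × ℕ),
    (∀ pq ∈ S, q ≤ pq.2 ∧ (∃ i, (pq.1 i : ℝ) ≠ pq.2 * z i) ∧
      ∃ x : Fin d → ℝ, (∀ i, a i ≤ x i ∧ x i ≤ a i + l i) ∧ Near w τ pq.2 x pq.1) →
    ∑ pq ∈ S, ∏ i, (2 * (pq.2 : ℝ) ^ (-1 - τ * w i)) ≤ (1/10) * ∏ i, l i
  hPot : ∀ K : Finset ℕ,
    (∀ k ∈ K, r k < 1 / (q : ℝ) ∧
      ∃ x : Fin d → ℝ, (∀ i, a i ≤ x i ∧ x i ≤ a i + l i) ∧ ∀ i, |x i - y k i| ≤ r k) →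
    ∑ k ∈ K, ∏ i, min 1 (r k / l i) ≤ 1 / (10 * 5 ^ d)

lemma InB_box {d : ℕ} (w : Fin d → ℝ) (hw0 : ∀ i, 0 < w i) (τ : ℝ) (hτ : 1 < τ) (q : ℕ) (hq : 1 ≤ q)
    (a l : Fin d → ℝ) (p : Fin d → ℤ) (hp : p ∈ Cand a l q) (x : Fin d → ℝ) (hx : InB w τ q p x) :
    ∀ i, a i ≤ x i ∧ x i ≤ a i + l i := by
  intro i
  have hq0 : (0 : ℝ) < q := by exact_mod_cast hq
  obtain ⟨e1, e2, e3⟩ := InB_shift w hw0 τ hτ q hq p x hx i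
  obtain ⟨e4, e5⟩ := (mem_Cand a l q p).1 hp i
  constructor
  · exact le_of_mul_le_mul_left (by linarith) hq0
  · exact le_of_mul_le_mul_left (by linarith : (q : ℝ) * x i ≤ q * (a i + l i)) hq0

lemma finite_pairs {d : ℕ} (w : Fin d → ℝ) (hw0 : ∀ i, 0 < w i) (τ : ℝ) (hτ : 1 < τ) (q N0 : ℕ) (hq : 1 ≤ q)
    (a l : Fin d → ℝ) (ha : ∀ i, 0 ≤ a i) (hal : ∀ i, a i + l i ≤ 1/2) :
    {pq : (Fin d → ℤ) × ℕ | q ≤ pq.2 ∧ pq.2 ≤ N0 ∧ 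
      ∃ x : Fin d → ℝ, (∀ i, a i ≤ x i ∧ x i ≤ a i + l i) ∧ Near w τ pq.2 x pq.1}.Finite := by
  apply Set.Finite.subset ((Set.finite_Icc (fun _ : Fin d => (-1 : ℤ)) (fun _ => (N0 : ℤ) + 1)).prod (Set.finite_Icc q N0))
  rintro ⟨P, n⟩ ⟨h1, h2, x, hx, hn⟩
  simp only at h1 h2 hn
  have hn1 : (1 : ℝ) ≤ n := by exact_mod_cast hq.trans h1
  have hnN : (n : ℝ) ≤ N0 := by exact_mod_cast h2
  have key : ∀ i, -1 ≤ P i ∧ P i ≤ (N0 : ℤ) + 1 := by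
    intro i
    have e1 := hn i
    have e2 : (n : ℝ) ^ (-(τ * w i)) ≤ 1 := by
      apply Real.rpow_le_one_of_one_le_of_nonpos hn1
      have := hw0 i
      have : 0 < τ * w i := by positivity
      linarith
    have e3 := abs_lt.1 (e1.trans_le e2)
    have e4 := hx i
    have e5 := ha i
    have e6 := hal i
    have e7 : 0 ≤ (n : ℝ) * x i := by have : 0 ≤ x i := by linarith
                                      positivity
    have e8 : (n : ℝ) * x i ≤ N0 := by nlinarith
    constructor
    · have : ((-1 : ℤ) : ℝ) ≤ P i := by push_cast; linarith
      exact_mod_cast this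
    · have : (P i : ℝ) ≤ ((N0 + 1 : ℤ) : ℝ) := by push_cast; linarith
      exact_mod_cast this
  exact ⟨⟨fun i => (key i).1, fun i => (key i).2⟩, h1, h2⟩

lemma L5 {d : ℕ} (w : Fin d → ℝ) (hw0 : ∀ i, 0 < w i) (hw1 : ∀ i, w i < 1) (hwsum : ∑ i, w i = 1)
    (τ : ℝ) (hτ : 1 < τ) (u : Fin d → ℝ) (hu0 : ∀ i, 0 < u i) (hu1 : ∀ i, u i < 1) (husum : ∑ i, u i = 1)
    (y : ℕ → Fin d → ℝ) (r : ℕ → ℝ) (hfin : ∀ δ > 0, {k | δ ≤ r k}.Finite)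
    (q : ℕ) (z a l : Fin d → ℝ) (h : GoodState w τ y r q z a l) :
    ∃ c : ℝ, 0 < c ∧ c ≤ 1 ∧ ∃ Q0 : ℕ, ∀ q' ≥ Q0, q'.Prime → ∃ G : Finset (Fin d → ℤ),
      (4/10 : ℝ) * (∏ i, l i) * (q' : ℝ) ^ d ≤ G.card ∧ ∀ p ∈ G,
        p ∈ Cand a l q' ∧
        (∀ x, InB w τ q' p x → ∀ (n : ℕ) (P : Fin d → ℤ), q ≤ n → n < q' →
          (∃ i, (P i : ℝ) ≠ n * z i) → ¬ Near w τ n x P) ∧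
        (∀ (n : ℕ) (P : Fin d → ℤ), 1 ≤ n → n < q' → ∃ i, (c / q') ^ u i ≤ |(n : ℝ) * (p i / q') - P i|) ∧
        (∀ x, InB w τ q' p x → ∀ k, 1 / (q' : ℝ) ≤ r k → r k < 1 / (q : ℝ) → ¬ ∀ i, |x i - y k i| ≤ r k) := by
  classical
  set V := ∏ i, l i with hVdef
  have hV : 0 < V := Finset.prod_pos fun i _ => h.hl i
  obtain ⟨N0, hN0⟩ := bad2 w hw0 hw1 hwsum τ hτ V hV
  set c := min 1 (V / 20 / 3 ^ d) with hc
  have hc0 : 0 < c := by rw [hc]; positivity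
  have hcV : 3 ^ d * c ≤ V / 20 := by
    have : c ≤ V / 20 / 3 ^ d := min_le_right _ _
    rw [le_div_iff₀ (by positivity)] at this
    linarith
  refine ⟨c, hc0, min_le_left _ _, ?_⟩
  have hf := finite_pairs w hw0 τ hτ q N0 h.hq a l h.ha h.hal
  set S0 : Finset ((Fin d → ℤ) × ℕ) := hf.toFinset.filter (fun pq => ∃ i, (pq.1 i : ℝ) ≠ pq.2 * z i) with hS0
  have hS0R := h.hR S0 (by
    intro pq hpq
    rw [hS0, Finset.mem_filter, Set.Finite.mem_toFinset] at hpq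
    obtain ⟨⟨e1, e2, e3⟩, e4⟩ := hpq
    exact ⟨e1, e4, e3⟩)
  have hE1 := bad1 w hw0 τ hτ V hV S0 (by
    intro pq hpq
    rw [hS0, Finset.mem_filter, Set.Finite.mem_toFinset] at hpq
    exact h.hq.trans hpq.1.1) hS0R
  have hE := ((card_Cand a l h.hl).and hE1).and ((hN0 c hc0 hcV).and
    ((bad3 u hu0 hu1 husum V c hc0 hcV).and (bad4 w hw0 τ hτ a l h.hl y r)))
  obtain ⟨Q0, hQ0⟩ := eventually_atTop.1 (hE.and (eventually_ge_atTop 1))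
  refine ⟨Q0, fun q' hq' hp' => ?_⟩
  obtain ⟨⟨⟨hcard, hb1⟩, hb2, hb3, hb4⟩, hq1⟩ := hQ0 q' hq'
  have hq0 : (0 : ℝ) < q' := by exact_mod_cast hq1
  set A := Cand a l q' with hA
  have hArange : ∀ p ∈ A, ∀ i, 0 ≤ p i ∧ p i < q' := by
    intro p hp i
    have e1 := (mem_Cand a l q' p).1 hp i
    have e2 := h.ha i
    have e3 := h.hal i
    constructor
    · have : (0 : ℝ) ≤ p i := by have : (0 : ℝ) ≤ q' * a i := by positivity
                                 linarith
      exact_mod_cast this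
    · have : (p i : ℝ) < (q' : ℤ) := by
        push_cast
        nlinarith
      exact_mod_cast this
  set B1 := A.filter (fun p => ∃ pq ∈ S0, ∃ x, InB w τ q' p x ∧ Near w τ pq.2 x pq.1)
  set B2 := A.filter (fun p => ∃ n P x, N0 < n ∧ n < q' ∧ InB w τ q' p x ∧ Near w τ n x P)
  set B3 := A.filter (fun p => ∃ (n : ℕ) (P : Fin d → ℤ), 1 ≤ n ∧ n < q' ∧
        ∀ i, |(n : ℝ) * (p i / q') - P i| < (c / q') ^ u i)
  set K := (hfin (1 / (q' : ℝ)) (by positivity)).toFinset.filter (fun k => r k < 1 / (q : ℝ) ∧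
      ∃ x : Fin d → ℝ, (∀ i, a i ≤ x i ∧ x i ≤ a i + l i) ∧ ∀ i, |x i - y k i| ≤ r k) with hK
  set B4 := A.filter (fun p => ∃ k ∈ K, ∃ x, InB w τ q' p x ∧ ∀ i, |x i - y k i| ≤ r k)
  have c1 := hb1 B1 (fun p hp => (Finset.mem_filter.1 hp).2)
  have c2 := hb2 hp' B2 (fun p hp => hArange p (Finset.mem_filter.1 hp).1) (fun p hp => (Finset.mem_filter.1 hp).2)
  have c3 := hb3 hp' B3 (fun p hp => hArange p (Finset.mem_filter.1 hp).1) (fun p hp => (Finset.mem_filter.1 hp).2)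
  have c4 := hb4 K (fun k hk => by
      have := (Finset.mem_filter.1 hk).1
      rw [Set.Finite.mem_toFinset] at this
      exact this) B4 (fun p hp => (Finset.mem_filter.1 hp).1) (fun p hp => (Finset.mem_filter.1 hp).2)
  have c5 := h.hPot K (fun k hk => (Finset.mem_filter.1 hk).2)
  have c4' : (B4.card : ℝ) ≤ V / 10 * (q' : ℝ) ^ d := by
    refine c4.trans ?_
    calc 5 ^ d * V * (q' : ℝ) ^ d * ∑ k ∈ K, ∏ i, min 1 (r k / l i)
        ≤ 5 ^ d * V * (q' : ℝ) ^ d * (1 / (10 * 5 ^ d)) := by gcongr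
      _ = _ := by field_simp
  refine ⟨A \ (B1 ∪ B2 ∪ B3 ∪ B4), ?_, ?_⟩
  · have e1 : (A.card : ℝ) ≤ ((A \ (B1 ∪ B2 ∪ B3 ∪ B4)).card : ℝ) + (B1 ∪ B2 ∪ B3 ∪ B4).card := by
      exact_mod_cast Finset.card_le_card_sdiff_add_card
    have e2 : ((B1 ∪ B2 ∪ B3 ∪ B4).card : ℝ) ≤ B1.card + B2.card + B3.card + B4.card := by
      have := Finset.card_union_le (B1 ∪ B2 ∪ B3) B4
      have := Finset.card_union_le (B1 ∪ B2) B3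
      have := Finset.card_union_le B1 B2
      have : (B1 ∪ B2 ∪ B3 ∪ B4).card ≤ B1.card + B2.card + B3.card + B4.card := by omega
      exact_mod_cast this
    linarith
  · intro p hp
    rw [Finset.mem_sdiff, Finset.mem_union, Finset.mem_union, Finset.mem_union] at hp
    obtain ⟨hpA, hpB⟩ := hp
    push Not at hpB
    obtain ⟨⟨⟨n1, n2⟩, n3⟩, n4⟩ := hpB
    refine ⟨hpA, ?_, ?_, ?_⟩
    · intro x hx n P hqn hnq hPz hN
      by_cases hnN : n ≤ N0
      · apply n1
        refine Finset.mem_filter.2 ⟨hpA, (P, n), ?_, x, hx, hN⟩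
        rw [hS0, Finset.mem_filter, Set.Finite.mem_toFinset]
        exact ⟨⟨hqn, hnN, x, InB_box w hw0 τ hτ q' hq1 a l p hpA x hx, hN⟩, hPz⟩
      · exact n2 (Finset.mem_filter.2 ⟨hpA, n, P, x, not_le.1 hnN, hnq, hx, hN⟩)
    · intro n P hn1 hnq
      by_contra! hcon
      exact n3 (Finset.mem_filter.2 ⟨hpA, n, P, hn1, hnq, hcon⟩)
    · intro x hx k hk1 hk2 hk3
      apply n4
      refine Finset.mem_filter.2 ⟨hpA, k, ?_, x, hx, hk3⟩
      rw [hK, Finset.mem_filter, Set.Finite.mem_toFinset]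
      exact ⟨hk1, hk2, x, InB_box w hw0 τ hτ q' hq1 a l p hpA x hx, hk3⟩


/-- `p/q` is badly approximable by smaller denominators (weight `u`) -/
def Far {d : ℕ} (u : Fin d → ℝ) (c : ℝ) (q : ℕ) (p : Fin d → ℤ) : Prop :=
  ∀ (n : ℕ) (P : Fin d → ℤ), 1 ≤ n → n < q → ∃ i, (c / q) ^ u i ≤ |(n : ℝ) * (p i / q) - P i|

lemma Far.all {d : ℕ} {u : Fin d → ℝ} (hu0 : ∀ i, 0 < u i) {c : ℝ} (hc0 : 0 < c) (hc1 : c ≤ 1)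
    {q : ℕ} (hq : 1 ≤ q) {p : Fin d → ℤ} (h : Far u c q p) (n : ℕ) (P : Fin d → ℤ)
    (hne : ∃ i, (P i : ℝ) ≠ n * (p i / q)) : ∃ i, (c / q) ^ u i ≤ |(n : ℝ) * (p i / q) - P i| := by
  have hq1 : (1 : ℝ) ≤ q := by exact_mod_cast hq
  have hq0 : (0 : ℝ) < q := by linarith
  obtain ⟨m, hm⟩ : ∃ m, m = n / q := ⟨_, rfl⟩
  have hdm : (n : ℝ) = q * m + (n % q : ℕ) := by
    rw [hm]; exact_mod_cast (Nat.div_add_mod n q).symm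
  have hcq : ∀ i, (c / q) ^ u i ≤ 1 := fun i => by
    apply Real.rpow_le_one (by positivity) _ (hu0 i).le
    rw [div_le_one hq0]; linarith
  have heq : ∀ i, (n : ℝ) * (p i / q) - P i = (n % q : ℕ) * (p i / q) - ((P i - m * p i : ℤ) : ℝ) := by
    intro i
    push_cast
    have : (q * m + (n % q : ℕ) : ℝ) * (p i / q) = m * p i + (n % q : ℕ) * (p i / q) := by
      field_simp
    rw [← hdm] at this
    linarith
  by_cases h0 : n % q = 0
  · obtain ⟨i, hi⟩ := hne
    refine ⟨i, (hcq i).trans ?_⟩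
    have e := heq i
    have hne' : (n : ℝ) * (p i / q) - P i ≠ 0 := fun hh => hi (by linarith)
    rw [e] at hne' ⊢
    rw [h0] at hne' ⊢
    simp only [Nat.cast_zero, zero_mul, zero_sub, abs_neg] at hne' ⊢
    have hne'' : (P i - m * p i : ℤ) ≠ 0 := by
      intro hh; apply hne'; rw [hh]; simp
    exact_mod_cast Int.one_le_abs hne''
  · obtain ⟨i, hi⟩ := h (n % q) (fun i => P i - m * p i) (by omega) (Nat.mod_lt _ (by omega))
    exact ⟨i, by rw [heq i]; exact hi⟩

lemma Far.sep_block {d : ℕ} {u : Fin d → ℝ} (hu0 : ∀ i, 0 < u i) {c : ℝ} (hc0 : 0 < c) (hc1 : c ≤ 1)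
    {q : ℕ} (hq : 1 ≤ q) {p : Fin d → ℤ} (h : Far u c q p) (n n' : ℕ) (P P' : Fin d → ℤ)
    (hne : (P, n) ≠ (P', n')) (hlt : n / q = n' / q) :
    ∃ i, (c / q) ^ u i ≤ |((n : ℝ) * (p i / q) - P i) - (n' * (p i / q) - P' i)| := by
  have hq1 : (1 : ℝ) ≤ q := by exact_mod_cast hq
  have hq0 : (0 : ℝ) < q := by linarith
  have hcq : ∀ i, (c / q) ^ u i ≤ 1 := fun i => by
    apply Real.rpow_le_one (by positivity) _ (hu0 i).le
    rw [div_le_one hq0]; linarith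
  have hm := Nat.div_add_mod n q
  have hm' := Nat.div_add_mod n' q
  have l1 := Nat.mod_lt n (show q > 0 by omega)
  have l2 := Nat.mod_lt n' (show q > 0 by omega)
  rw [hlt] at hm
  rcases lt_trichotomy n n' with hh | hh | hh
  · obtain ⟨i, hi⟩ := h (n' - n) (fun i => P' i - P i) (by omega) (by omega)
    refine ⟨i, hi.trans (le_of_eq ?_)⟩
    rw [Nat.cast_sub hh.le, ← abs_neg]
    congr 1
    push_cast
    ring
  · subst hh
    have : P ≠ P' := fun h => hne (by rw [h])
    obtain ⟨i, hi⟩ := Function.ne_iff.1 this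
    refine ⟨i, (hcq i).trans ?_⟩
    have : (n : ℝ) * (p i / q) - P i - (n * (p i / q) - P' i) = ((P' i - P i : ℤ) : ℝ) := by push_cast; ring
    rw [this]
    exact_mod_cast Int.one_le_abs (sub_ne_zero.2 hi.symm)
  · obtain ⟨i, hi⟩ := h (n - n') (fun i => P i - P' i) (by omega) (by omega)
    refine ⟨i, hi.trans (le_of_eq ?_)⟩
    rw [Nat.cast_sub hh.le]
    congr 1
    push_cast
    ring

lemma Far.sep_center {d : ℕ} {u : Fin d → ℝ} (hu0 : ∀ i, 0 < u i) (hu1 : ∀ i, u i < 1) {c : ℝ} (hc0 : 0 < c) (hc1 : c ≤ 1)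
    {Q q q' : ℕ} (hQ : 1 ≤ Q) (hq : Q ≤ q) (hq2 : q < 2 * Q) (hq' : Q ≤ q') (hq2' : q' < 2 * Q)
    {p p' : Fin d → ℤ} (h : Far u c q p) (hlt : q' < q) :
    ∃ i, (c / 4) * (Q : ℝ) ^ (-1 - u i) ≤ |(p i : ℝ) / q - p' i / q'| := by
  have hQ0 : (0 : ℝ) < Q := by exact_mod_cast hQ
  have hq0 : (0 : ℝ) < q := by exact_mod_cast (by omega : 0 < q)
  have hq0' : (0 : ℝ) < q' := by exact_mod_cast (by omega : 0 < q')
  have hqQ : (q : ℝ) ≤ 2 * Q := by exact_mod_cast hq2.le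
  have hqQ' : (q' : ℝ) ≤ 2 * Q := by exact_mod_cast hq2'.le
  obtain ⟨i, hi⟩ := h q' p' (by omega) hlt
  refine ⟨i, ?_⟩
  have e1 : (q' : ℝ) * (p i / q) - p' i = q' * (p i / q - p' i / q') := by field_simp
  rw [e1, abs_mul, abs_of_pos hq0'] at hi
  have e2 : (c / (2 * Q)) ^ u i ≤ (c / q) ^ u i := by
    apply Real.rpow_le_rpow (by positivity) _ (hu0 i).le
    gcongr
  have e3 : (c / 2) * (Q : ℝ) ^ (-u i) ≤ (c / (2 * Q)) ^ u i := by
    rw [show c / (2 * Q) = (c / 2) / Q by field_simp, Real.div_rpow (by positivity) hQ0.le,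
      Real.rpow_neg hQ0.le, ← div_eq_mul_inv]
    gcongr
    calc c / 2 = (c / 2) ^ (1 : ℝ) := (Real.rpow_one _).symm
      _ ≤ _ := Real.rpow_le_rpow_of_exponent_ge (by positivity) (by linarith) (hu1 i).le
  have e4 : (q' : ℝ) * |(p i : ℝ) / q - p' i / q'| ≤ 2 * Q * |(p i : ℝ) / q - p' i / q'| := by gcongr
  rw [show -1 - u i = -u i - 1 by ring, Real.rpow_sub_one hQ0.ne']
  have e5 : (c / 2) * (Q : ℝ) ^ (-u i) ≤ 2 * Q * |(p i : ℝ) / q - p' i / q'| := by linarith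
  have : (c / 4) * ((Q : ℝ) ^ (-u i) / Q) = ((c / 2) * (Q : ℝ) ^ (-u i)) / (2 * Q) := by field_simp; norm_num
  rw [this, div_le_iff₀ (by positivity)]
  linarith

lemma Far.sep {d : ℕ} {u : Fin d → ℝ} (hu0 : ∀ i, 0 < u i) (hu1 : ∀ i, u i < 1) {c : ℝ} (hc0 : 0 < c) (hc1 : c ≤ 1)
    {Q q q' : ℕ} (hQ : 1 ≤ Q) (hq : Q ≤ q) (hq2 : q < 2 * Q) (hq' : Q ≤ q') (hq2' : q' < 2 * Q)
    {p p' : Fin d → ℤ} (h : Far u c q p) (h' : Far u c q' p') (hne : q = q' → p ≠ p') :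
    ∃ i, (c / 4) * (Q : ℝ) ^ (-1 - u i) ≤ |(p i : ℝ) / q - p' i / q'| := by
  rcases lt_trichotomy q q' with hh | hh | hh
  · obtain ⟨i, hi⟩ := Far.sep_center hu0 hu1 hc0 hc1 hQ hq' hq2' hq hq2 (p' := p) h' hh
    exact ⟨i, by rw [abs_sub_comm]; exact hi⟩
  · replace hne := hne hh
    subst hh
    obtain ⟨i, hi⟩ := Function.ne_iff.1 hne
    refine ⟨i, ?_⟩
    have hQ1 : (1 : ℝ) ≤ Q := by exact_mod_cast hQ
    have hQ0 : (0 : ℝ) < Q := by linarith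
    have hq0 : (0 : ℝ) < q := by exact_mod_cast (by omega : 0 < q)
    have hqQ : (q : ℝ) ≤ 2 * Q := by exact_mod_cast hq2.le
    have e1 : (1 : ℝ) ≤ |(p i : ℝ) - p' i| := by exact_mod_cast Int.one_le_abs (sub_ne_zero.2 hi)
    rw [← sub_div, abs_div, abs_of_pos hq0, le_div_iff₀ hq0]
    refine le_trans ?_ e1
    have e2 : (Q : ℝ) ^ (-1 - u i) ≤ (Q : ℝ) ^ (-1 : ℝ) :=
      Real.rpow_le_rpow_of_exponent_le hQ1 (by linarith [hu0 i])
    rw [Real.rpow_neg_one] at e2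
    calc c / 4 * (Q : ℝ) ^ (-1 - u i) * q ≤ 1 / 4 * (Q : ℝ)⁻¹ * (2 * Q) := by gcongr
      _ ≤ 1 := by field_simp; norm_num
  · exact Far.sep_center hu0 hu1 hc0 hc1 hQ hq hq2 hq' hq2' h hh

lemma L6 {d : ℕ} (hd : 1 ≤ d) (w : Fin d → ℝ) (hw0 : ∀ i, 0 < w i) (hwsum : ∑ i, w i = 1)
    (τ : ℝ) (hτ : 1 < τ) (u : Fin d → ℝ) (hu0 : ∀ i, 0 < u i) (hu1 : ∀ i, u i < 1)
    (δ : ℝ) (hδ : 0 < δ) (hδu : ∀ i, u i + δ ≤ τ * w i) (c : ℝ) (hc0 : 0 < c) (hc1 : c ≤ 1)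
    (ε : ℝ) (hε : 0 < ε) :
    ∀ᶠ q : ℕ in atTop, ∀ p : Fin d → ℤ, Far u c q p →
      ∀ S : Finset ((Fin d → ℤ) × ℕ),
      (∀ pq ∈ S, q ≤ pq.2 ∧ (∃ i, (pq.1 i : ℝ) ≠ pq.2 * (p i / q)) ∧
        ∃ x : Fin d → ℝ, InB w τ q p x ∧ Near w τ pq.2 x pq.1) →
      ∑ pq ∈ S, ∏ i, (2 * (pq.2 : ℝ) ^ (-1 - τ * w i)) ≤ (1/10) * ∏ i, ((ε / 2) * (q : ℝ) ^ (-1 - τ * w i)) := by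
  classical
  set Z := ∑' m : ℕ, (m : ℝ) ^ (-τ) with hZ
  have hsum : Summable (fun n : ℕ => (n : ℝ) ^ (-τ)) := Real.summable_nat_rpow.2 (by linarith)
  have hZ0 : 0 ≤ Z := tsum_nonneg fun m => by positivity
  have hlim : Tendsto (fun q : ℕ => (24 / c) ^ d * Z * ((q : ℝ) ^ (-δ)) ^ d) atTop (𝓝 0) := by
    have h1 : Tendsto (fun q : ℕ => (q : ℝ) ^ (-δ)) atTop (𝓝 0) :=
      (tendsto_rpow_neg_atTop hδ).comp tendsto_natCast_atTop_atTop
    have h2 := (h1.pow d).const_mul ((24 / c) ^ d * Z)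
    rwa [zero_pow (by omega), mul_zero] at h2
  filter_upwards [hlim.eventually_le_const (show 0 < (1/10) * (ε / 2) ^ d by positivity), eventually_ge_atTop 1]
    with q hqlim hq p hF S hS
  have hq1 : (1 : ℝ) ≤ q := by exact_mod_cast hq
  have hq0 : (0 : ℝ) < q := by linarith
  have hprod : ∀ n : ℝ, 0 < n → ∏ i, n ^ (-1 - τ * w i) = n ^ (-(d : ℝ) - τ) := by
    intro n hn
    rw [← Real.rpow_sum_of_pos hn]
    congr 1
    rw [Finset.sum_sub_distrib, ← Finset.mul_sum, hwsum]
    simp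
  have hterm : ∀ n : ℝ, 0 < n → ∏ i, (2 * n ^ (-1 - τ * w i)) = 2 ^ d * n ^ (-(d : ℝ) - τ) := by
    intro n hn
    rw [Finset.prod_mul_distrib, hprod n hn]; simp
  have hRHS : ∏ i, ((ε / 2) * (q : ℝ) ^ (-1 - τ * w i)) = (ε / 2) ^ d * (q : ℝ) ^ (-(d : ℝ) - τ) := by
    rw [Finset.prod_mul_distrib, hprod q hq0, Finset.prod_const, Finset.card_univ, Fintype.card_fin]
  rw [hRHS]
  set T := S.image (fun pq => pq.2 / q) with hT
  have hT1 : ∀ m ∈ T, 1 ≤ m := by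
    intro m hm
    obtain ⟨pq, hpq, rfl⟩ := Finset.mem_image.1 hm
    exact Nat.div_pos (hS pq hpq).1 (by omega)
  rw [← Finset.sum_fiberwise_of_maps_to (g := fun pq : (Fin d → ℤ) × ℕ => pq.2 / q) (t := T)
    (fun pq hpq => Finset.mem_image_of_mem _ hpq)]
  have hblock : ∀ m ∈ T, ∑ pq ∈ S with pq.2 / q = m, ∏ i, (2 * (pq.2 : ℝ) ^ (-1 - τ * w i)) ≤
      (24 / c) ^ d * ((q : ℝ) ^ (-δ)) ^ d * (q : ℝ) ^ (-(d : ℝ) - τ) * (m : ℝ) ^ (-τ) := by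
    intro m hm
    have hm1 : (1 : ℝ) ≤ m := by exact_mod_cast hT1 m hm
    have hm0 : (0 : ℝ) < m := by linarith
    set Sm := S.filter (fun pq => pq.2 / q = m) with hSm
    have hmem : ∀ pq ∈ Sm, (m : ℝ) * q ≤ pq.2 ∧ (pq.2 : ℝ) ≤ (m + 1) * q := by
      intro pq hpq
      have e := (Finset.mem_filter.1 hpq).2
      have e1 := Nat.div_add_mod pq.2 q
      have e2 := Nat.mod_lt pq.2 (show q > 0 by omega)
      rw [e] at e1
      constructor
      · have : m * q ≤ pq.2 := by rw [mul_comm]; omega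
        exact_mod_cast this
      · have : pq.2 ≤ (m + 1) * q := by rw [add_mul, mul_comm m q]; omega
        exact_mod_cast this
    have hy : ∀ pq ∈ Sm, ∀ i, |(pq.2 : ℝ) * (p i / q) - pq.1 i| ≤ 2 * (m + 1) * (q : ℝ) ^ (-(τ * w i)) := by
      intro pq hpq i
      obtain ⟨hq2, _, x, hx, hN⟩ := hS pq (Finset.mem_filter.1 hpq).1
      have hnq : (q : ℝ) ≤ pq.2 := by exact_mod_cast hq2
      obtain ⟨e1, e2, e3⟩ := InB_shift w hw0 τ hτ q hq p x hx i
      have e4 := hN i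
      have e5 : (pq.2 : ℝ) ^ (-(τ * w i)) ≤ (q : ℝ) ^ (-(τ * w i)) := by
        apply Real.rpow_le_rpow_of_nonpos hq0 hnq
        have := hw0 i
        have : 0 < τ * w i := by positivity
        linarith
      have hpow : 0 < (q : ℝ) ^ (-(τ * w i)) := by positivity
      have e6 : (pq.2 : ℝ) * (p i / q) - pq.1 i = (pq.2 * x i - pq.1 i) - (pq.2 / q) * (q * x i - p i) := by
        field_simp; ring
      have e7 : |(pq.2 / q : ℝ) * (q * x i - p i)| ≤ (m + 1) * (q : ℝ) ^ (-(τ * w i)) := by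
        rw [abs_mul, abs_of_nonneg (by positivity : (0 : ℝ) ≤ pq.2 / q), abs_of_nonneg (by linarith)]
        apply mul_le_mul _ (by linarith) (by linarith) (by positivity)
        rw [div_le_iff₀ hq0]; exact (hmem pq hpq).2
      rw [e6]
      refine (abs_sub _ _).trans ?_
      nlinarith
    have hratio : ∀ i, (q : ℝ) ^ (-(τ * w i)) / (c / q) ^ u i ≤ (q : ℝ) ^ (-δ) / c := by
      intro i
      have t1 : (q : ℝ) ^ (-(τ * w i)) ≤ (q : ℝ) ^ (-δ) * (q : ℝ) ^ (- u i) := by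
        rw [← Real.rpow_add hq0]
        exact Real.rpow_le_rpow_of_exponent_le hq1 (by linarith [hδu i])
      have t2 : c * (q : ℝ) ^ (- u i) ≤ (c / q) ^ u i := by
        rw [Real.div_rpow hc0.le hq0.le, Real.rpow_neg hq0.le, ← div_eq_mul_inv]
        gcongr
        calc c = c ^ (1 : ℝ) := (Real.rpow_one _).symm
          _ ≤ _ := Real.rpow_le_rpow_of_exponent_ge hc0 hc1 (hu1 i).le
      rw [div_le_div_iff₀ (by positivity) hc0]
      calc (q : ℝ) ^ (-(τ * w i)) * c ≤ (q : ℝ) ^ (-δ) * (q : ℝ) ^ (- u i) * c := by gcongr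
        _ = (q : ℝ) ^ (-δ) * (c * (q : ℝ) ^ (- u i)) := by ring
        _ ≤ _ := by gcongr
    have hcard : (Sm.card : ℝ) ≤ (12 * m * ((q : ℝ) ^ (-δ) / c)) ^ d := by
      rcases Finset.eq_empty_or_nonempty Sm with he | ⟨pq0, hpq0⟩
      · rw [he]; simp; positivity
      · have hX : 1 ≤ 2 * ((m : ℝ) + 1) * ((q : ℝ) ^ (-δ) / c) := by
          obtain ⟨i, hi⟩ := hF.all hu0 hc0 hc1 hq pq0.2 pq0.1 (hS pq0 (Finset.mem_filter.1 hpq0).1).2.1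
          have h1 := hi.trans (hy pq0 hpq0 i)
          have h2 : 1 ≤ 2 * ((m : ℝ) + 1) * ((q : ℝ) ^ (-(τ * w i)) / (c / q) ^ u i) := by
            rw [← mul_div_assoc, le_div_iff₀ (by positivity)]; linarith
          refine h2.trans ?_
          exact mul_le_mul_of_nonneg_left (hratio i) (by positivity)
        have hpk := packing Sm (fun pq i => (pq.2 : ℝ) * (p i / q) - pq.1 i) (fun _ => 0)
          (fun i => 2 * ((m : ℝ) + 1) * (q : ℝ) ^ (-(τ * w i))) (fun i => (c / q) ^ u i)
          (fun i => by positivity) (fun i => by positivity)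
          (fun pq hpq i => by simpa using hy pq hpq i)
          (fun A hA B hB hAB => by
            have hA' := (Finset.mem_filter.1 hA).2
            have hB' := (Finset.mem_filter.1 hB).2
            exact hF.sep_block hu0 hc0 hc1 hq A.2 B.2 A.1 B.1 hAB (hA'.trans hB'.symm))
        refine hpk.trans ?_
        calc _ ≤ ∏ i : Fin d, (12 * m * ((q : ℝ) ^ (-δ) / c)) := by
              apply Finset.prod_le_prod
              · intro i _; positivity
              · intro i _
                have h1 : 2 * (2 * ((m : ℝ) + 1) * (q : ℝ) ^ (-(τ * w i))) / (c / q) ^ u i ≤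
                    4 * ((m : ℝ) + 1) * ((q : ℝ) ^ (-δ) / c) := by
                  calc _ = 4 * ((m : ℝ) + 1) * ((q : ℝ) ^ (-(τ * w i)) / (c / q) ^ u i) := by ring
                    _ ≤ _ := mul_le_mul_of_nonneg_left (hratio i) (by positivity)
                have h2 : ((m : ℝ) + 1) * ((q : ℝ) ^ (-δ) / c) ≤ (2 * m) * ((q : ℝ) ^ (-δ) / c) := by
                  gcongr; linarith
                linarith
          _ = _ := by simp
    calc ∑ pq ∈ Sm, ∏ i, (2 * (pq.2 : ℝ) ^ (-1 - τ * w i))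
        ≤ ∑ pq ∈ Sm, 2 ^ d * ((m : ℝ) * q) ^ (-(d : ℝ) - τ) := by
          apply Finset.sum_le_sum
          intro pq hpq
          have h1 := (hmem pq hpq).1
          have h0 : 0 < (m : ℝ) * q := by positivity
          rw [hterm _ (h0.trans_le h1)]
          gcongr 2 ^ d * ?_
          apply Real.rpow_le_rpow_of_nonpos h0 h1
          have : (0 : ℝ) ≤ d := by positivity
          linarith
      _ = Sm.card * (2 ^ d * ((m : ℝ) * q) ^ (-(d : ℝ) - τ)) := by rw [Finset.sum_const, nsmul_eq_mul]
      _ ≤ (12 * m * ((q : ℝ) ^ (-δ) / c)) ^ d * (2 ^ d * ((m : ℝ) * q) ^ (-(d : ℝ) - τ)) := by gcongr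
      _ = _ := by
          rw [Real.mul_rpow hm0.le hq0.le, mul_pow, mul_pow, div_pow, div_pow,
            show -(d : ℝ) - τ = -τ - d by ring, Real.rpow_sub hm0, Real.rpow_natCast,
            show (24 : ℝ) ^ d = 12 ^ d * 2 ^ d by rw [← mul_pow]; norm_num]
          field_simp
  refine (Finset.sum_le_sum hblock).trans ?_
  rw [← Finset.mul_sum]
  have hTs : ∑ m ∈ T, (m : ℝ) ^ (-τ) ≤ Z := hsum.sum_le_tsum T (fun m _ => by positivity)
  calc _ ≤ (24 / c) ^ d * ((q : ℝ) ^ (-δ)) ^ d * (q : ℝ) ^ (-(d : ℝ) - τ) * Z := by gcongr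
    _ = ((24 / c) ^ d * Z * ((q : ℝ) ^ (-δ)) ^ d) * (q : ℝ) ^ (-(d : ℝ) - τ) := by ring
    _ ≤ ((1/10) * (ε / 2) ^ d) * (q : ℝ) ^ (-(d : ℝ) - τ) := by gcongr
    _ = _ := by ring


lemma L7 {d : ℕ} (w : Fin d → ℝ) (hw0 : ∀ i, 0 < w i)
    (τ : ℝ) (hτ : 1 < τ) (u : Fin d → ℝ) (hu0 : ∀ i, 0 < u i) (hu1 : ∀ i, u i < 1)
    (huw : ∀ i, u i < τ * w i) (s η : ℝ) (hη : 0 < η)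
    (hB : ∀ t, 0 ≤ t → ∑ i, (max 0 (u i - t) + min 0 (τ * w i - t)) ≤ (d : ℝ) + 1 - (1 + t) * s - 2 * η)
    (c : ℝ) (hc0 : 0 < c) (hc1 : c ≤ 1)
    (ε : ℝ) (hε : 0 < ε) (hε1 : ε < 1) (y : ℕ → Fin d → ℝ) (r : ℕ → ℝ) (hr : ∀ k, 0 < r k)
    (hsumr : ∀ K : Finset ℕ, ∑ k ∈ K, r k ^ s ≤ 1) (V : ℝ) (hV : 0 < V)
    (G : ℕ → Finset (Fin d → ℤ)) (Q0 : ℕ)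
    (hG : ∀ q ≥ Q0, q.Prime → (4/10 : ℝ) * V * (q : ℝ) ^ d ≤ (G q).card ∧ ∀ p ∈ G q, Far u c q p)
    (N : ℕ) :
    ∃ q ≥ N, q.Prime ∧ ∃ p ∈ G q, ∀ K : Finset ℕ,
      (∀ k ∈ K, r k < 1 / (q : ℝ) ∧ ∃ x, InB w τ q p x ∧ ∀ i, |x i - y k i| ≤ r k) →
      ∑ k ∈ K, ∏ i, min 1 (r k / ((ε / 2) * (q : ℝ) ^ (-1 - τ * w i))) ≤ 1 / (10 * 5 ^ d) := by
  classical
  set κ : ℝ := 1 / (10 * 5 ^ d) with hκ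
  have hκ0 : 0 < κ := by positivity
  set CE : ℝ := ∏ i, ((2 / ε) * 2 ^ (1 + τ * w i)) with hCE
  have hCE0 : 0 ≤ CE := Finset.prod_nonneg fun i _ => by positivity
  have hlim : Tendsto (fun Q : ℕ => (4/10) * V * κ * (Q : ℝ) ^ η) atTop atTop := by
    apply Tendsto.const_mul_atTop (by positivity)
    exact (tendsto_rpow_atTop hη).comp tendsto_natCast_atTop_atTop
  obtain ⟨N1, hN1⟩ := eventually_atTop.1 (hlim.eventually_gt_atTop (CE * (17 / c) ^ d))
  obtain ⟨Q, hQN, hQ1, hQcard⟩ := exists_many_primes η hη (N + Q0 + 2 + N1)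
  have hQbig := hN1 Q (by omega)
  set Pr := (Finset.Ico Q (2 * Q)).filter Nat.Prime with hPr
  have hPrm : ∀ q ∈ Pr, Q ≤ q ∧ q < 2 * Q ∧ q.Prime := by
    intro q hq
    rw [hPr, Finset.mem_filter, Finset.mem_Ico] at hq
    exact ⟨hq.1.1, hq.1.2, hq.2⟩
  have hQr : (1 : ℝ) < Q := by exact_mod_cast (by omega : 1 < Q)
  have hQ0 : (0 : ℝ) < Q := by linarith
  set T := Pr.sigma G with hT
  by_contra! hcon
  have hK : ∀ v ∈ T, ∃ K : Finset ℕ,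
      (∀ k ∈ K, r k < 1 / (v.1 : ℝ) ∧ ∃ x, InB w τ v.1 v.2 x ∧ ∀ i, |x i - y k i| ≤ r k) ∧
      κ < ∑ k ∈ K, ∏ i, min 1 (r k / ((ε / 2) * (v.1 : ℝ) ^ (-1 - τ * w i))) := by
    rintro ⟨q, p⟩ hv
    obtain ⟨h1, h2⟩ := Finset.mem_sigma.1 hv
    exact hcon q (by have := (hPrm q h1).1; omega) (hPrm q h1).2.2 p h2
  choose! KK hKK using hK
  set KA := T.biUnion KK with hKA
  have hTcard : (4/10 : ℝ) * V * (Q : ℝ) ^ d * (Q : ℝ) ^ (1 - η) ≤ T.card := by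
    rw [hT, Finset.card_sigma]
    push_cast
    calc (4/10 : ℝ) * V * (Q : ℝ) ^ d * (Q : ℝ) ^ (1 - η) ≤ (4/10 : ℝ) * V * (Q : ℝ) ^ d * Pr.card := by gcongr
      _ = ∑ q ∈ Pr, (4/10 : ℝ) * V * (Q : ℝ) ^ d := by rw [Finset.sum_const, nsmul_eq_mul]; ring
      _ ≤ _ := by
        apply Finset.sum_le_sum
        intro q hq
        obtain ⟨h1, h2, h3⟩ := hPrm q hq
        have h4 : (Q : ℝ) ≤ q := by exact_mod_cast h1
        refine le_trans ?_ (hG q (by omega) h3).1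
        gcongr
  have hup : (T.card : ℝ) * κ ≤ CE * (17 / c) ^ d * (Q : ℝ) ^ ((d : ℝ) + 1 - 2 * η) := by
    calc (T.card : ℝ) * κ = ∑ v ∈ T, κ := by rw [Finset.sum_const, nsmul_eq_mul]
      _ ≤ ∑ v ∈ T, ∑ k ∈ KK v, CE * ∏ i, min 1 (r k * (Q : ℝ) ^ (1 + τ * w i)) := by
        apply Finset.sum_le_sum
        intro v hv
        obtain ⟨h1, h2⟩ := hKK v hv
        refine h2.le.trans (Finset.sum_le_sum fun k hk => ?_)
        rw [hCE, ← Finset.prod_mul_distrib]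
        obtain ⟨hv1, hv2⟩ := Finset.mem_sigma.1 hv
        obtain ⟨p1, p2, p3⟩ := hPrm v.1 hv1
        have hv0 : (0 : ℝ) < v.1 := by exact_mod_cast p3.pos
        have hv2Q : (v.1 : ℝ) ≤ 2 * Q := by exact_mod_cast p2.le
        have hrk := hr k
        apply Finset.prod_le_prod
        · intro i _; positivity
        · intro i _
          have hwi := hw0 i
          have A1 : (1 : ℝ) ≤ (2 / ε) * 2 ^ (1 + τ * w i) := by
            have t1 : 1 ≤ 2 / ε := by rw [le_div_iff₀ hε]; linarith
            have t2 : (1 : ℝ) ≤ 2 ^ (1 + τ * w i) := Real.one_le_rpow (by norm_num) (by positivity)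
            nlinarith
          have A2 : r k / ((ε / 2) * (v.1 : ℝ) ^ (-1 - τ * w i)) ≤
              ((2 / ε) * 2 ^ (1 + τ * w i)) * (r k * (Q : ℝ) ^ (1 + τ * w i)) := by
            have t1 : r k / ((ε / 2) * (v.1 : ℝ) ^ (-1 - τ * w i)) = (2 / ε) * r k * (v.1 : ℝ) ^ (1 + τ * w i) := by
              rw [show -1 - τ * w i = -(1 + τ * w i) by ring, Real.rpow_neg hv0.le]
              field_simp
            have t2 : (v.1 : ℝ) ^ (1 + τ * w i) ≤ 2 ^ (1 + τ * w i) * (Q : ℝ) ^ (1 + τ * w i) := by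
              rw [← Real.mul_rpow (by norm_num) hQ0.le]
              exact Real.rpow_le_rpow hv0.le hv2Q (by positivity)
            rw [t1]
            calc _ ≤ (2 / ε) * r k * (2 ^ (1 + τ * w i) * (Q : ℝ) ^ (1 + τ * w i)) := by gcongr
              _ = _ := by ring
          rw [mul_min_of_nonneg _ _ (by linarith)]
          exact min_le_min (by linarith) A2
      _ = ∑ k ∈ KA, ∑ v ∈ T with k ∈ KK v, CE * ∏ i, min 1 (r k * (Q : ℝ) ^ (1 + τ * w i)) := by
        apply Finset.sum_comm'
        intro v k
        rw [hKA, Finset.mem_biUnion, Finset.mem_filter]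
        constructor
        · rintro ⟨h1, h2⟩; exact ⟨⟨h1, h2⟩, v, h1, h2⟩
        · rintro ⟨⟨h1, h2⟩, _⟩; exact ⟨h1, h2⟩
      _ ≤ ∑ k ∈ KA, CE * (17 / c) ^ d * (Q : ℝ) ^ ((d : ℝ) + 1 - 2 * η) * r k ^ s := by
        apply Finset.sum_le_sum
        intro k hk
        rw [Finset.sum_const, nsmul_eq_mul]
        have hrk := hr k
        set Tk := T.filter (fun v => k ∈ KK v) with hTk
        have hpk := packing Tk (fun v i => (v.2 i : ℝ) / v.1) (y k) (fun i => r k + (Q : ℝ) ^ (-1 - u i))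
          (fun i => (c / 4) * (Q : ℝ) ^ (-1 - u i)) (fun i => by positivity) (fun i => by positivity)
          (by
            intro v hv i
            obtain ⟨hvT, hvk⟩ := Finset.mem_filter.1 hv
            obtain ⟨hv1, hv2⟩ := Finset.mem_sigma.1 hvT
            obtain ⟨p1, p2, p3⟩ := hPrm v.1 hv1
            obtain ⟨_, x, hx, hxy⟩ := (hKK v hvT).1 k hvk
            obtain ⟨e1, e2⟩ := hx i
            have e3 := hxy i
            have e4 : (v.1 : ℝ) ^ (-1 - τ * w i) ≤ (Q : ℝ) ^ (-1 - u i) := by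
              calc (v.1 : ℝ) ^ (-1 - τ * w i) ≤ (Q : ℝ) ^ (-1 - τ * w i) := by
                    apply Real.rpow_le_rpow_of_nonpos hQ0 (by exact_mod_cast p1)
                    have := hw0 i
                    have : 0 < τ * w i := by positivity
                    linarith
                _ ≤ _ := Real.rpow_le_rpow_of_exponent_le hQr.le (by linarith [huw i])
            rw [abs_le] at e3 ⊢
            constructor <;> linarith)
          (by
            intro v hv v' hv' hne
            obtain ⟨hvT, _⟩ := Finset.mem_filter.1 hv
            obtain ⟨hv1, hv2⟩ := Finset.mem_sigma.1 hvT
            obtain ⟨p1, p2, p3⟩ := hPrm v.1 hv1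
            obtain ⟨hvT', _⟩ := Finset.mem_filter.1 hv'
            obtain ⟨hv1', hv2'⟩ := Finset.mem_sigma.1 hvT'
            obtain ⟨p1', p2', p3'⟩ := hPrm v'.1 hv1'
            have F1 := (hG v.1 (by omega) p3).2 v.2 hv2
            have F2 := (hG v'.1 (by omega) p3').2 v'.2 hv2'
            refine Far.sep hu0 hu1 hc0 hc1 hQ1 p1 p2 p1' p2' F1 F2 ?_
            intro h1 h2
            apply hne
            exact Sigma.ext h1 (heq_of_eq h2))
        have hcard : (Tk.card : ℝ) ≤ (17 / c) ^ d * ∏ i, max 1 (r k * (Q : ℝ) ^ (1 + u i)) := by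
          refine hpk.trans ?_
          calc _ ≤ ∏ i, ((17 / c) * max 1 (r k * (Q : ℝ) ^ (1 + u i))) := by
                apply Finset.prod_le_prod
                · intro i _; positivity
                · intro i _
                  have t1 : 2 * (r k + (Q : ℝ) ^ (-1 - u i)) / ((c / 4) * (Q : ℝ) ^ (-1 - u i)) =
                      (8 / c) * (r k * (Q : ℝ) ^ (1 + u i) + 1) := by
                    rw [show 1 + u i = - (-1 - u i) by ring, Real.rpow_neg hQ0.le]
                    field_simp; norm_num
                  rw [t1]
                  set M := max 1 (r k * (Q : ℝ) ^ (1 + u i)) with hM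
                  have m1 : 1 ≤ M := le_max_left _ _
                  have m2 : r k * (Q : ℝ) ^ (1 + u i) ≤ M := le_max_right _ _
                  have c1 : 1 ≤ 1 / c := by rw [le_div_iff₀ hc0]; linarith
                  have : (8 / c) * (r k * (Q : ℝ) ^ (1 + u i) + 1) ≤ (8 / c) * (M + M) := by gcongr
                  calc _ ≤ (8 / c) * (M + M) + (1 / c) * M := by nlinarith
                    _ = _ := by ring
            _ = _ := by rw [Finset.prod_mul_distrib, Finset.prod_const, Finset.card_univ, Fintype.card_fin]
        have hrQ : r k ≤ 1 / Q := by
          obtain ⟨v, hvT, hvk⟩ := Finset.mem_biUnion.1 hk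
          obtain ⟨p1, p2, p3⟩ := hPrm v.1 (Finset.mem_sigma.1 hvT).1
          refine ((hKK v hvT).1 k hvk).1.le.trans ?_
          have : (Q : ℝ) ≤ v.1 := by exact_mod_cast p1
          gcongr
        have hC := expC w u τ s η hB Q (r k) hQr hrk hrQ
        have hmin0 : 0 ≤ ∏ i, min 1 (r k * (Q : ℝ) ^ (1 + τ * w i)) := Finset.prod_nonneg fun i _ => by positivity
        calc (Tk.card : ℝ) * (CE * ∏ i, min 1 (r k * (Q : ℝ) ^ (1 + τ * w i)))
            ≤ ((17 / c) ^ d * ∏ i, max 1 (r k * (Q : ℝ) ^ (1 + u i))) *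
              (CE * ∏ i, min 1 (r k * (Q : ℝ) ^ (1 + τ * w i))) := by gcongr
          _ = CE * (17 / c) ^ d * ((∏ i, max 1 (r k * (Q : ℝ) ^ (1 + u i))) * ∏ i, min 1 (r k * (Q : ℝ) ^ (1 + τ * w i))) := by ring
          _ ≤ CE * (17 / c) ^ d * (r k ^ s * (Q : ℝ) ^ ((d : ℝ) + 1 - 2 * η)) := by gcongr
          _ = _ := by ring
      _ = CE * (17 / c) ^ d * (Q : ℝ) ^ ((d : ℝ) + 1 - 2 * η) * ∑ k ∈ KA, r k ^ s := by rw [Finset.mul_sum]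
      _ ≤ CE * (17 / c) ^ d * (Q : ℝ) ^ ((d : ℝ) + 1 - 2 * η) * 1 := by
        gcongr; exact hsumr KA
      _ = _ := by ring
  have hlow : (4/10 : ℝ) * V * κ * (Q : ℝ) ^ η * (Q : ℝ) ^ ((d : ℝ) + 1 - 2 * η) ≤ T.card * κ := by
    calc _ = ((4/10 : ℝ) * V * (Q : ℝ) ^ d * (Q : ℝ) ^ (1 - η)) * κ := by
          rw [← Real.rpow_natCast, mul_assoc _ ((Q : ℝ) ^ η), ← Real.rpow_add hQ0,
            mul_assoc _ ((Q : ℝ) ^ (d : ℝ)), ← Real.rpow_add hQ0]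
          rw [show η + ((d : ℝ) + 1 - 2 * η) = d + (1 - η) by ring]
          ring
      _ ≤ _ := by gcongr
  have hpos : 0 < (Q : ℝ) ^ ((d : ℝ) + 1 - 2 * η) := by positivity
  have := mul_lt_mul_of_pos_right hQbig hpos
  linarith


/-- membership in an axis-parallel box -/
def InBox {d : ℕ} (a l : Fin d → ℝ) (x : Fin d → ℝ) : Prop := ∀ i, a i ≤ x i ∧ x i ≤ a i + l i

/-- lower corner of the next box -/
noncomputable def nA {d : ℕ} (w : Fin d → ℝ) (τ ε : ℝ) (q : ℕ) (p : Fin d → ℤ) : Fin d → ℝ :=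
  fun i => (p i : ℝ) / q + (1 - ε) * (q : ℝ) ^ (-1 - τ * w i)

/-- side lengths of the next box -/
noncomputable def nL {d : ℕ} (w : Fin d → ℝ) (τ ε : ℝ) (q : ℕ) : Fin d → ℝ :=
  fun i => (ε / 2) * (q : ℝ) ^ (-1 - τ * w i)

lemma InBox_InB {d : ℕ} (w : Fin d → ℝ) (τ ε : ℝ) (hε : 0 < ε) (hε1 : ε < 1) (q : ℕ) (hq : 1 ≤ q)
    (p : Fin d → ℤ) (x : Fin d → ℝ) (hx : InBox (nA w τ ε q p) (nL w τ ε q) x) : InB w τ q p x := by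
  intro i
  have hq0 : (0 : ℝ) < q := by exact_mod_cast hq
  obtain ⟨h1, h2⟩ := hx i
  simp only [nA, nL] at h1 h2
  have hp : 0 < (q : ℝ) ^ (-1 - τ * w i) := by positivity
  constructor <;> nlinarith

/-- parameters fixed throughout the construction -/
structure Par {d : ℕ} (w : Fin d → ℝ) (τ : ℝ) (u : Fin d → ℝ) (s η : ℝ) : Prop where
  hd : 1 ≤ d
  hw0 : ∀ i, 0 < w i
  hw1 : ∀ i, w i < 1
  hwsum : ∑ i, w i = 1
  hτ : 1 < τ
  hu0 : ∀ i, 0 < u i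
  hu1 : ∀ i, u i < 1
  husum : ∑ i, u i = 1
  huw : ∀ i, u i < τ * w i
  hs : 0 < s
  hsd : s ≤ d
  hη : 0 < η
  hB : ∀ t, 0 ≤ t → ∑ i, (max 0 (u i - t) + min 0 (τ * w i - t)) ≤ (d : ℝ) + 1 - (1 + t) * s - 2 * η

lemma step_state {d : ℕ} {w : Fin d → ℝ} {τ : ℝ} {u : Fin d → ℝ} {s η : ℝ} (H : Par w τ u s η)
    (y : ℕ → Fin d → ℝ) (r : ℕ → ℝ) (hr : ∀ k, 0 < r k)
    (hsumr : ∀ K : Finset ℕ, ∑ k ∈ K, r k ^ s ≤ 1) (hfin : ∀ δ > 0, {k | δ ≤ r k}.Finite)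
    (q : ℕ) (z a l : Fin d → ℝ) (h : GoodState w τ y r q z a l)
    (ε : ℝ) (hε : 0 < ε) (hε1 : ε < 1) :
    ∃ (q' : ℕ) (p : Fin d → ℤ), q < q' ∧
      GoodState w τ y r q' (fun i => (p i : ℝ) / q') (nA w τ ε q' p) (nL w τ ε q') ∧
      ∀ x, InBox (nA w τ ε q' p) (nL w τ ε q') x → InBox a l x ∧
        (∀ (n : ℕ) (P : Fin d → ℤ), q ≤ n → n < q' → (∃ i, (P i : ℝ) ≠ n * z i) → ¬ Near w τ n x P) ∧
        (∀ k, 1 / (q' : ℝ) ≤ r k → r k < 1 / (q : ℝ) → ¬ ∀ i, |x i - y k i| ≤ r k) := by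
  obtain ⟨c, hc0, hc1, Q0, hQ0⟩ := L5 w H.hw0 H.hw1 H.hwsum τ H.hτ u H.hu0 H.hu1 H.husum y r hfin q z a l h
  have hV : 0 < ∏ i, l i := Finset.prod_pos fun i _ => h.hl i
  obtain ⟨δ, hδ, hδu⟩ : ∃ δ > 0, ∀ i, u i + δ ≤ τ * w i := by
    have hne : Nonempty (Fin d) := ⟨⟨0, H.hd⟩⟩
    obtain ⟨i0, hi0⟩ := Finite.exists_min (fun i => τ * w i - u i)
    exact ⟨τ * w i0 - u i0, by linarith [H.huw i0], fun i => by linarith [hi0 i]⟩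
  obtain ⟨N1, hN1⟩ := eventually_atTop.1 (L6 H.hd w H.hw0 H.hwsum τ H.hτ u H.hu0 H.hu1 δ hδ hδu c hc0 hc1 ε hε)
  choose! G hG using hQ0
  obtain ⟨q', hq', hpr, p, hp, hPot⟩ := L7 w H.hw0 τ H.hτ u H.hu0 H.hu1 H.huw s η H.hη H.hB c hc0 hc1 ε hε hε1 y r hr
    hsumr (∏ i, l i) hV G Q0 (fun q' hq' hpr => ⟨(hG q' hq' hpr).1, fun p hp => ((hG q' hq' hpr).2 p hp).2.2.1⟩)
    (q + 1 + Q0 + N1)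
  obtain ⟨hp1, hp2, hp3, hp4⟩ := (hG q' (by omega) hpr).2 p hp
  have hq1 : 1 ≤ q' := hpr.one_lt.le
  have hq0 : (0 : ℝ) < q' := by exact_mod_cast hq1
  have hsub := fun x hx => InBox_InB w τ ε hε hε1 q' hq1 p x hx
  have hbox := fun x hx => InB_box w H.hw0 τ H.hτ q' hq1 a l p hp1 x (hsub x hx)
  have hl' : ∀ i, 0 < nL w τ ε q' i := fun i => by simp only [nL]; positivity
  have hc1 := hbox (nA w τ ε q' p) (fun i => ⟨le_rfl, by linarith [hl' i]⟩)
  have hc2 := hbox (fun i => nA w τ ε q' p i + nL w τ ε q' i) (fun i => ⟨by linarith [hl' i], le_rfl⟩)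
  refine ⟨q', p, by omega, ⟨hq1, hl', ?_, ?_, ?_, ?_⟩, ?_⟩
  · intro i; exact (h.ha i).trans (hc1 i).1
  · intro i; exact (hc2 i).2.trans (h.hal i)
  · intro S hS
    apply hN1 q' (by omega) p hp3 S
    intro pq hpq
    obtain ⟨e1, e2, x, hx, hN⟩ := hS pq hpq
    exact ⟨e1, e2, x, hsub x hx, hN⟩
  · intro K hK
    apply hPot K
    intro k hk
    obtain ⟨e1, x, hx, hN⟩ := hK k hk
    exact ⟨e1, x, hsub x hx, hN⟩
  · intro x hx
    exact ⟨hbox x hx, hp2 x (hsub x hx), hp4 x (hsub x hx)⟩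

lemma init_state {d : ℕ} (w : Fin d → ℝ) (hw0 : ∀ i, 0 < w i) (hwsum : ∑ i, w i = 1) (τ : ℝ) (hτ : 1 < τ)
    (s : ℝ) (hs : 0 < s) (hsd : s ≤ d) :
    ∃ q : ℕ, 1 ≤ q ∧ ∀ (y : ℕ → Fin d → ℝ) (r : ℕ → ℝ), (∀ k, 0 < r k) → (∀ k, r k < 1) →
      (∀ K : Finset ℕ, ∑ k ∈ K, r k ^ s ≤ 1 / (10 * 5 ^ d) / 2 ^ d) →
      GoodState w τ y r q (fun _ => 0) (fun _ => 0) (fun _ => 1 / 2) := by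
  classical
  obtain ⟨N0, hN0⟩ := tail_small τ hτ ((1/10) * (1/20) ^ d) (by positivity)
  refine ⟨N0 + 1, by omega, fun y r hr hr1 hsum => ⟨by omega, fun _ => by norm_num, fun _ => le_rfl, fun _ => by norm_num, ?_, ?_⟩⟩
  · intro S hS
    set T := S.image (fun pq => pq.2) with hT
    rw [← Finset.sum_fiberwise_of_maps_to (g := fun pq : (Fin d → ℤ) × ℕ => pq.2) (t := T)
      (fun pq hpq => Finset.mem_image_of_mem _ hpq)]
    have hTm : ∀ n ∈ T, N0 < n := by
      intro n hn
      obtain ⟨pq, hpq, rfl⟩ := Finset.mem_image.1 hn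
      have := (hS pq hpq).1; omega
    have hb : ∀ n ∈ T, ∑ pq ∈ S with pq.2 = n, ∏ i, (2 * (pq.2 : ℝ) ^ (-1 - τ * w i)) ≤ 10 ^ d * (n : ℝ) ^ (-τ) := by
      intro n hn
      have hn1 : (1 : ℝ) ≤ n := by exact_mod_cast (show 1 ≤ n by have := hTm n hn; omega)
      have hn0 : (0 : ℝ) < n := by linarith
      have hprod : ∏ i, (2 * (n : ℝ) ^ (-1 - τ * w i)) = 2 ^ d * (n : ℝ) ^ (-(d : ℝ) - τ) := by
        rw [Finset.prod_mul_distrib, ← Real.rpow_sum_of_pos hn0, Finset.prod_const, Finset.card_univ, Fintype.card_fin]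
        congr 2
        rw [Finset.sum_sub_distrib, ← Finset.mul_sum, hwsum]
        simp
      set Sn := S.filter (fun pq => pq.2 = n) with hSn
      have hinj : Set.InjOn Prod.fst (Sn : Set ((Fin d → ℤ) × ℕ)) := by
        intro A hA B hB hAB
        have h1 := (Finset.mem_filter.1 hA).2
        have h2 := (Finset.mem_filter.1 hB).2
        exact Prod.ext hAB (h1.trans h2.symm)
      have hcard : (Sn.card : ℝ) ≤ (5 * (n : ℝ)) ^ d := by
        rw [← Finset.card_image_of_injOn hinj]
        refine (int_box (Sn.image Prod.fst) (fun _ => 0) (fun _ => 2 * n) (fun _ => by positivity) ?_).trans ?_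
        · intro P hP i
          obtain ⟨pq, hpq, rfl⟩ := Finset.mem_image.1 hP
          obtain ⟨h1, h2⟩ := Finset.mem_filter.1 hpq
          obtain ⟨e1, e2, x, hx, hN⟩ := hS pq h1
          have e3 := hN i
          rw [h2] at e3
          have e4 : (n : ℝ) ^ (-(τ * w i)) ≤ 1 := by
            apply Real.rpow_le_one_of_one_le_of_nonpos hn1
            have := hw0 i
            have : 0 < τ * w i := by positivity
            linarith
          have e5 := abs_lt.1 (e3.trans_le e4)
          obtain ⟨e6, e7⟩ := hx i
          have e8 : 0 ≤ (n : ℝ) * x i := by positivity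
          have e9 : (n : ℝ) * x i ≤ n * 1 := by gcongr; linarith
          rw [abs_le]; constructor <;> linarith
        · rw [Finset.prod_const, Finset.card_univ, Fintype.card_fin]
          gcongr
          linarith
      calc ∑ pq ∈ Sn, ∏ i, (2 * (pq.2 : ℝ) ^ (-1 - τ * w i)) = ∑ pq ∈ Sn, 2 ^ d * (n : ℝ) ^ (-(d : ℝ) - τ) := by
            apply Finset.sum_congr rfl
            intro pq hpq
            rw [(Finset.mem_filter.1 hpq).2, hprod]
        _ = Sn.card * (2 ^ d * (n : ℝ) ^ (-(d : ℝ) - τ)) := by rw [Finset.sum_const, nsmul_eq_mul]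
        _ ≤ (5 * (n : ℝ)) ^ d * (2 ^ d * (n : ℝ) ^ (-(d : ℝ) - τ)) := by gcongr
        _ = _ := by
            rw [show -(d : ℝ) - τ = -τ - d by ring, Real.rpow_sub hn0, Real.rpow_natCast, mul_pow,
              show (10 : ℝ) ^ d = 5 ^ d * 2 ^ d by rw [← mul_pow]; norm_num]
            field_simp
    refine (Finset.sum_le_sum hb).trans ?_
    rw [← Finset.mul_sum]
    calc 10 ^ d * ∑ n ∈ T, (n : ℝ) ^ (-τ) ≤ 10 ^ d * ((1/10) * (1/20) ^ d) := by
          gcongr; exact hN0 T hTm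
      _ = (1/10) * (10 * (1 / 20)) ^ d := by rw [mul_pow]; ring
      _ = _ := by rw [Finset.prod_const, Finset.card_univ, Fintype.card_fin]; norm_num
  · intro K _
    calc ∑ k ∈ K, ∏ i : Fin d, min 1 (r k / (1 / 2)) ≤ ∑ k ∈ K, 2 ^ d * r k ^ s := by
          apply Finset.sum_le_sum
          intro k _
          have hk := hr k
          rw [Finset.prod_const, Finset.card_univ, Fintype.card_fin]
          calc (min 1 (r k / (1 / 2))) ^ d ≤ (r k / (1 / 2)) ^ d := by gcongr; exact min_le_right _ _
            _ = 2 ^ d * r k ^ (d : ℝ) := by rw [Real.rpow_natCast, ← mul_pow]; congr 1; ring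
            _ ≤ _ := by
              gcongr 2 ^ d * ?_
              exact Real.rpow_le_rpow_of_exponent_ge hk (hr1 k).le hsd
      _ = 2 ^ d * ∑ k ∈ K, r k ^ s := by rw [Finset.mul_sum]
      _ ≤ 2 ^ d * (1 / (10 * 5 ^ d) / 2 ^ d) := by gcongr; exact hsum K
      _ = _ := by field_simp


lemma exists_seq {S : Type*} (R : ℕ → S → S → Prop) (h : ∀ j s, ∃ s', R j s s') (s0 : S) :
    ∃ f : ℕ → S, f 0 = s0 ∧ ∀ j, R j (f j) (f (j + 1)) := by
  choose g hg using h
  exact ⟨fun n => Nat.rec s0 (fun j s => g j s) n, rfl, fun j => hg j _⟩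

lemma exists_interval (q : ℕ → ℕ) (hq : StrictMono q) (j0 n : ℕ) (hn : q j0 ≤ n) :
    ∃ j, j0 ≤ j ∧ q j ≤ n ∧ n < q (j + 1) := by
  classical
  have hex : ∃ m, n < q m := ⟨n + 1, by have := hq.id_le (n + 1); simp only [id] at this; omega⟩
  have h1 := Nat.find_spec hex
  have h0 : j0 < Nat.find hex := by
    by_contra hcon
    have := hq.monotone (not_lt.1 hcon)
    omega
  refine ⟨Nat.find hex - 1, by omega, ?_, ?_⟩
  · have := Nat.find_min hex (m := Nat.find hex - 1) (by omega)
    omega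
  · rw [Nat.sub_add_cancel (by omega)]; exact h1

lemma rpow_mul_w {d : ℕ} (w : Fin d → ℝ) (τ c : ℝ) (hc : 0 ≤ c) (n : ℕ) (i : Fin d) :
    (c * (n : ℝ) ^ (-τ)) ^ w i = c ^ w i * (n : ℝ) ^ (-(τ * w i)) := by
  rw [Real.mul_rpow hc (by positivity), ← Real.rpow_mul (by positivity)]
  congr 2
  ring

lemma main_lemma {d : ℕ} {w : Fin d → ℝ} {τ : ℝ} {u : Fin d → ℝ} {s η : ℝ} (H : Par w τ u s η) :
    ∃ κ0 ρ0 : ℝ, 0 < κ0 ∧ 0 < ρ0 ∧ ∀ (y : ℕ → Fin d → ℝ) (r : ℕ → ℝ), (∀ k, 0 < r k) → (∀ k, r k < ρ0) →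
      (∀ K : Finset ℕ, ∑ k ∈ K, r k ^ s ≤ κ0) →
      ∃ x ∈ wExact w τ, ∀ k, ¬ ∀ i, |x i - y k i| ≤ r k := by
  obtain ⟨q0, hq0, hinit⟩ := init_state w H.hw0 H.hwsum τ H.hτ s H.hs H.hsd
  have hq0r : (1 : ℝ) ≤ q0 := by exact_mod_cast hq0
  refine ⟨1 / (10 * 5 ^ d) / 2 ^ d, 1 / q0, by positivity, by positivity, ?_⟩
  intro y r hr hrq hsum
  have hr1 : ∀ k, r k < 1 := fun k => (hrq k).trans_le (by rw [div_le_one (by linarith)]; exact hq0r)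
  have hsum1 : ∀ K : Finset ℕ, ∑ k ∈ K, r k ^ s ≤ 1 := by
    intro K
    refine (hsum K).trans ?_
    have h5 : (1 : ℝ) ≤ 5 ^ d := one_le_pow₀ (by norm_num)
    have h2 : (1 : ℝ) ≤ 2 ^ d := one_le_pow₀ (by norm_num)
    rw [div_div, div_le_one (by positivity)]
    nlinarith
  have hfin : ∀ δ > 0, {k | δ ≤ r k}.Finite := by
    intro δ hδ
    by_contra hinf
    have hinf : {k | δ ≤ r k}.Infinite := hinf
    obtain ⟨m, hm⟩ := exists_nat_gt (1 / δ ^ s)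
    obtain ⟨K, hK, hKm⟩ := hinf.exists_subset_card_eq m
    have h1 : (m : ℝ) * δ ^ s ≤ ∑ k ∈ K, r k ^ s := by
      rw [← hKm, ← nsmul_eq_mul]
      apply Finset.card_nsmul_le_sum
      intro k hk
      exact Real.rpow_le_rpow hδ.le (hK hk) H.hs.le
    have h2 := hsum1 K
    have h3 : 0 < δ ^ s := by positivity
    rw [div_lt_iff₀ h3] at hm
    linarith
  have h0 := hinit y r hr hr1 hsum
  let St := {t : ℕ × (Fin d → ℝ) × (Fin d → ℝ) × (Fin d → ℝ) // GoodState w τ y r t.1 t.2.1 t.2.2.1 t.2.2.2}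
  let ee : ℕ → ℝ := fun j => 1 / ((j : ℝ) + 2)
  have hee0 : ∀ j, 0 < ee j := fun j => by simp only [ee]; positivity
  have hee1 : ∀ j, ee j < 1 := fun j => by
    simp only [ee]
    rw [div_lt_one (by positivity)]
    have : (0 : ℝ) ≤ j := by positivity
    linarith
  obtain ⟨f, hf0, hf⟩ := exists_seq (S := St) (fun j t t' => ∃ p : Fin d → ℤ, t.1.1 < t'.1.1 ∧
      t'.1.2.1 = (fun i => (p i : ℝ) / t'.1.1) ∧ t'.1.2.2.1 = nA w τ (ee j) t'.1.1 p ∧ t'.1.2.2.2 = nL w τ (ee j) t'.1.1 ∧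
      ∀ x, InBox t'.1.2.2.1 t'.1.2.2.2 x → InBox t.1.2.2.1 t.1.2.2.2 x ∧
        (∀ (n : ℕ) (P : Fin d → ℤ), t.1.1 ≤ n → n < t'.1.1 → (∃ i, (P i : ℝ) ≠ n * t.1.2.1 i) → ¬ Near w τ n x P) ∧
        (∀ k, 1 / (t'.1.1 : ℝ) ≤ r k → r k < 1 / (t.1.1 : ℝ) → ¬ ∀ i, |x i - y k i| ≤ r k)) (by
      rintro j ⟨⟨q, z, a, l⟩, ht⟩
      obtain ⟨q', p, e1, e2, e3⟩ := step_state H y r hr hsum1 hfin q z a l ht (ee j) (hee0 j) (hee1 j)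
      exact ⟨⟨⟨q', _, _, _⟩, e2⟩, p, e1, rfl, rfl, rfl, e3⟩) ⟨⟨q0, _, _, _⟩, h0⟩
  set q : ℕ → ℕ := fun j => (f j).1.1 with hqdef
  set z : ℕ → Fin d → ℝ := fun j => (f j).1.2.1 with hzdef
  set a : ℕ → Fin d → ℝ := fun j => (f j).1.2.2.1 with hadef
  set l : ℕ → Fin d → ℝ := fun j => (f j).1.2.2.2 with hldef
  have hg : ∀ j, GoodState w τ y r (q j) (z j) (a j) (l j) := fun j => (f j).2
  choose p hlt hz ha hl hst using hf
  have hqm : StrictMono q := strictMono_nat_of_lt_succ hlt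
  have hq00 : q 0 = q0 := by simp only [hqdef, hf0]
  have hq1 : ∀ j, 1 ≤ q j := fun j => (hg j).hq
  have hqr0 : ∀ j, (0 : ℝ) < q j := fun j => by exact_mod_cast hq1 j
  -- the limit point
  have hIcc : ∀ j x, x ∈ Set.Icc (a j) (fun i => a j i + l j i) ↔ InBox (a j) (l j) x := by
    intro j x
    simp only [Set.mem_Icc, Pi.le_def, InBox, forall_and]
  obtain ⟨x, hx⟩ := IsCompact.nonempty_iInter_of_sequence_nonempty_isCompact_isClosed
    (fun j => Set.Icc (a j) (fun i => a j i + l j i))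
    (by
      intro j x hx
      rw [hIcc] at hx ⊢
      exact (hst j x hx).1)
    (by
      intro j
      exact ⟨a j, by rw [hIcc]; exact fun i => ⟨le_rfl, by linarith [(hg j).hl i]⟩⟩)
    isCompact_Icc (fun j => isClosed_Icc)
  have hxb : ∀ j, InBox (a j) (l j) x := fun j => (hIcc j x).1 (Set.mem_iInter.1 hx j)
  have hx0 : ∀ i, 0 ≤ x i ∧ x i ≤ 1 / 2 := by
    intro i
    have h1 := hxb 0 i
    have h2 := (hg 0).ha i
    have h3 := (hg 0).hal i
    constructor <;> linarith
  have hxz : ∀ j i, (1 - ee j) * (q (j + 1) : ℝ) ^ (-1 - τ * w i) ≤ x i - z (j + 1) i ∧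
      x i - z (j + 1) i < (q (j + 1) : ℝ) ^ (-1 - τ * w i) := by
    intro j i
    have h1 := hxb (j + 1) i
    have e1 : a (j + 1) i = z (j + 1) i + (1 - ee j) * (q (j + 1) : ℝ) ^ (-1 - τ * w i) := by
      simp only [hadef, hzdef, ha, hz, nA, hqdef]
    have e2 : l (j + 1) i = (ee j / 2) * (q (j + 1) : ℝ) ^ (-1 - τ * w i) := by
      simp only [hldef, hl, nL, hqdef]
    rw [e1, e2] at h1
    have hpos : 0 < (q (j + 1) : ℝ) ^ (-1 - τ * w i) := by have := hqr0 (j + 1); positivity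
    have := hee0 j
    constructor
    · linarith
    · nlinarith
  have hA : ∀ n : ℕ, 0 < n → (0 : ℝ) < (n : ℝ) ^ (-τ) := fun n hn => by
    have : (0 : ℝ) < n := by exact_mod_cast hn
    positivity
  refine ⟨x, ⟨⟨fun i => ⟨(hx0 i).1, by linarith [(hx0 i).2]⟩, ?_⟩, ?_⟩, ?_⟩
  · apply Set.infinite_of_injective_forall_mem (f := fun j => ((p j, q (j + 1)) : (Fin d → ℤ) × ℕ))
    · intro i j hij
      have := congrArg Prod.snd hij
      simp only at this
      have := hqm.injective this
      omega
    · intro j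
      refine ⟨hq1 (j + 1), ?_⟩
      have hqj := hqr0 (j + 1)
      simp only
      rw [wNorm_lt_iff H.hd w _ H.hw0 (by have := hA _ (hq1 (j + 1)); linarith)]
      intro i
      rw [rpow_mul_w w τ 1 zero_le_one, Real.one_rpow, one_mul]
      have hzi : z (j + 1) i = p j i / q (j + 1) := by simp only [hzdef, hz, hqdef]
      obtain ⟨e1, e2⟩ := hxz j i
      have e3 : (q (j + 1) : ℝ) * x i - p j i = q (j + 1) * (x i - z (j + 1) i) := by
        rw [hzi]; field_simp
      have hpos : 0 < (q (j + 1) : ℝ) ^ (-1 - τ * w i) := by positivity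
      have e4 : 0 ≤ x i - z (j + 1) i := le_trans (mul_nonneg (by linarith [hee1 j]) hpos.le) e1
      rw [e3, abs_of_nonneg (by positivity)]
      calc (q (j + 1) : ℝ) * (x i - z (j + 1) i) < q (j + 1) * (q (j + 1) : ℝ) ^ (-1 - τ * w i) := by gcongr
        _ = _ := by
          rw [show -1 - τ * w i = -(τ * w i) - 1 by ring, Real.rpow_sub_one hqj.ne']; field_simp
  · intro hmem
    simp only [Set.mem_iUnion] at hmem
    obtain ⟨c, ⟨hc0, hc1⟩, hxc⟩ := hmem
    apply hxc.2
    have hlim : ∀ i, ∀ᶠ j : ℕ in atTop, c ^ w i ≤ 1 - ee j := by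
      intro i
      have h1 : Tendsto (fun j : ℕ => 1 - ee j) atTop (𝓝 (1 - 0)) := by
        apply tendsto_const_nhds.sub
        simp only [ee]
        have := (tendsto_const_div_atTop_nhds_zero_nat (1 : ℝ)).comp (tendsto_add_atTop_nat 2)
        refine this.congr fun j => ?_
        simp
      rw [sub_zero] at h1
      exact h1.eventually_const_le (Real.rpow_lt_one hc0.le hc1 (H.hw0 i))
    obtain ⟨j0, hj0⟩ := eventually_atTop.1 (eventually_all.2 hlim)
    have hNear : ∀ pq : (Fin d → ℤ) × ℕ, 0 < pq.2 →
        wNorm w (fun i => (pq.2 : ℝ) * x i - (pq.1 i : ℝ)) < c * (pq.2 : ℝ) ^ (-τ) →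
        ∀ i, |(pq.2 : ℝ) * x i - pq.1 i| < c ^ w i * (pq.2 : ℝ) ^ (-(τ * w i)) := by
      intro pq h1 h2 i
      have hpos := hA _ h1
      rw [wNorm_lt_iff H.hd w _ H.hw0 (by positivity)] at h2
      rw [← rpow_mul_w w τ c hc0.le]
      exact h2 i
    have hNear' : ∀ pq : (Fin d → ℤ) × ℕ, 0 < pq.2 →
        wNorm w (fun i => (pq.2 : ℝ) * x i - (pq.1 i : ℝ)) < c * (pq.2 : ℝ) ^ (-τ) → Near w τ pq.2 x pq.1 := by
      intro pq h1 h2 i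
      have h3 : (0 : ℝ) < pq.2 := by exact_mod_cast h1
      refine (hNear pq h1 h2 i).trans_le ?_
      have h4 : c ^ w i ≤ 1 := Real.rpow_le_one hc0.le hc1.le (H.hw0 i).le
      have h5 : 0 < (pq.2 : ℝ) ^ (-(τ * w i)) := by positivity
      nlinarith
    apply Set.Finite.subset (finite_pairs w H.hw0 τ H.hτ 1 (q (j0 + 1)) le_rfl (fun _ => 0) (fun _ => 1 / 2)
      (fun _ => le_rfl) (fun _ => by norm_num))
    rintro pq ⟨hpos, hlt'⟩
    refine ⟨hpos, ?_, x, fun i => ⟨(hx0 i).1, by linarith [(hx0 i).2]⟩, hNear' pq hpos hlt'⟩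
    by_contra hbig
    obtain ⟨j, hj, hj1, hj2⟩ := exists_interval q hqm (j0 + 1) pq.2 (by omega)
    have hall : ∀ i, (pq.1 i : ℝ) = pq.2 * z j i := by
      by_contra hne
      push Not at hne
      exact (hst j x (hxb (j + 1))).2.1 pq.2 pq.1 hj1 hj2 hne (hNear' pq hpos hlt')
    obtain ⟨j', rfl⟩ : ∃ j', j = j' + 1 := ⟨j - 1, by omega⟩
    let i : Fin d := ⟨0, H.hd⟩
    have e1 := (hxz j' i).1
    have e2 := hNear pq hpos hlt' i
    have e3 := hj0 j' (by omega) i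
    rw [hall i, ← mul_sub] at e2
    have hqj := hqr0 (j' + 1)
    have hn0 : (0 : ℝ) < pq.2 := by exact_mod_cast hpos
    have hqn : (q (j' + 1) : ℝ) ≤ pq.2 := by exact_mod_cast hj1
    have e4 : (pq.2 : ℝ) ^ (-(τ * w i)) ≤ pq.2 * (q (j' + 1) : ℝ) ^ (-1 - τ * w i) := by
      rw [show -1 - τ * w i = -(τ * w i) - 1 by ring, Real.rpow_sub_one hqj.ne']
      have t1 : (pq.2 : ℝ) ^ (-(τ * w i)) ≤ (q (j' + 1) : ℝ) ^ (-(τ * w i)) := by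
        apply Real.rpow_le_rpow_of_nonpos hqj hqn
        have := H.hw0 i
        have := H.hτ
        have : 0 < τ * w i := by positivity
        linarith
      have t2 : 1 ≤ (pq.2 : ℝ) / q (j' + 1) := by rw [le_div_iff₀ hqj]; linarith
      have t3 : 0 < (q (j' + 1) : ℝ) ^ (-(τ * w i)) := by positivity
      calc _ ≤ 1 * (q (j' + 1) : ℝ) ^ (-(τ * w i)) := by linarith
        _ ≤ (pq.2 : ℝ) / q (j' + 1) * (q (j' + 1) : ℝ) ^ (-(τ * w i)) := by gcongr
        _ = _ := by ring
    have e5 : c ^ w i * (pq.2 : ℝ) ^ (-(τ * w i)) ≤ pq.2 * (x i - z (j' + 1) i) := by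
      calc c ^ w i * (pq.2 : ℝ) ^ (-(τ * w i)) ≤ (1 - ee j') * (pq.2 * (q (j' + 1) : ℝ) ^ (-1 - τ * w i)) := by
            apply mul_le_mul e3 e4 (by positivity) (by linarith [hee1 j'])
        _ = pq.2 * ((1 - ee j') * (q (j' + 1) : ℝ) ^ (-1 - τ * w i)) := by ring
        _ ≤ _ := by gcongr
    have := le_abs_self (pq.2 * (x i - z (j' + 1) i))
    linarith
  · intro k hk
    have hex : ∃ m, 1 / (q m : ℝ) ≤ r k := by
      obtain ⟨m, hm⟩ := exists_nat_gt (1 / r k)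
      refine ⟨m, ?_⟩
      have h1 : (m : ℝ) ≤ q m := by exact_mod_cast hqm.id_le m
      rw [div_lt_iff₀ (hr k)] at hm
      rw [div_le_iff₀ (hqr0 m)]
      have := hr k
      nlinarith
    classical
    have h1 := Nat.find_spec hex
    have h0 : Nat.find hex ≠ 0 := by
      intro h
      rw [h, hq00] at h1
      linarith [hrq k]
    obtain ⟨j, hj⟩ := Nat.exists_eq_succ_of_ne_zero h0
    have h2 := Nat.find_min hex (m := j) (by omega)
    rw [hj] at h1
    exact (hst j x (hxb (j + 1))).2.2 k h1 (not_le.1 h2) hk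


lemma lower_ne_zero {d : ℕ} {w : Fin d → ℝ} {τ : ℝ} {u : Fin d → ℝ} {s η : ℝ} (H : Par w τ u s η) :
    Measure.hausdorffMeasure s (wExact w τ) ≠ 0 := by
  classical
  intro hzero
  have hs := H.hs
  obtain ⟨κ0, ρ0, hκ0, hρ0, hmain⟩ := main_lemma H
  rw [Measure.hausdorffMeasure_apply] at hzero
  have h1 := le_of_eq hzero
  rw [iSup_le_iff] at h1
  have h2 := h1 (ENNReal.ofReal (ρ0 / 2))
  rw [iSup_le_iff] at h2
  have h3 := (h2 (ENNReal.ofReal_pos.2 (by linarith))).trans_lt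
    (show (0 : ENNReal) < ENNReal.ofReal (κ0 / 2) from ENNReal.ofReal_pos.2 (by linarith))
  simp only [iInf_lt_iff] at h3
  obtain ⟨t, hcov, hdiam, hsum⟩ := h3
  set D : ℕ → ℝ := fun n => (Metric.ediam (t n)).toReal with hD
  have hfin : ∀ n, Metric.ediam (t n) ≠ ⊤ := fun n => ((hdiam n).trans_lt ENNReal.ofReal_lt_top).ne
  have hD0 : ∀ n, 0 ≤ D n := fun n => ENNReal.toReal_nonneg
  have hDρ : ∀ n, D n ≤ ρ0 / 2 := fun n => ENNReal.toReal_le_of_le_ofReal (by linarith) (hdiam n)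
  have hDsum : ∀ K : Finset ℕ, ∑ n ∈ K, D n ^ s ≤ κ0 / 2 := by
    intro K
    have e1 : ∑ n ∈ K, ENNReal.ofReal (D n ^ s) ≤ ENNReal.ofReal (κ0 / 2) := by
      refine le_trans ?_ hsum.le
      refine le_trans (Finset.sum_le_sum ?_) (ENNReal.sum_le_tsum K)
      intro n _
      rw [← ENNReal.ofReal_rpow_of_nonneg (hD0 n) hs.le, ENNReal.ofReal_toReal (hfin n)]
      rcases Set.eq_empty_or_nonempty (t n) with he | hne
      · rw [he]; simp [hs]
      · simp [hne]
    rw [← ENNReal.ofReal_sum_of_nonneg (fun n _ => Real.rpow_nonneg (hD0 n) _)] at e1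
    exact (ENNReal.ofReal_le_ofReal_iff (by linarith)).1 e1
  set δ : ℕ → ℝ := fun n => min (ρ0 / 2) ((κ0 / 4 * (1 / 2) ^ n) ^ (1 / s)) with hδ
  have hδ0 : ∀ n, 0 < δ n := fun n => by simp only [hδ]; positivity
  have hδs : ∀ n, δ n ^ s ≤ κ0 / 4 * (1 / 2) ^ n := by
    intro n
    calc δ n ^ s ≤ ((κ0 / 4 * (1 / 2) ^ n) ^ (1 / s)) ^ s :=
          Real.rpow_le_rpow (hδ0 n).le (min_le_right _ _) hs.le
      _ = _ := by
          rw [← Real.rpow_mul (by positivity), one_div_mul_cancel hs.ne', Real.rpow_one]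
  have hδsum : ∀ K : Finset ℕ, ∑ n ∈ K, δ n ^ s ≤ κ0 / 2 := by
    intro K
    refine (Finset.sum_le_sum fun n _ => hδs n).trans ?_
    rw [← Finset.mul_sum]
    have : ∑ n ∈ K, ((1 : ℝ) / 2) ^ n ≤ 2 :=
      (summable_geometric_two.sum_le_tsum K (fun n _ => by positivity)).trans_eq
        tsum_geometric_two
    nlinarith
  let y : ℕ → Fin d → ℝ := fun n => if h : (t n).Nonempty then h.some else 0
  obtain ⟨x, hx, hxk⟩ := hmain y (fun n => max (D n) (δ n)) (fun n => lt_max_of_lt_right (hδ0 n))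
    (fun n => max_lt (by linarith [hDρ n]) (by have := min_le_left (ρ0 / 2) ((κ0 / 4 * (1 / 2) ^ n) ^ (1 / s)); simp only [hδ]; linarith))
    (by
      intro K
      calc ∑ n ∈ K, max (D n) (δ n) ^ s ≤ ∑ n ∈ K, (D n ^ s + δ n ^ s) := by
            apply Finset.sum_le_sum
            intro n _
            have a1 := Real.rpow_nonneg (hD0 n) s
            have a2 := Real.rpow_nonneg (hδ0 n).le s
            rcases max_cases (D n) (δ n) with h | h <;> rw [h.1] <;> linarith
        _ ≤ _ := by rw [Finset.sum_add_distrib]; linarith [hDsum K, hδsum K])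
  obtain ⟨n, hn⟩ := Set.mem_iUnion.1 (hcov hx)
  apply hxk n
  intro i
  have hne : (t n).Nonempty := ⟨x, hn⟩
  have hy : y n ∈ t n := by simp only [y, hne, dite_true]; exact hne.some_mem
  have h5 : dist x (y n) ≤ D n := by
    rw [dist_edist]
    exact ENNReal.toReal_mono (hfin n) (Metric.edist_le_ediam_of_mem hn hy)
  have h6 := dist_le_pi_dist x (y n) i
  rw [Real.dist_eq] at h6
  exact h6.trans (h5.trans (le_max_left _ _))

lemma exact_dim (d : ℕ) (hd : 1 ≤ d) (w : Fin d → ℝ)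
    (hw0 : ∀ i, 0 < w i) (hw1 : ∀ i, w i < 1) (hwmono : Monotone w)
    (hwsum : ∑ i, w i = 1) (τ : ℝ) (hτ : 1 < τ) :
    dimH (wExact w τ) =
      ENNReal.ofReal (⨅ k : Fin d,
        ((d : ℝ) + 1 + ∑ i : Fin d, if i ≤ k then τ * w k - τ * w i else 0) /
          (1 + τ * w k)) := by
  have hne : Nonempty (Fin d) := ⟨⟨0, hd⟩⟩
  set F : Fin d → ℝ := fun k => ((d : ℝ) + 1 + ∑ i : Fin d, if i ≤ k then τ * w k - τ * w i else 0) /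
          (1 + τ * w k) with hF
  obtain ⟨k0, hk0⟩ := exists_eq_ciInf_of_finite (f := F)
  have hmin : ∀ k, F k0 ≤ F k := fun k => by rw [hk0]; exact ciInf_le (Set.finite_range F).bddBelow k
  rw [← hk0]
  apply le_antisymm
  · exact (dimH_mono Set.sdiff_subset).trans (upper hd w hw0 hwmono τ hτ k0)
  · have hden : ∀ k, 0 < 1 + τ * w k := fun k => by have := hw0 k; positivity
    have hs0H : ∀ k, F k0 * (1 + τ * w k) ≤ d + 1 + ∑ i, max 0 (τ * w k - τ * w i) := by
      intro k
      rw [← sum_ite_eq_max w hwmono τ hτ k, ← le_div_iff₀ (hden k)]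
      exact hmin k
    have hs0d : F k0 ≤ d := by
      have h1 := hs0H ⟨d - 1, by omega⟩
      set L : Fin d := ⟨d - 1, by omega⟩ with hL
      have h2 : ∀ i, w i ≤ w L := fun i => hwmono (by rw [Fin.le_def, hL]; simp only; omega)
      have h3 : ∑ i, max 0 (τ * w L - τ * w i) = d * (τ * w L) - τ := by
        calc ∑ i, max 0 (τ * w L - τ * w i) = ∑ i, (τ * w L - τ * w i) := by
              apply Finset.sum_congr rfl
              intro i _
              rw [max_eq_right]; nlinarith [h2 i]
          _ = _ := by
              rw [Finset.sum_sub_distrib, Finset.sum_const, ← Finset.mul_sum, hwsum, Finset.card_univ,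
                Fintype.card_fin, nsmul_eq_mul, mul_one]
      rw [h3] at h1
      have h4 := hden L
      by_contra hcon
      have h5 := not_le.1 hcon
      nlinarith
    apply le_of_forall_lt_imp_le_of_dense
    intro b hb
    by_cases hb0 : b = 0
    · rw [hb0]; exact zero_le
    have hbtop : b ≠ ⊤ := (hb.trans ENNReal.ofReal_lt_top).ne
    lift b to NNReal using hbtop
    have hs : 0 < (b : ℝ) := by
      have : b ≠ 0 := by simpa using hb0
      exact_mod_cast pos_iff_ne_zero.2 this
    have hbs : (b : ℝ) < F k0 := by
      rw [← ENNReal.ofReal_coe_nnreal] at hb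
      exact (ENNReal.ofReal_lt_ofReal_iff_of_nonneg b.2).1 hb
    obtain ⟨u, η, hη, hu0, huw, husum, hB⟩ := expB w hw0 hw1 hwsum τ (F k0) b hτ hs hbs hs0d hs0H
    have hu1 : ∀ i, u i < 1 := by
      intro i
      obtain ⟨j, hj⟩ : ∃ j, j ≠ i := by
        by_contra! hall
        have : ∑ j, w j = w i := by
          rw [Finset.sum_eq_single i]
          · intro j _ hj; exact absurd (hall j) hj
          · intro h; exact absurd (Finset.mem_univ i) h
        linarith [hw1 i]
      rw [← husum]
      exact Finset.single_lt_sum hj (Finset.mem_univ i) (Finset.mem_univ j) (hu0 j) (fun k _ _ => (hu0 k).le)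
    apply le_dimH_of_hausdorffMeasure_ne_zero
    exact lower_ne_zero (⟨hd, hw0, hw1, hwsum, hτ, hu0, hu1, husum, huw, hs, by linarith, hη, hB⟩ : Par w τ u b η)

end

theorem dimH_exact (d : ℕ) (hd : 1 ≤ d) (w : Fin d → ℝ)
    (hw0 : ∀ i, 0 < w i) (hw1 : ∀ i, w i < 1) (hwmono : Monotone w)
    (hwsum : ∑ i, w i = 1) (τ : ℝ) (hτ : 1 < τ) :
    dimH (wExact w τ) =
      ENNReal.ofReal (⨅ k : Fin d,
        ((d : ℝ) + 1 + ∑ i : Fin d, if i ≤ k then τ * w k - τ * w i else 0) /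
          (1 + τ * w k)) := by
  exact exact_dim d hd w hw0 hw1 hwmono hwsum τ hτ
end

section
/- For every dimension d ≥ 1, every weight vector w ∈ (0,1)^d, and every τ > 1, the set E_w(τ) of w-weighted τ-exactly-approximable vectors is uncountable. -/
open Real MeasureTheory Set

noncomputable def rad {d : ℕ} (w : Fin d → ℝ) (τ : ℝ) (i : Fin d) (q : ℕ) : ℝ :=
  (q : ℝ) ^ (-1 - τ * w i)

/-- closed box around `p/q` -/
def bx {d : ℕ} (w : Fin d → ℝ) (τ : ℝ) (p : Fin d → ℤ) (q : ℕ) : Set (Fin d → ℝ) :=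
  Icc (fun i => (p i : ℝ) / q - rad w τ i q) (fun i => (p i : ℝ) / q + rad w τ i q)

/-- the one-sided shell -/
def shell {d : ℕ} (w : Fin d → ℝ) (τ : ℝ) (i0 : Fin d) (ε : ℝ) (p : Fin d → ℤ) (q : ℕ) :
    Set (Fin d → ℝ) :=
  Set.pi univ fun i => Ioo ((p i : ℝ) / q + (if i = i0 then (1 - ε) * rad w τ i q else 0))
    ((p i : ℝ) / q + rad w τ i q)

noncomputable def Ps (d q : ℕ) : Finset (Fin d → ℤ) := Fintype.piFinset fun _ => Finset.Icc 0 (q : ℤ)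

def Bad {d : ℕ} (w : Fin d → ℝ) (τ : ℝ) (N : ℕ) : Set (Fin d → ℝ) :=
  ⋃ k : ℕ, ⋃ p ∈ Ps d (k + N), bx w τ p (k + N)

section
variable {d : ℕ} {w : Fin d → ℝ} {τ : ℝ}

lemma rad_pos {i : Fin d} {q : ℕ} (hq : 0 < q) : 0 < rad w τ i q := by
  unfold rad; positivity

lemma rad_anti (hw0 : ∀ i, 0 < w i) (hτ : 1 < τ) {i : Fin d} {q Q : ℕ} (hq : 0 < q) (h : q ≤ Q) :
    rad w τ i Q ≤ rad w τ i q := by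
  unfold rad
  apply Real.rpow_le_rpow_of_nonpos
  · exact_mod_cast hq
  · exact_mod_cast h
  · have := mul_pos (by linarith : 0 < τ) (hw0 i)
    linarith

lemma mul_rad {i : Fin d} {q : ℕ} (hq : 0 < q) : (q : ℝ) * rad w τ i q = (q : ℝ) ^ (-τ * w i) := by
  have hq' : (0 : ℝ) < q := by exact_mod_cast hq
  unfold rad
  nth_rewrite 1 [← Real.rpow_one (q : ℝ)]
  rw [← Real.rpow_add hq']
  congr 1; ring

lemma mul_rad_le (hw0 : ∀ i, 0 < w i) (hτ : 1 < τ) {i : Fin d} {q : ℕ} (hq : 0 < q) :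
    (q : ℝ) * rad w τ i q ≤ 1 := by
  rw [mul_rad hq]
  apply Real.rpow_le_one_of_one_le_of_nonpos
  · exact_mod_cast hq
  · have := mul_pos (by linarith : 0 < τ) (hw0 i)
    linarith

lemma prod_rad (hwsum : ∑ i, w i = 1) {q : ℕ} (hq : 0 < q) :
    ∏ i, rad w τ i q = (q : ℝ) ^ (-(d : ℝ) - τ) := by
  have hq' : (0 : ℝ) < q := by exact_mod_cast hq
  unfold rad
  rw [← Real.rpow_sum_of_pos hq']
  congr 1
  rw [Finset.sum_sub_distrib, ← Finset.mul_sum, hwsum]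
  simp

lemma vol_bx (hwsum : ∑ i, w i = 1) (p : Fin d → ℤ) {q : ℕ} (hq : 0 < q) :
    volume (bx w τ p q) = ENNReal.ofReal (2 ^ d * (q : ℝ) ^ (-(d : ℝ) - τ)) := by
  unfold bx
  rw [Real.volume_Icc_pi, ← ENNReal.ofReal_prod_of_nonneg]
  · congr 1
    rw [← prod_rad hwsum hq]
    have : (2 : ℝ) ^ d = ∏ _i : Fin d, 2 := by simp
    rw [this, ← Finset.prod_mul_distrib]
    apply Finset.prod_congr rfl
    intro i _; ring
  · intro i _
    have := rad_pos (w := w) (τ := τ) (i := i) hq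
    linarith

lemma vol_shell (hwsum : ∑ i, w i = 1) (i0 : Fin d) {ε : ℝ} (hε : 0 < ε) (p : Fin d → ℤ)
    {q : ℕ} (hq : 0 < q) :
    volume (shell w τ i0 ε p q) = ENNReal.ofReal (ε * (q : ℝ) ^ (-(d : ℝ) - τ)) := by
  unfold shell
  rw [Real.volume_pi_Ioo, ← ENNReal.ofReal_prod_of_nonneg]
  · congr 1
    rw [← prod_rad hwsum hq]
    have : ε = ∏ i : Fin d, if i = i0 then ε else 1 := by simp
    nth_rewrite 2 [this]
    rw [← Finset.prod_mul_distrib]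
    apply Finset.prod_congr rfl
    intro i _
    split_ifs <;> ring
  · intro i _
    have := rad_pos (w := w) (τ := τ) (i := i) hq
    split_ifs
    · nlinarith
    · linarith

lemma shell_sub_bx (i0 : Fin d) {ε : ℝ} (hε : 0 < ε) (hε1 : ε ≤ 1 / 2) (p : Fin d → ℤ) {q : ℕ}
    (hq : 0 < q) {x : Fin d → ℝ} (hx : x ∈ shell w τ i0 ε p q) (i : Fin d) :
    |x i - (p i : ℝ) / q| < rad w τ i q := by
  have h := hx i (mem_univ i)
  have := rad_pos (w := w) (τ := τ) (i := i) hq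
  simp only [mem_Ioo] at h
  rw [abs_lt]
  refine ⟨?_, by linarith [h.2]⟩
  have h1 := h.1
  split_ifs at h1
  · nlinarith
  · linarith

lemma mem_bx {p : Fin d → ℤ} {q : ℕ} {x : Fin d → ℝ} :
    x ∈ bx w τ p q ↔ ∀ i, |x i - (p i : ℝ) / q| ≤ rad w τ i q := by
  unfold bx
  rw [mem_Icc, Pi.le_def, Pi.le_def, ← forall_and]
  apply forall_congr'
  intro i
  rw [abs_le]
  constructor <;> rintro ⟨h1, h2⟩ <;> constructor <;> linarith

lemma meet (hw0 : ∀ i, 0 < w i) (hτ : 1 < τ) (i0 : Fin d) {ε : ℝ} (hε : 0 < ε) (hε1 : ε ≤ 1 / 2)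
    {p p' : Fin d → ℤ} {q Q : ℕ}
    (hq : 0 < q) (hQ : 0 < Q) (h : (shell w τ i0 ε p Q ∩ bx w τ p' q).Nonempty) (i : Fin d) :
    |((p i * q - p' i * Q : ℤ) : ℝ)| ≤ 2 * (q * Q) * rad w τ i (min q Q) := by
  obtain ⟨x, hx1, hx2⟩ := h
  have h1 := shell_sub_bx i0 hε hε1 p hQ hx1 i
  have h2 := mem_bx.1 hx2 i
  have hm : 0 < min q Q := lt_min hq hQ
  have h3 := rad_anti (w := w) hw0 hτ (i := i) hm (min_le_left q Q)
  have h4 := rad_anti (w := w) hw0 hτ (i := i) hm (min_le_right q Q)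
  have hq' : (0 : ℝ) < q := by exact_mod_cast hq
  have hQ' : (0 : ℝ) < Q := by exact_mod_cast hQ
  have h5 : |(p i : ℝ) / Q - (p' i : ℝ) / q| ≤ 2 * rad w τ i (min q Q) := by
    rw [abs_le]; rw [abs_lt] at h1; rw [abs_le] at h2
    constructor <;> linarith [h1.1, h1.2, h2.1, h2.2]
  have h6 : ((p i * q - p' i * Q : ℤ) : ℝ) = (q * Q) * ((p i : ℝ) / Q - (p' i : ℝ) / q) := by
    push_cast; field_simp
  rw [h6, abs_mul, abs_of_pos (by positivity : (0 : ℝ) < q * Q)]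
  calc _ ≤ ((q : ℝ) * Q) * (2 * rad w τ i (min q Q)) := by gcongr
    _ = _ := by ring

lemma vol_inter (hwsum : ∑ i, w i = 1) (i0 : Fin d) {ε : ℝ} (hε : 0 < ε) (hε1 : ε ≤ 1 / 2)
    {p p' : Fin d → ℤ} {q Q : ℕ} (hq : 0 < q) (hQ : 0 < Q) :
    volume (shell w τ i0 ε p Q ∩ bx w τ p' q) ≤
      ENNReal.ofReal (2 ^ d * ((max q Q : ℕ) : ℝ) ^ (-(d : ℝ) - τ)) := by
  rcases le_total q Q with h | h
  · rw [max_eq_right h, ← vol_bx hwsum p hQ]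
    apply measure_mono
    intro x hx
    rw [mem_bx]
    intro i
    exact (shell_sub_bx i0 hε hε1 p hQ hx.1 i).le
  · rw [max_eq_left h, ← vol_bx hwsum p' hq]
    exact measure_mono inter_subset_right

open Classical in
/-- number of nearby pairs, coprime case -/
lemma pair_count (F : Finset (Fin d → ℤ)) {q Q : ℕ} (hp : Q.Prime) (hq : 0 < q) (hnd : ¬ Q ∣ q)
    (hF : ∀ p ∈ F, ∀ i, 0 < p i ∧ p i < Q) (L : Fin d → ℝ) (hL : ∀ i, 0 ≤ L i) :
    ((((F ×ˢ Ps d q).filter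
      fun z => ∀ i, |((z.1 i * q - z.2 i * Q : ℤ) : ℝ)| ≤ L i).card : ℕ) : ℝ) ≤
      ∏ i, (2 * L i) := by
  set A := (F ×ˢ Ps d q).filter fun z => ∀ i, |((z.1 i * q - z.2 i * Q : ℤ) : ℝ)| ≤ L i
  let B : Finset (Fin d → ℤ) := Fintype.piFinset fun i => (Finset.Icc (-⌊L i⌋) ⌊L i⌋).erase 0
  have hcop : IsCoprime (q : ℤ) (Q : ℤ) := by
    rw [Nat.isCoprime_iff_coprime]
    exact ((Nat.Prime.coprime_iff_not_dvd hp).2 hnd).symm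
  have hQ0 : (0 : ℤ) < Q := by exact_mod_cast hp.pos
  have hcard : A.card ≤ B.card := by
    apply Finset.card_le_card_of_injOn (fun (z : (Fin d → ℤ) × (Fin d → ℤ)) (i : Fin d) => z.1 i * (q : ℤ) - z.2 i * (Q : ℤ))
    · intro z hz
      simp only [A, Finset.coe_filter, Finset.mem_product, mem_setOf_eq] at hz
      simp only [B, Fintype.coe_piFinset, Set.mem_pi, mem_univ, true_imp_iff]
      intro i
      simp only [Finset.mem_coe, Finset.mem_erase, Finset.mem_Icc]
      have h := hz.2 i
      rw [abs_le] at h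
      refine ⟨?_, ?_, ?_⟩
      · intro h0
        have h1 : (Q : ℤ) ∣ z.1 i * q := ⟨z.2 i, by linarith⟩
        have h2 := hcop.symm.dvd_of_dvd_mul_right h1
        have h3 := hF _ hz.1.1 i
        have := Int.le_of_dvd h3.1 h2
        omega
      · rw [neg_le, Int.le_floor]; push_cast at h ⊢; linarith [h.1]
      · rw [Int.le_floor]; exact h.2
    · intro z hz z' hz' h
      simp only [A, Finset.coe_filter, Finset.mem_product, mem_setOf_eq] at hz hz'
      have key : ∀ i, z.1 i = z'.1 i ∧ z.2 i = z'.2 i := by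
        intro i
        have hi := congrFun h i
        simp only at hi
        have h1 : (Q : ℤ) ∣ (z.1 i - z'.1 i) * q := ⟨z.2 i - z'.2 i, by linarith⟩
        have h2 := hcop.symm.dvd_of_dvd_mul_right h1
        have h3 := hF _ hz.1.1 i
        have h4 := hF _ hz'.1.1 i
        have h5 : z.1 i - z'.1 i = 0 := by
          apply Int.eq_zero_of_abs_lt_dvd h2
          rw [abs_lt]; constructor <;> linarith
        have h6 : z.1 i = z'.1 i := by linarith
        refine ⟨h6, ?_⟩
        rw [h6] at hi
        have : z.2 i * Q = z'.2 i * Q := by linarith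
        exact mul_right_cancel₀ hQ0.ne' this
      exact Prod.ext (funext fun i => (key i).1) (funext fun i => (key i).2)
  calc (A.card : ℝ) ≤ B.card := by exact_mod_cast hcard
    _ = ∏ i, (((Finset.Icc (-⌊L i⌋) ⌊L i⌋).erase 0).card : ℝ) := by
      simp only [B, Fintype.card_piFinset]; push_cast; rfl
    _ ≤ _ := by
      apply Finset.prod_le_prod
      · intros; positivity
      · intro i _
        have h0 : 0 ≤ ⌊L i⌋ := Int.floor_nonneg.2 (hL i)
        rw [Finset.card_erase_of_mem (by simp [h0]), Int.card_Icc]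
        have h1 : (((⌊L i⌋ + 1 - -⌊L i⌋).toNat - 1 : ℕ) : ℤ) = 2 * ⌊L i⌋ := by omega
        have h2 : (((⌊L i⌋ + 1 - -⌊L i⌋).toNat - 1 : ℕ) : ℝ) = 2 * (⌊L i⌋ : ℝ) := by exact_mod_cast h1
        rw [h2]
        have := Int.floor_le (L i)
        linarith

lemma lemA (hw0 : ∀ i, 0 < w i) (hτ : 1 < τ) (hwsum : ∑ i, w i = 1)
    (i0 : Fin d) {ε : ℝ} (hε : 0 < ε) (hε1 : ε ≤ 1 / 2)
    (F : Finset (Fin d → ℤ)) {q Q : ℕ} (hp : Q.Prime) (hq : 0 < q) (hnd : ¬ Q ∣ q)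
    (hF : ∀ p ∈ F, ∀ i, 0 < p i ∧ p i < Q) :
    ∑ p ∈ F, ∑ p' ∈ Ps d q, volume (shell w τ i0 ε p Q ∩ bx w τ p' q) ≤
      ENNReal.ofReal (8 ^ d * (Q : ℝ) ^ (-τ) * (q : ℝ) ^ (-τ)) := by
  classical
  have hQ := hp.pos
  have hm : 0 < min q Q := lt_min hq hQ
  rw [← Finset.sum_product']
  set L : Fin d → ℝ := fun i => 2 * (q * Q) * rad w τ i (min q Q)
  have hL : ∀ i, 0 ≤ L i := fun i => by
    have := rad_pos (w := w) (τ := τ) (i := i) hm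
    positivity
  have hcnt := pair_count F hp hq hnd hF L hL
  set A := (F ×ˢ Ps d q).filter fun z => ∀ i, |((z.1 i * q - z.2 i * Q : ℤ) : ℝ)| ≤ L i
  have hsum : ∑ z ∈ F ×ˢ Ps d q, volume (shell w τ i0 ε z.1 Q ∩ bx w τ z.2 q) =
      ∑ z ∈ A, volume (shell w τ i0 ε z.1 Q ∩ bx w τ z.2 q) := by
    symm
    apply Finset.sum_subset (Finset.filter_subset _ _)
    intro z hz hzA
    by_contra hne
    apply hzA
    rw [Finset.mem_filter]
    refine ⟨hz, fun i => ?_⟩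
    have : (shell w τ i0 ε z.1 Q ∩ bx w τ z.2 q).Nonempty := by
      rw [Set.nonempty_iff_ne_empty]
      intro h; apply hne; rw [h]; simp
    exact meet hw0 hτ i0 hε hε1 hq hQ this i
  rw [hsum]
  calc _ ≤ ∑ z ∈ A, ENNReal.ofReal (2 ^ d * ((max q Q : ℕ) : ℝ) ^ (-(d : ℝ) - τ)) :=
        Finset.sum_le_sum fun z _ => vol_inter hwsum i0 hε hε1 hq hQ
    _ = ENNReal.ofReal (A.card * (2 ^ d * ((max q Q : ℕ) : ℝ) ^ (-(d : ℝ) - τ))) := by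
        rw [Finset.sum_const, nsmul_eq_mul, ENNReal.ofReal_mul (by positivity : (0:ℝ) ≤ A.card),
          ENNReal.ofReal_natCast]
    _ ≤ _ := by
        apply ENNReal.ofReal_le_ofReal
        have e1 : ∏ i, (2 * L i) =
            4 ^ d * (q * Q) ^ d * ((min q Q : ℕ) : ℝ) ^ (-(d : ℝ) - τ) := by
          rw [← prod_rad hwsum hm]
          have : (4 : ℝ) ^ d * (q * Q) ^ d = ∏ _i : Fin d, (4 * ((q : ℝ) * Q)) := by
            simp [mul_pow]
          rw [this, ← Finset.prod_mul_distrib]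
          apply Finset.prod_congr rfl
          intro i _
          simp only [L]; ring
        have hmx : 0 < max q Q := lt_max_of_lt_left hq
        calc _ ≤ (∏ i, (2 * L i)) * (2 ^ d * ((max q Q : ℕ) : ℝ) ^ (-(d : ℝ) - τ)) := by gcongr
          _ = 8 ^ d * ((q * Q) ^ d * (((min q Q : ℕ) : ℝ) ^ (-(d : ℝ) - τ) *
              ((max q Q : ℕ) : ℝ) ^ (-(d : ℝ) - τ))) := by
              rw [e1]
              have : (8 : ℝ) ^ d = 4 ^ d * 2 ^ d := by rw [← mul_pow]; norm_num
              rw [this]; ring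
          _ = _ := by
              have h1 : ((min q Q : ℕ) : ℝ) * ((max q Q : ℕ) : ℝ) = q * Q := by
                exact_mod_cast min_mul_max q Q
              rw [← Real.mul_rpow (by positivity) (by positivity), h1]
              have h2 : (0 : ℝ) < q * Q := by
                have : 0 < q * Q := Nat.mul_pos hq hQ
                exact_mod_cast this
              rw [← Real.rpow_natCast ((q : ℝ) * Q) d, ← Real.rpow_add h2, mul_assoc, mul_comm ((Q : ℝ) ^ (-τ)),
                ← Real.mul_rpow (by positivity) (by positivity)]
              congr 2; ring

lemma lemB (hw0 : ∀ i, 0 < w i) (hτ : 1 < τ) (hwsum : ∑ i, w i = 1)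
    (i0 : Fin d) {ε : ℝ} (hε : 0 < ε) (hε1 : ε ≤ 1 / 2)
    (p : Fin d → ℤ) {j Q : ℕ} (hQ : 0 < Q) (hj : 0 < j) :
    ∑ p' ∈ Ps d (j * Q), volume (shell w τ i0 ε p Q ∩ bx w τ p' (j * Q)) ≤
      ENNReal.ofReal (10 ^ d * (Q : ℝ) ^ (-(d : ℝ) - τ) * (j : ℝ) ^ (-τ)) := by
  classical
  have hq : 0 < j * Q := Nat.mul_pos hj hQ
  have hle : Q ≤ j * Q := Nat.le_mul_of_pos_left Q hj
  set A : Finset (Fin d → ℤ) :=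
    Fintype.piFinset fun i => Finset.Icc (j * p i - 2 * j) (j * p i + 2 * j)
  have hj' : (0 : ℝ) < j := by exact_mod_cast hj
  have hQ' : (0 : ℝ) < Q := by exact_mod_cast hQ
  have hsum : ∑ p' ∈ Ps d (j * Q), volume (shell w τ i0 ε p Q ∩ bx w τ p' (j * Q)) ≤
      ∑ p' ∈ A, volume (shell w τ i0 ε p Q ∩ bx w τ p' (j * Q)) := by
    apply Finset.sum_le_sum_of_ne_zero
    intro p' _ hne
    have hn : (shell w τ i0 ε p Q ∩ bx w τ p' (j * Q)).Nonempty := by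
      rw [Set.nonempty_iff_ne_empty]
      intro h; apply hne; rw [h]; simp
    rw [Fintype.mem_piFinset]
    intro i
    have h := meet hw0 hτ i0 hε hε1 hq hQ hn i
    rw [min_eq_right hle] at h
    have h1 := mul_rad_le (w := w) hw0 hτ (i := i) hQ
    have h2 : |((p i * (j * Q : ℕ) - p' i * Q : ℤ) : ℝ)| ≤ 2 * (j * Q) := by
      refine h.trans ?_
      push_cast
      calc _ = 2 * ((j : ℝ) * Q) * (Q * rad w τ i Q) := by ring
        _ ≤ 2 * ((j : ℝ) * Q) * 1 := by gcongr
        _ = _ := by ring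
    have h3 : |p i * (j * Q : ℕ) - p' i * Q| ≤ 2 * (j * Q) := by exact_mod_cast h2
    rw [abs_le] at h3
    have hQz : (0 : ℤ) < Q := by exact_mod_cast hQ
    push_cast at h3
    rw [Finset.mem_Icc]
    constructor
    · refine le_of_mul_le_mul_right ?_ hQz
      linarith [h3.2]
    · refine le_of_mul_le_mul_right ?_ hQz
      linarith [h3.1]
  have hA : (A.card : ℝ) ≤ (5 * j) ^ d := by
    have : A.card ≤ (5 * j) ^ d := by
      simp only [A, Fintype.card_piFinset, Int.card_Icc]
      calc _ ≤ ∏ _i : Fin d, (5 * j) := by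
            apply Finset.prod_le_prod
            · intros; positivity
            · intro i _; omega
        _ = _ := by simp
    exact_mod_cast this
  refine hsum.trans ?_
  calc _ ≤ ∑ z ∈ A, ENNReal.ofReal (2 ^ d * ((max (j * Q) Q : ℕ) : ℝ) ^ (-(d : ℝ) - τ)) :=
        Finset.sum_le_sum fun z _ => vol_inter hwsum i0 hε hε1 hq hQ
    _ = ENNReal.ofReal (A.card * (2 ^ d * ((max (j * Q) Q : ℕ) : ℝ) ^ (-(d : ℝ) - τ))) := by
        rw [Finset.sum_const, nsmul_eq_mul, ENNReal.ofReal_mul (by positivity : (0:ℝ) ≤ A.card),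
          ENNReal.ofReal_natCast]
    _ ≤ _ := by
        apply ENNReal.ofReal_le_ofReal
        rw [max_eq_left hle]
        calc _ ≤ (5 * (j : ℝ)) ^ d * (2 ^ d * ((j * Q : ℕ) : ℝ) ^ (-(d : ℝ) - τ)) := by gcongr
          _ = 10 ^ d * (Q : ℝ) ^ (-(d : ℝ) - τ) * ((j : ℝ) ^ d * (j : ℝ) ^ (-(d : ℝ) - τ)) := by
              push_cast
              rw [Real.mul_rpow hj'.le hQ'.le]
              have : (10 : ℝ) ^ d = 5 ^ d * 2 ^ d := by rw [← mul_pow]; norm_num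
              rw [this, mul_pow]; ring
          _ = _ := by
              rw [← Real.rpow_natCast (j : ℝ) d, ← Real.rpow_add hj']
              congr 2; ring

lemma lemC (hw0 : ∀ i, 0 < w i) (hτ : 1 < τ)
    (i0 : Fin d) {ε : ℝ} (hε : 0 < ε) (hε1 : ε ≤ 1 / 2)
    {p p' : Fin d → ℤ} {j Q M : ℕ} (hQ : 0 < Q) (hj : 0 < j) (hjM : j < M)
    (hbig : ∀ i, 2 * (M : ℝ) < (Q : ℝ) ^ (τ * w i)) (hne : ¬ (p' = p ∧ j = 1)) :
    shell w τ i0 ε p Q ∩ bx w τ p' (j * Q) = ∅ := by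
  by_contra hcon
  have hn := Set.nonempty_iff_ne_empty.2 hcon
  have hq : 0 < j * Q := Nat.mul_pos hj hQ
  have hle : Q ≤ j * Q := Nat.le_mul_of_pos_left Q hj
  have hj' : (0 : ℝ) < j := by exact_mod_cast hj
  have hQ' : (0 : ℝ) < Q := by exact_mod_cast hQ
  have key : ∀ i, p' i = j * p i := by
    intro i
    have h := meet hw0 hτ i0 hε hε1 hq hQ hn i
    rw [min_eq_right hle] at h
    have h1 : (Q : ℝ) * rad w τ i Q * (2 * M) < 1 := by
      rw [mul_rad hQ]
      calc _ < (Q : ℝ) ^ (-τ * w i) * (Q : ℝ) ^ (τ * w i) := by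
            have := hbig i
            have : (0 : ℝ) < (Q : ℝ) ^ (-τ * w i) := by positivity
            gcongr
        _ = 1 := by rw [← Real.rpow_add hQ']; simp
    have h2 : |((p i * (j * Q : ℕ) - p' i * Q : ℤ) : ℝ)| < Q := by
      refine h.trans_lt ?_
      have hjM' : (j : ℝ) ≤ M := by exact_mod_cast hjM.le
      have := rad_pos (w := w) (τ := τ) (i := i) hQ
      push_cast
      calc _ = (Q : ℝ) * rad w τ i Q * (2 * j) * Q := by ring
        _ ≤ (Q : ℝ) * rad w τ i Q * (2 * M) * Q := by gcongr
        _ < 1 * Q := by gcongr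
        _ = _ := by ring
    have h3 : |p i * (j * Q : ℕ) - p' i * Q| < Q := by exact_mod_cast h2
    have h4 : p i * (j * Q : ℕ) - p' i * Q = 0 := by
      apply Int.eq_zero_of_abs_lt_dvd _ h3
      exact ⟨p i * j - p' i, by push_cast; ring⟩
    have hQz : (0 : ℤ) < Q := by exact_mod_cast hQ
    apply mul_right_cancel₀ hQz.ne'
    push_cast at h4
    linarith
  have hj1 : j ≠ 1 := by
    intro h
    apply hne
    refine ⟨funext fun i => ?_, h⟩
    rw [key i, h]; simp
  have hj2 : 2 ≤ j := by omega
  obtain ⟨x, hx1, hx2⟩ := hn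
  have h1 := (hx1 i0 (mem_univ _)).1
  simp only [if_true] at h1
  have h2 := mem_bx.1 hx2 i0
  rw [key i0] at h2
  have h3 : (((j * p i0 : ℤ) : ℝ)) / ((j * Q : ℕ) : ℝ) = p i0 / Q := by
    push_cast; field_simp
  rw [h3] at h2
  have h4 := (abs_le.1 h2).2
  have h5 := mul_pos (by linarith : 0 < τ) (hw0 i0)
  have h6 : rad w τ i0 (j * Q) ≤ rad w τ i0 Q / 2 := by
    unfold rad
    push_cast
    rw [Real.mul_rpow hj'.le hQ'.le]
    have : (j : ℝ) ^ (-1 - τ * w i0) ≤ 1 / 2 := by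
      have hj2' : (2 : ℝ) ≤ j := by exact_mod_cast hj2
      calc (j : ℝ) ^ (-1 - τ * w i0) ≤ (j : ℝ) ^ (-1 : ℝ) :=
            Real.rpow_le_rpow_of_exponent_le (by linarith) (by linarith)
        _ = 1 / j := by rw [Real.rpow_neg_one]; simp
        _ ≤ 1 / 2 := by gcongr
    have h7 : (0 : ℝ) < (Q : ℝ) ^ (-1 - τ * w i0) := by positivity
    nlinarith
  have h8 := rad_pos (w := w) (τ := τ) (i := i0) hQ
  nlinarith
end

section
open Filter Topology
open scoped ENNReal
variable {d : ℕ} {w : Fin d → ℝ} {τ : ℝ}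

noncomputable def tl (τ : ℝ) (M : ℕ) : ℝ≥0∞ := ∑' k : ℕ, ENNReal.ofReal (((k + M : ℕ) : ℝ) ^ (-τ))

lemma tl_tendsto (hτ : 1 < τ) : Tendsto (tl τ) atTop (𝓝 0) := by
  have h : Summable fun n : ℕ => ((n : ℝ)) ^ (-τ) := Real.summable_nat_rpow.2 (by linarith)
  exact ENNReal.tendsto_sum_nat_add (fun n : ℕ => ENNReal.ofReal ((n : ℝ) ^ (-τ)))
    h.tsum_ofReal_ne_top

lemma vol_Bad (hwsum : ∑ i, w i = 1) {N : ℕ} (hN : 0 < N) :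
    volume (Bad w τ N) ≤ ENNReal.ofReal (4 ^ d) * tl τ N := by
  unfold Bad tl
  rw [← ENNReal.tsum_mul_left]
  refine (measure_iUnion_le _).trans (ENNReal.tsum_le_tsum fun k => ?_)
  refine (measure_biUnion_finset_le _ _).trans ?_
  have hq : 0 < k + N := by omega
  have hq' : (0 : ℝ) < ((k + N : ℕ) : ℝ) := by exact_mod_cast hq
  rw [Finset.sum_congr rfl fun p _ => vol_bx hwsum p hq, Finset.sum_const, nsmul_eq_mul,
    ← ENNReal.ofReal_natCast, ← ENNReal.ofReal_mul (by positivity),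
    ← ENNReal.ofReal_mul (by positivity)]
  apply ENNReal.ofReal_le_ofReal
  have hc : ((Ps d (k + N)).card : ℝ) ≤ (2 * ((k + N : ℕ) : ℝ)) ^ d := by
    have : (Ps d (k + N)).card ≤ (2 * (k + N)) ^ d := by
      simp only [Ps, Fintype.card_piFinset, Int.card_Icc]
      rw [Finset.prod_const, Finset.card_univ, Fintype.card_fin]
      apply Nat.pow_le_pow_left
      omega
    exact_mod_cast this
  calc _ ≤ (2 * ((k + N : ℕ) : ℝ)) ^ d * (2 ^ d * ((k + N : ℕ) : ℝ) ^ (-(d : ℝ) - τ)) := by gcongr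
    _ = 4 ^ d * (((k + N : ℕ) : ℝ) ^ d * ((k + N : ℕ) : ℝ) ^ (-(d : ℝ) - τ)) := by
      have : (4 : ℝ) ^ d = 2 ^ d * 2 ^ d := by rw [← mul_pow]; norm_num
      rw [this, mul_pow]; ring
    _ = _ := by
      rw [← Real.rpow_natCast (((k + N : ℕ) : ℝ)) d, ← Real.rpow_add hq']
      congr 2; ring

def cube (d : ℕ) : Set (Fin d → ℝ) := Set.pi univ fun _ => Ioo 0 1

lemma cells {U : Set (Fin d → ℝ)} (hU : IsOpen U) (hUc : U ⊆ cube d) {c : ℝ} (hc : 0 < c)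
    (hcU : ENNReal.ofReal c < volume U) :
    ∃ δ > 0, ∃ Q0 : ℕ, ∀ Q ≥ Q0, 0 < Q → ∃ F : Finset (Fin d → ℤ),
      (∀ p ∈ F, Metric.closedBall (fun i => (p i : ℝ) / Q) δ ⊆ U) ∧
      c * (Q : ℝ) ^ d ≤ F.card := by
  classical
  let Un : ℕ → Set (Fin d → ℝ) := fun n => {y | Metric.closedBall y (1 / ((n : ℝ) + 1)) ⊆ U}
  have hmono : Monotone Un := by
    intro m n hmn y hy
    refine Subset.trans (Metric.closedBall_subset_closedBall ?_) hy
    have : (m : ℝ) ≤ n := by exact_mod_cast hmn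
    gcongr
  have hun : ⋃ n, Un n = U := by
    ext y
    rw [mem_iUnion]
    constructor
    · rintro ⟨n, hn⟩
      exact hn (Metric.mem_closedBall_self (by positivity))
    · intro hy
      obtain ⟨e, he, hs⟩ := Metric.isOpen_iff.1 hU y hy
      obtain ⟨n, hn⟩ := exists_nat_one_div_lt he
      exact ⟨n, (Metric.closedBall_subset_ball hn).trans hs⟩
  have ht := tendsto_measure_iUnion_atTop (μ := volume) hmono
  rw [hun] at ht
  obtain ⟨n, hn⟩ := (ht.eventually (lt_mem_nhds hcU)).exists
  have hδ : (0 : ℝ) < 1 / (2 * ((n : ℝ) + 1)) := by positivity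
  refine ⟨1 / (2 * ((n : ℝ) + 1)), hδ, 2 * (n + 1), fun Q hQ hQ0 => ?_⟩
  set δ := 1 / (2 * ((n : ℝ) + 1)) with hδd
  have hQ' : (0 : ℝ) < Q := by exact_mod_cast hQ0
  have hQδ : 1 / (Q : ℝ) ≤ δ := by
    have : (2 * ((n : ℝ) + 1)) ≤ Q := by exact_mod_cast hQ
    rw [hδd]; gcongr
  have h2δ : δ + δ = 1 / ((n : ℝ) + 1) := by rw [hδd]; field_simp; norm_num
  refine ⟨(Ps d Q).filter fun p => Metric.closedBall (fun i => (p i : ℝ) / Q) δ ⊆ U,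
    fun p hp => (Finset.mem_filter.1 hp).2, ?_⟩
  set F := (Ps d Q).filter fun p => Metric.closedBall (fun i => (p i : ℝ) / Q) δ ⊆ U
  have hcov : Un n ⊆ ⋃ p ∈ F, Icc (fun i => (p i : ℝ) / Q) (fun i => (p i : ℝ) / Q + 1 / Q) := by
    intro y hy
    have hyU : y ∈ U := hy (Metric.mem_closedBall_self (by positivity))
    have hyc := hUc hyU
    have hl : ∀ i, (⌊Q * y i⌋ : ℝ) / Q ≤ y i := fun i => by
      rw [div_le_iff₀ hQ', mul_comm]; exact Int.floor_le _
    have hr : ∀ i, y i ≤ (⌊Q * y i⌋ : ℝ) / Q + 1 / Q := fun i => by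
      rw [← add_div, le_div_iff₀ hQ', mul_comm]; exact (Int.lt_floor_add_one _).le
    simp only [mem_iUnion]
    refine ⟨fun i => ⌊Q * y i⌋, ?_, hl, hr⟩
    rw [Finset.mem_filter]
    constructor
    · rw [Ps, Fintype.mem_piFinset]
      intro i
      have := hyc i (mem_univ i)
      rw [Finset.mem_Icc]
      constructor
      · apply Int.floor_nonneg.2
        have := this.1
        positivity
      · have h1 : (⌊Q * y i⌋ : ℝ) ≤ Q :=
          (Int.floor_le _).trans (by nlinarith [this.2])
        exact_mod_cast h1
    · refine Subset.trans ?_ hy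
      apply Metric.closedBall_subset_closedBall'
      rw [← h2δ]
      gcongr
      rw [dist_pi_le_iff hδ.le]
      intro i
      rw [Real.dist_eq, abs_le]
      constructor <;> linarith [hl i, hr i]
  have h1 := (measure_mono (μ := volume) hcov).trans (measure_biUnion_finset_le _ _)
  have h2 : ∀ p : Fin d → ℤ,
      volume (Icc (fun i => (p i : ℝ) / Q) (fun i => (p i : ℝ) / Q + 1 / Q)) =
      ENNReal.ofReal ((1 / Q) ^ d) := by
    intro p
    rw [Real.volume_Icc_pi]
    simp
    rw [← ENNReal.ofReal_pow (by positivity)]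
    simp
  rw [Finset.sum_congr rfl fun p _ => h2 p, Finset.sum_const, nsmul_eq_mul,
    ← ENNReal.ofReal_natCast, ← ENNReal.ofReal_mul (by positivity)] at h1
  have h3 := (ENNReal.ofReal_le_ofReal_iff (by positivity)).1 (hn.le.trans h1)
  rw [div_pow, one_pow, mul_one_div, le_div_iff₀ (by positivity)] at h3
  exact h3

lemma select (hw0 : ∀ i, 0 < w i) (hτ : 1 < τ) (hwsum : ∑ i, w i = 1)
    (i0 : Fin d) {ε : ℝ} (hε : 0 < ε) (hε1 : ε ≤ 1 / 2)
    {U : Set (Fin d → ℝ)} (hU : IsOpen U) (hUc : U ⊆ cube d) {c : ℝ} (hc : 0 < c)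
    (hcU : ENNReal.ofReal c < volume U) {M : ℕ} (hM : 0 < M) (hfin : tl τ M ≠ ⊤)
    (ht : 2 * 10 ^ d * (tl τ M).toReal < ε * c) :
    ∃ (Q : ℕ) (p : Fin d → ℤ), M ≤ Q ∧ closure (shell w τ i0 ε p Q) ⊆ U ∧
      volume (shell w τ i0 ε p Q \
        ⋃ k : ℕ, ⋃ p' ∈ Ps d (k + M), ⋃ (_ : ¬ (p' = p ∧ k + M = Q)), bx w τ p' (k + M)) ≠ 0 := by
  classical
  obtain ⟨δ, hδ, Q0, hcell⟩ := cells hU hUc hc hcU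
  have hev : ∀ᶠ Q : ℕ in atTop, (∀ i, 2 * (M : ℝ) < (Q : ℝ) ^ (τ * w i)) ∧ Q0 ≤ Q ∧ M ≤ Q ∧
      1 / δ ≤ (Q : ℝ) := by
    refine Filter.Eventually.and (Filter.eventually_all.2 fun i => ?_)
      ((eventually_ge_atTop Q0).and ((eventually_ge_atTop M).and ?_))
    · have h := (tendsto_rpow_atTop (mul_pos (by linarith : 0 < τ) (hw0 i))).comp
        (tendsto_natCast_atTop_atTop (R := ℝ))
      exact h.eventually (eventually_gt_atTop _)
    · exact tendsto_natCast_atTop_atTop.eventually (eventually_ge_atTop _)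
  obtain ⟨Q1, hQ1⟩ := eventually_atTop.1 hev
  obtain ⟨Q, hQQ1, hp⟩ := Nat.exists_infinite_primes Q1
  obtain ⟨hbig, hQ0, hMQ, hQδ⟩ := hQ1 Q hQQ1
  have hQ := hp.pos
  have hQ' : (0 : ℝ) < Q := by exact_mod_cast hQ
  obtain ⟨F, hFU, hFc⟩ := hcell Q hQ0 hQ
  have hF : ∀ p ∈ F, ∀ i, 0 < p i ∧ p i < Q := by
    intro p hpF i
    have h1 := hUc (hFU p hpF (Metric.mem_closedBall_self hδ.le)) i (mem_univ i)
    have h2 : 0 < (p i : ℝ) := by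
      have := h1.1
      rwa [lt_div_iff₀ hQ', zero_mul] at this
    have h3 : (p i : ℝ) < Q := by
      have := h1.2
      rwa [div_lt_iff₀ hQ', one_mul] at this
    exact ⟨by exact_mod_cast h2, by exact_mod_cast h3⟩
  have hFcard : (F.card : ℝ) ≤ (Q : ℝ) ^ d := by
    have : F.card ≤ Q ^ d := by
      calc F.card ≤ (Fintype.piFinset fun _ : Fin d => Finset.Ico (0 : ℤ) Q).card := by
            apply Finset.card_le_card
            intro p hpF
            rw [Fintype.mem_piFinset]
            intro i
            rw [Finset.mem_Ico]
            exact ⟨(hF p hpF i).1.le, (hF p hpF i).2⟩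
        _ = Q ^ d := by simp [Fintype.card_piFinset]
    exact_mod_cast this
  have hclos : ∀ p ∈ F, closure (shell w τ i0 ε p Q) ⊆ U := by
    intro p hpF
    refine Subset.trans ?_ (hFU p hpF)
    apply closure_minimal _ Metric.isClosed_closedBall
    intro x hx
    rw [Metric.mem_closedBall, dist_pi_le_iff hδ.le]
    intro i
    have h1 := shell_sub_bx i0 hε hε1 p hQ hx i
    have h2 := mul_rad_le (w := w) hw0 hτ (i := i) hQ
    rw [Real.dist_eq]
    refine h1.le.trans ?_
    rw [div_le_iff₀ hδ] at hQδ
    have h3 : (Q : ℝ) * rad w τ i Q ≤ Q * δ := by linarith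
    exact le_of_mul_le_mul_left h3 hQ'
  by_contra hcon
  have hzero : ∀ p ∈ F, volume (shell w τ i0 ε p Q) ≤
      (∑' k : ℕ, if Q ∣ (k + M) then 0 else
        ∑ p' ∈ Ps d (k + M), volume (shell w τ i0 ε p Q ∩ bx w τ p' (k + M))) +
      ∑' k : ℕ, ∑ p' ∈ Ps d ((k + M) * Q),
        volume (shell w τ i0 ε p Q ∩ bx w τ p' ((k + M) * Q)) := by
    intro p hpF
    have h0 : volume (shell w τ i0 ε p Q \
        ⋃ k : ℕ, ⋃ p' ∈ Ps d (k + M), ⋃ (_ : ¬ (p' = p ∧ k + M = Q)), bx w τ p' (k + M)) = 0 := by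
      by_contra h
      exact hcon ⟨Q, p, hMQ, hclos p hpF, h⟩
    set A1 : Set (Fin d → ℝ) := ⋃ k : ℕ, if Q ∣ (k + M) then ∅ else
      ⋃ p' ∈ Ps d (k + M), shell w τ i0 ε p Q ∩ bx w τ p' (k + M) with hA1
    set A2 : Set (Fin d → ℝ) := ⋃ k : ℕ, ⋃ p' ∈ Ps d ((k + M) * Q),
      shell w τ i0 ε p Q ∩ bx w τ p' ((k + M) * Q) with hA2
    have hsub : shell w τ i0 ε p Q ⊆ (shell w τ i0 ε p Q \
        ⋃ k : ℕ, ⋃ p' ∈ Ps d (k + M), ⋃ (_ : ¬ (p' = p ∧ k + M = Q)), bx w τ p' (k + M)) ∪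
        (A1 ∪ A2) := by
      intro x hx
      by_cases hxB : x ∈ ⋃ k : ℕ, ⋃ p' ∈ Ps d (k + M), ⋃ (_ : ¬ (p' = p ∧ k + M = Q)),
        bx w τ p' (k + M)
      swap
      · exact Or.inl ⟨hx, hxB⟩
      right
      simp only [mem_iUnion] at hxB
      obtain ⟨k, p', hp', hne, hxb⟩ := hxB
      by_cases hdv : Q ∣ k + M
      · right
        obtain ⟨j, hj⟩ := hdv
        rw [mul_comm] at hj
        have hj0 : 0 < j := by
          rcases Nat.eq_zero_or_pos j with h | h
          · subst h; omega
          · exact h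
        rw [hj] at hp' hxb hne
        by_cases hjM : j < M
        · exfalso
          have hne' : ¬ (p' = p ∧ j = 1) := by
            rintro ⟨h1, h2⟩
            exact hne ⟨h1, by rw [h2, one_mul]⟩
          have := lemC (τ := τ) hw0 hτ i0 hε hε1 hQ hj0 hjM hbig hne'
          have hmem : x ∈ shell w τ i0 ε p Q ∩ bx w τ p' (j * Q) := ⟨hx, hxb⟩
          rw [this] at hmem
          exact hmem
        · rw [hA2]
          simp only [mem_iUnion]
          have e : j - M + M = j := by omega
          refine ⟨j - M, p', ?_, ?_⟩
          · rw [e]; exact hp'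
          · rw [e]; exact ⟨hx, hxb⟩
      · left
        rw [hA1, mem_iUnion]
        refine ⟨k, ?_⟩
        rw [if_neg hdv]
        simp only [mem_iUnion]
        exact ⟨p', hp', hx, hxb⟩
    calc volume (shell w τ i0 ε p Q) ≤ 0 + (volume A1 + volume A2) := by
          rw [← h0]
          refine (measure_mono hsub).trans ((measure_union_le _ _).trans ?_)
          gcongr
          exact measure_union_le _ _
      _ ≤ _ := by
          rw [zero_add]
          gcongr
          · refine (measure_iUnion_le _).trans (ENNReal.tsum_le_tsum fun k => ?_)
            split_ifs
            · simp
            · exact measure_biUnion_finset_le _ _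
          · refine (measure_iUnion_le _).trans (ENNReal.tsum_le_tsum fun k => ?_)
            exact measure_biUnion_finset_le _ _
  have hX : (0 : ℝ) < (Q : ℝ) ^ (-(d : ℝ) - τ) := by positivity
  set X := (Q : ℝ) ^ (-(d : ℝ) - τ) with hXd
  set t := (tl τ M).toReal with htd
  have htt : tl τ M = ENNReal.ofReal t := (ENNReal.ofReal_toReal hfin).symm
  have ht0 : 0 ≤ t := ENNReal.toReal_nonneg
  clear_value t X
  have hsum := Finset.sum_le_sum hzero
  rw [Finset.sum_congr rfl fun p _ => vol_shell hwsum i0 hε p hQ, Finset.sum_const, nsmul_eq_mul,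
    Finset.sum_add_distrib] at hsum
  have hS1 : ∑ p ∈ F, (∑' k : ℕ, if Q ∣ (k + M) then 0 else
        ∑ p' ∈ Ps d (k + M), volume (shell w τ i0 ε p Q ∩ bx w τ p' (k + M))) ≤
      ENNReal.ofReal (8 ^ d * (Q : ℝ) ^ (-τ) * t) := by
    rw [← Summable.tsum_finsetSum (fun _ _ => ENNReal.summable),
      ENNReal.ofReal_mul (by positivity), ← htt, tl, ← ENNReal.tsum_mul_left]
    refine ENNReal.tsum_le_tsum fun k => ?_
    split_ifs with h
    · simp
    · rw [← ENNReal.ofReal_mul (by positivity)]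
      exact lemA hw0 hτ hwsum i0 hε hε1 F hp (by omega) h hF
  have hS2 : ∑ p ∈ F, (∑' k : ℕ, ∑ p' ∈ Ps d ((k + M) * Q),
        volume (shell w τ i0 ε p Q ∩ bx w τ p' ((k + M) * Q))) ≤
      ENNReal.ofReal (F.card * (10 ^ d * X * t)) := by
    rw [ENNReal.ofReal_mul (Nat.cast_nonneg _), ENNReal.ofReal_natCast, ← nsmul_eq_mul]
    apply Finset.sum_le_card_nsmul
    intro p _
    rw [ENNReal.ofReal_mul (by positivity), ← htt, tl, ← ENNReal.tsum_mul_left]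
    refine ENNReal.tsum_le_tsum fun k => ?_
    rw [← ENNReal.ofReal_mul (by positivity)]
    rw [hXd]
    exact lemB hw0 hτ hwsum i0 hε hε1 p hQ (j := k + M) (by omega)
  have hfinal := hsum.trans (add_le_add hS1 hS2)
  have hb1 : 0 ≤ 8 ^ d * (Q : ℝ) ^ (-τ) * t := by positivity
  have hb2 : 0 ≤ (F.card : ℝ) * (10 ^ d * X * t) :=
    mul_nonneg (Nat.cast_nonneg _) (by positivity)
  rw [← hXd, ← ENNReal.ofReal_natCast, ← ENNReal.ofReal_mul (Nat.cast_nonneg _),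
    ← ENNReal.ofReal_add hb1 hb2,
    ENNReal.ofReal_le_ofReal_iff (add_nonneg hb1 hb2)] at hfinal
  have hQX : (Q : ℝ) ^ (-τ) = (Q : ℝ) ^ d * X := by
    rw [hXd, ← Real.rpow_natCast (Q : ℝ) d, ← Real.rpow_add hQ']
    congr 1; ring
  rw [hQX] at hfinal
  have hY : (0 : ℝ) < (Q : ℝ) ^ d := by positivity
  set Y := (Q : ℝ) ^ d
  have h810 : (8 : ℝ) ^ d ≤ 10 ^ d := by gcongr; norm_num
  have hA : ε * c * (Y * X) ≤ 2 * 10 ^ d * t * (Y * X) := by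
    calc ε * c * (Y * X) = (c * Y) * (ε * X) := by ring
      _ ≤ F.card * (ε * X) := by gcongr
      _ ≤ _ := hfinal
      _ ≤ 10 ^ d * (Y * X) * t + Y * (10 ^ d * X * t) := by gcongr
      _ = _ := by ring
  have := le_of_mul_le_mul_right hA (by positivity)
  linarith

lemma isClosed_bx (p : Fin d → ℤ) (q : ℕ) : IsClosed (bx w τ p q) := isClosed_Icc

lemma isOpen_shell (i0 : Fin d) (ε : ℝ) (p : Fin d → ℤ) (q : ℕ) :
    IsOpen (shell w τ i0 ε p q) :=
  isOpen_set_pi finite_univ fun _ _ => isOpen_Ioo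

lemma step (hw0 : ∀ i, 0 < w i) (hτ : 1 < τ) (hwsum : ∑ i, w i = 1)
    (i0 : Fin d) {ε : ℝ} (hε : 0 < ε) (hε1 : ε ≤ 1 / 2) (y : Fin d → ℝ)
    {V : Set (Fin d → ℝ)} (hV : IsOpen V) (hVc : V ⊆ cube d) {N : ℕ} (hN : 0 < N)
    (hvol : volume (V \ Bad w τ N) ≠ 0) :
    ∃ (V' : Set (Fin d → ℝ)) (N' : ℕ), (IsOpen V' ∧ V' ⊆ cube d ∧ 0 < N' ∧
      volume (V' \ Bad w τ N') ≠ 0) ∧ N < N' ∧ closure V' ⊆ V ∧ y ∉ V' ∧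
      ∃ (Q : ℕ) (p : Fin d → ℤ), N ≤ Q ∧ Q < N' ∧ V' ⊆ shell w τ i0 ε p Q ∧
      ∀ x ∈ V', ∀ q, N ≤ q → q < N' → ∀ p' ∈ Ps d q, x ∈ bx w τ p' q → p' = p ∧ q = Q := by
  have hcube : volume (cube d) = 1 := by
    unfold cube; rw [Real.volume_pi_Ioo]; simp
  have hvfin : volume (V \ Bad w τ N) ≠ ⊤ := by
    have : volume (V \ Bad w τ N) ≤ 1 := hcube ▸ measure_mono (sdiff_subset.trans hVc)
    exact ne_top_of_le_ne_top ENNReal.one_ne_top this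
  set g := (volume (V \ Bad w τ N)).toReal with hg
  have hgpos : 0 < g := ENNReal.toReal_pos hvol hvfin
  have hgv : volume (V \ Bad w τ N) = ENNReal.ofReal g := (ENNReal.ofReal_toReal hvfin).symm
  have hη : 0 < ε * (g / 2) / (2 * 10 ^ d) := by positivity
  obtain ⟨M, hMt, hMN⟩ := (((tl_tendsto hτ).eventually (gt_mem_nhds (ENNReal.ofReal_pos.2 hη))).and
    (eventually_ge_atTop N)).exists
  have hfin : tl τ M ≠ ⊤ := hMt.ne_top
  have ht : 2 * 10 ^ d * (tl τ M).toReal < ε * (g / 2) := by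
    have := (ENNReal.lt_ofReal_iff_toReal_lt hfin).1 hMt
    rw [lt_div_iff₀ (by positivity)] at this
    linarith
  set C : Set (Fin d → ℝ) := ⋃ q ∈ Finset.Ico N M, ⋃ p ∈ Ps d q, bx w τ p q with hC
  have hCcl : IsClosed C := isClosed_biUnion_finset fun q _ =>
    isClosed_biUnion_finset fun p _ => isClosed_bx p q
  have hCB : C ⊆ Bad w τ N := by
    intro x hx
    simp only [hC, mem_iUnion, Finset.mem_Ico] at hx
    obtain ⟨q, hq, p, hp, hxb⟩ := hx
    simp only [Bad, mem_iUnion]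
    have e : q - N + N = q := by omega
    refine ⟨q - N, p, ?_, ?_⟩ <;> rwa [e]
  have hUo : IsOpen (V \ C) := hV.sdiff hCcl
  have hcU : ENNReal.ofReal (g / 2) < volume (V \ C) := by
    calc ENNReal.ofReal (g / 2) < ENNReal.ofReal g :=
          (ENNReal.ofReal_lt_ofReal_iff hgpos).2 (by linarith)
      _ = _ := hgv.symm
      _ ≤ _ := measure_mono (sdiff_subset_sdiff_right hCB)
  obtain ⟨Q, p, hMQ, hcl, hv⟩ := select hw0 hτ hwsum i0 hε hε1 hUo (sdiff_subset.trans hVc)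
    (by positivity : 0 < g / 2) hcU (by omega) hfin ht
  classical
  set D : Set (Fin d → ℝ) := ⋃ q ∈ Finset.Icc M Q,
    ⋃ p' ∈ (Ps d q).filter (fun p' => ¬ (p' = p ∧ q = Q)), bx w τ p' q with hD
  have hDcl : IsClosed D := isClosed_biUnion_finset fun q _ =>
    isClosed_biUnion_finset fun p _ => isClosed_bx p q
  have hV'U : (shell w τ i0 ε p Q \ D) \ {y} ⊆ V \ C :=
    (sdiff_subset.trans sdiff_subset).trans (subset_closure.trans hcl)
  refine ⟨(shell w τ i0 ε p Q \ D) \ {y}, Q + 1, ⟨?_, ?_, by omega, ?_⟩, by omega, ?_, ?_, Q, p,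
    by omega, by omega, sdiff_subset.trans sdiff_subset, ?_⟩
  · exact ((isOpen_shell i0 ε p Q).sdiff hDcl).sdiff isClosed_singleton
  · exact hV'U.trans (sdiff_subset.trans hVc)
  · intro h0
    apply hv
    have hd : 0 < d := i0.pos
    have : Nonempty (Fin d) := ⟨i0⟩
    have hy : volume ({y} : Set (Fin d → ℝ)) = 0 := measure_singleton y
    refine measure_mono_null (t := ((shell w τ i0 ε p Q \ D) \ {y}) \ Bad w τ (Q + 1) ∪ {y}) ?_
      (measure_union_null h0 hy)
    rintro x ⟨hx, hxn⟩
    by_cases hxy : x = y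
    · right; exact hxy
    left
    simp only [mem_iUnion, not_exists] at hxn
    refine ⟨⟨⟨hx, ?_⟩, hxy⟩, ?_⟩
    · intro hxD
      simp only [hD, mem_iUnion, Finset.mem_Icc, Finset.mem_filter] at hxD
      obtain ⟨q, hq, p', ⟨hp', hne⟩, hxb⟩ := hxD
      have e : q - M + M = q := by omega
      exact hxn (q - M) p' (by rwa [e]) (by rwa [e]) (by rwa [e])
    · intro hxB
      simp only [Bad, mem_iUnion] at hxB
      obtain ⟨k, p', hp', hxb⟩ := hxB
      have e : k + (Q + 1) - M + M = k + (Q + 1) := by omega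
      refine hxn (k + (Q + 1) - M) p' (by rwa [e]) ?_ (by rwa [e])
      rintro ⟨_, h⟩
      omega
  · exact (closure_mono (sdiff_subset.trans sdiff_subset)).trans (hcl.trans sdiff_subset)
  · simp
  · intro x hx q hNq hqQ p' hp' hxb
    by_contra hne
    by_cases hqM : q < M
    · apply (hV'U hx).2
      simp only [hC, mem_iUnion, Finset.mem_Ico]
      exact ⟨q, ⟨hNq, hqM⟩, p', hp', hxb⟩
    · apply hx.1.2
      simp only [hD, mem_iUnion, Finset.mem_Icc, Finset.mem_filter]
      exact ⟨q, ⟨by omega, by omega⟩, p', ⟨hp', hne⟩, hxb⟩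
end

section
open Filter Topology
open scoped ENNReal
variable {d : ℕ} {w : Fin d → ℝ} {τ : ℝ}

lemma exists_seq_point (hw0 : ∀ i, 0 < w i) (hτ : 1 < τ) (hwsum : ∑ i, w i = 1)
    (i0 : Fin d) (y : ℕ → Fin d → ℝ) :
    ∃ (x : Fin d → ℝ) (N Q : ℕ → ℕ) (p : ℕ → Fin d → ℤ), x ∈ cube d ∧ (∀ k, x ≠ y k) ∧
      StrictMono N ∧ (∀ k, 0 < N k) ∧ ∀ k, N k ≤ Q k ∧ Q k < N (k + 1) ∧
      x ∈ shell w τ i0 (1 / ((k : ℝ) + 2)) (p k) (Q k) ∧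
      ∀ q, N k ≤ q → q < N (k + 1) → ∀ p' ∈ Ps d q, x ∈ bx w τ p' q → p' = p k ∧ q = Q k := by
  let St := {s : Set (Fin d → ℝ) × ℕ // IsOpen s.1 ∧ s.1 ⊆ cube d ∧ 0 < s.2 ∧
      volume (s.1 \ Bad w τ s.2) ≠ 0}
  have hcube : volume (cube d) = 1 := by
    unfold cube; rw [Real.volume_pi_Ioo]; simp
  have hstep : ∀ (k : ℕ) (s : St), ∃ s' : St, s.1.2 < s'.1.2 ∧ closure s'.1.1 ⊆ s.1.1 ∧
      y k ∉ s'.1.1 ∧ ∃ (Q : ℕ) (p : Fin d → ℤ), s.1.2 ≤ Q ∧ Q < s'.1.2 ∧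
        s'.1.1 ⊆ shell w τ i0 (1 / ((k : ℝ) + 2)) p Q ∧
      ∀ x ∈ s'.1.1, ∀ q, s.1.2 ≤ q → q < s'.1.2 → ∀ p' ∈ Ps d q, x ∈ bx w τ p' q →
        p' = p ∧ q = Q := by
    intro k s
    have hk : (0 : ℝ) ≤ k := Nat.cast_nonneg k
    obtain ⟨V', N', h, hrest⟩ := step hw0 hτ hwsum i0 (ε := 1 / ((k : ℝ) + 2)) (by positivity)
      (by gcongr; linarith) (y k) s.2.1 s.2.2.1 s.2.2.2.1 s.2.2.2.2
    exact ⟨⟨(V', N'), h⟩, hrest⟩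
  choose f hf1 hf2 hf3 fQ fp hf4 hf5 hf6 hf7 using hstep
  obtain ⟨N0, hN0t, hN0⟩ := (((tl_tendsto hτ).eventually (gt_mem_nhds
    (ENNReal.ofReal_pos.2 (by positivity : (0 : ℝ) < 1 / (2 * 4 ^ d))))).and
    (eventually_ge_atTop 1)).exists
  have hinit : volume (cube d \ Bad w τ N0) ≠ 0 := by
    intro h0
    have h1 : volume (cube d) ≤ volume (cube d \ Bad w τ N0) + volume (Bad w τ N0) :=
      (measure_mono (by intro x hx; by_cases hb : x ∈ Bad w τ N0 <;> simp [hx, hb])).trans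
        (measure_union_le _ _)
    rw [h0, zero_add, hcube] at h1
    have h2 : volume (Bad w τ N0) ≤ ENNReal.ofReal (1 / 2) := by
      refine (vol_Bad hwsum hN0).trans ?_
      calc _ ≤ ENNReal.ofReal (4 ^ d) * ENNReal.ofReal (1 / (2 * 4 ^ d)) := by gcongr
        _ = _ := by
          rw [← ENNReal.ofReal_mul (by positivity)]
          congr 1; field_simp
    have h3 := h1.trans h2
    rw [← ENNReal.ofReal_one, ENNReal.ofReal_le_ofReal_iff (by norm_num)] at h3
    norm_num at h3
  let s0 : St := ⟨(cube d, N0), isOpen_set_pi finite_univ fun _ _ => isOpen_Ioo, Subset.rfl,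
    hN0, hinit⟩
  let S : ℕ → St := fun n => Nat.rec s0 (fun k s => f k s) n
  have hS : ∀ n, S (n + 1) = f n (S n) := fun n => rfl
  have hne : ∀ n, (S n).1.1.Nonempty := by
    intro n
    rw [Set.nonempty_iff_ne_empty]
    intro h
    apply (S n).2.2.2.2
    rw [h]; simp
  have hcl : ∀ n, closure (S (n + 1)).1.1 ⊆ (S n).1.1 := fun n => by
    rw [hS]; exact hf2 n (S n)
  have hcomp : IsCompact (closure (S 0).1.1) := by
    apply Bornology.IsBounded.isCompact_closure
    refine Bornology.IsBounded.subset (Metric.isBounded_Icc (0 : Fin d → ℝ) 1) ?_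
    intro x hx
    have hx' := (S 0).2.2.1 hx
    exact ⟨fun i => (hx' i (mem_univ i)).1.le, fun i => (hx' i (mem_univ i)).2.le⟩
  obtain ⟨x, hx⟩ := IsCompact.nonempty_iInter_of_sequence_nonempty_isCompact_isClosed
    (fun n => closure (S n).1.1) (fun n => (hcl n).trans subset_closure)
    (fun n => (hne n).closure) hcomp (fun n => isClosed_closure)
  rw [mem_iInter] at hx
  have hxS : ∀ n, x ∈ (S n).1.1 := fun n => hcl n (hx (n + 1))
  refine ⟨x, fun n => (S n).1.2, fun n => fQ n (S n), fun n => fp n (S n),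
    (S 0).2.2.1 (hxS 0), ?_, strictMono_nat_of_lt_succ fun n => hf1 n (S n),
    fun n => (S n).2.2.2.1, fun n => ⟨hf4 n (S n), hf5 n (S n), hf6 n (S n) (hxS (n + 1)),
      fun q h1 h2 p' hp' hb => hf7 n (S n) x (hxS (n + 1)) q h1 h2 p' hp' hb⟩⟩
  intro k hxk
  apply hf3 k (S k)
  rw [← hxk]
  exact hxS (k + 1)

lemma wNorm_lt_iff_s3 [Nonempty (Fin d)] (hw0 : ∀ i, 0 < w i) {x : Fin d → ℝ} {c : ℝ} :
    wNorm w x < c ↔ ∀ i, |x i| ^ (1 / w i) < c := by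
  unfold wNorm
  constructor
  · intro h i
    exact (le_ciSup (f := fun i => |x i| ^ (1 / w i)) (Set.finite_range _).bddAbove i).trans_lt h
  · intro h
    obtain ⟨i, hi⟩ := exists_eq_ciSup_of_finite (f := fun i => |x i| ^ (1 / w i))
    rw [← hi]; exact h i

lemma wNorm_sol [Nonempty (Fin d)] (hw0 : ∀ i, 0 < w i) {x : Fin d → ℝ} {c : ℝ} (hc : 0 < c)
    {p : Fin d → ℤ} {q : ℕ} (hq : 0 < q) :
    wNorm w (fun i => (q : ℝ) * x i - (p i : ℝ)) < c * (q : ℝ) ^ (-τ) ↔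
      ∀ i, |x i - (p i : ℝ) / q| < c ^ (w i) * rad w τ i q := by
  rw [wNorm_lt_iff_s3 hw0]
  apply forall_congr'
  intro i
  have hq' : (0 : ℝ) < q := by exact_mod_cast hq
  have h1 : |(q : ℝ) * x i - p i| = q * |x i - (p i : ℝ) / q| := by
    rw [← abs_of_pos hq', ← abs_mul, abs_of_pos hq']
    congr 1; field_simp
  have h2 : c ^ (w i) * rad w τ i q * q = (c * (q : ℝ) ^ (-τ)) ^ (w i) := by
    rw [Real.mul_rpow hc.le (by positivity), ← Real.rpow_mul hq'.le, mul_assoc,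
      mul_comm (rad w τ i q), mul_rad hq]
  rw [one_div, Real.rpow_inv_lt_iff_of_pos (abs_nonneg _) (by positivity) (hw0 i), ← h2, h1,
    mul_comm (q : ℝ), mul_lt_mul_iff_left₀ hq']
end

theorem exact_uncountable (d : ℕ) (hd : 1 ≤ d) (w : Fin d → ℝ)
    (hw0 : ∀ i, 0 < w i) (hw1 : ∀ i, w i < 1) (hwmono : Monotone w)
    (hwsum : ∑ i, w i = 1) (τ : ℝ) (hτ : 1 < τ) :
    ¬ (wExact w τ).Countable := by
  intro hcount
  obtain ⟨y, hy⟩ := Set.countable_iff_exists_subset_range.1 hcount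
  let i0 : Fin d := ⟨0, hd⟩
  have hne : Nonempty (Fin d) := ⟨i0⟩
  obtain ⟨x, N, Q, p, hxc, hxy, hmono, hNpos, hk⟩ := exists_seq_point hw0 hτ hwsum i0 y
  suffices hx : x ∈ wExact w τ by
    obtain ⟨k, hk⟩ := hy hx
    exact hxy k hk.symm
  have hε : ∀ k : ℕ, (0 : ℝ) < 1 / ((k : ℝ) + 2) ∧ 1 / ((k : ℝ) + 2) ≤ 1 / 2 := fun k => by
    have : (0 : ℝ) ≤ k := Nat.cast_nonneg k
    exact ⟨by positivity, by gcongr; linarith⟩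
  have hQpos : ∀ k, 0 < Q k := fun k => (hNpos k).trans_le (hk k).1
  have hQmono : StrictMono Q := strictMono_nat_of_lt_succ fun n =>
    (hk n).2.1.trans_le (hk (n + 1)).1
  have hxI : ∀ i, x i ∈ Ico (0 : ℝ) 1 := fun i =>
    ⟨(hxc i (mem_univ i)).1.le, (hxc i (mem_univ i)).2⟩
  refine ⟨⟨hxI, ?_⟩, ?_⟩
  · apply Set.infinite_of_injective_forall_mem (f := fun k => (p k, Q k))
    · intro a b hab
      exact hQmono.injective (Prod.ext_iff.1 hab).2
    · intro k
      refine ⟨hQpos k, ?_⟩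
      rw [wNorm_sol hw0 one_pos (hQpos k)]
      intro i
      rw [Real.one_rpow, one_mul]
      exact shell_sub_bx i0 (hε k).1 (hε k).2 (p k) (hQpos k) (hk k).2.2.1 i
  · intro hU
    simp only [mem_iUnion] at hU
    obtain ⟨c, ⟨hc0, hc1⟩, hxW⟩ := hU
    apply hxW.2
    have hcw : c ^ (w i0) < 1 := Real.rpow_lt_one hc0.le hc1 (hw0 i0)
    obtain ⟨k0, hk0⟩ := exists_nat_one_div_lt (by linarith : 0 < 1 - c ^ (w i0))
    have hfin : (⋃ q ∈ Finset.range (N k0), ((fun p => (p, q)) '' (Ps d q : Set (Fin d → ℤ)))).Finite :=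
      Set.Finite.biUnion (Finset.finite_toSet _) fun q _ => (Finset.finite_toSet _).image _
    refine hfin.subset ?_
    rintro ⟨p', q⟩ ⟨hq, hs⟩
    simp only at hq hs
    rw [wNorm_sol hw0 hc0 hq] at hs
    have hq' : (0 : ℝ) < q := by exact_mod_cast hq
    have hle : ∀ i, |x i - (p' i : ℝ) / q| < rad w τ i q := fun i => by
      refine (hs i).trans_le ?_
      have h1 := Real.rpow_le_one hc0.le hc1.le (hw0 i).le
      have h2 := rad_pos (w := w) (τ := τ) (i := i) hq
      nlinarith
    have hp' : p' ∈ Ps d q := by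
      rw [Ps, Fintype.mem_piFinset]
      intro i
      have h1 := mul_rad_le (w := w) hw0 hτ (i := i) hq
      have h2 := abs_lt.1 (hle i)
      have h3 := hxc i (mem_univ i)
      have h4 : (p' i : ℝ) / q * q = p' i := by field_simp
      have h5 : -1 < (p' i : ℝ) := by
        rw [← h4]
        have h6 := h3.1
        nlinarith [h2.2, mul_pos hq' h6, mul_lt_mul_of_pos_left h2.2 hq']
      have h6 : (p' i : ℝ) < q + 1 := by
        rw [← h4]
        nlinarith [mul_lt_mul_of_pos_left h2.1 hq', mul_lt_mul_of_pos_left h3.2 hq']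
      have h5' : -1 < p' i := by exact_mod_cast h5
      have h6' : p' i < q + 1 := by exact_mod_cast h6
      rw [Finset.mem_Icc]; omega
    simp only [mem_iUnion, Finset.mem_range]
    refine ⟨q, ?_, p', hp', rfl⟩
    by_contra hqN
    push Not at hqN
    -- locate q
    have hex : ∃ k, q < N (k + 1) := ⟨q, (hmono.id_le (q + 1)).trans_lt' (Nat.lt_succ_self q)⟩
    classical
    set k := Nat.find hex with hkd
    have hk1 : q < N (k + 1) := Nat.find_spec hex
    have hk0k : k0 ≤ k := by
      have := hmono.lt_iff_lt.1 (hqN.trans_lt hk1)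
      omega
    have hk2 : N k ≤ q := by
      rcases Nat.eq_zero_or_pos k with h | h
      · have : k = k0 := by omega
        rw [this]; exact hqN
      · have := Nat.find_min hex (m := k - 1) (by omega)
        rw [Nat.sub_add_cancel h] at this
        omega
    obtain ⟨hpp, hqq⟩ := (hk k).2.2.2 q hk2 hk1 p' hp' (mem_bx.2 fun i => (hle i).le)
    have h1 := ((hk k).2.2.1 i0 (mem_univ _)).1
    simp only [if_true] at h1
    have h2 := (abs_lt.1 (hs i0)).2
    rw [hpp, hqq] at h2
    have h3 : c ^ (w i0) ≤ 1 - 1 / ((k : ℝ) + 2) := by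
      have : 1 / ((k : ℝ) + 2) ≤ 1 / ((k0 : ℝ) + 1) := by
        have : (k0 : ℝ) ≤ k := by exact_mod_cast hk0k
        gcongr
        norm_num
      linarith
    have h4 := mul_le_mul_of_nonneg_right h3 (rad_pos (w := w) (τ := τ) (i := i0) (hQpos k)).le
    linarith
end
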